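/- There exists a function sg: ℕ×ℕ → ℕ such that for all integers q ≥ 1 and k ≥ 1 and every q-colorful graph (G,χ), at least one of the following holds: (1) (G,χ) contains some (q,k)-segregated grid as a colorful minor and rtw(G,χ) ≥ k−1; or (2) rtw(G,χ) ≤ sg(q,k). -/

import Mathlib

open SimpleGraph

/-- `(H, ψ)` is a colorful minor of `(G, χ)`. -/
def IsColorfulMinor {q : ℕ} {α β : Type*} (H : SimpleGraph α) (ψ : α → Finset (Fin q))
    (G : SimpleGraph β) (χ : β → Finset (Fin q)) : Prop :=
  ∃ B : α → Set β,
    (∀ v, (G.induce (B v)).Connected) ∧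
    (Pairwise fun u v => Disjoint (B u) (B v)) ∧
    (∀ u v, H.Adj u v → ∃ x ∈ B u, ∃ y ∈ B v, G.Adj x y) ∧
    (∀ v, ∀ c ∈ ψ v, ∃ x ∈ B v, c ∈ χ x)

/-- The `(m × m)`-grid: vertices are pairs `(row, column)`, adjacent when at
`ℓ₁`-distance `1`. -/
def gridGraph (m : ℕ) : SimpleGraph (Fin m × Fin m) :=
  SimpleGraph.fromRel fun a b =>
    (a.1 = b.1 ∧ a.2.val + 1 = b.2.val) ∨ (a.2 = b.2 ∧ a.1.val + 1 = b.1.val)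

/-- The coloring of the `(q,k)`-segregated grid realizing the permutation `π`
(`0`-based): a vertex `(r, c)` carries the single color `π(⌊r/k⌋)` if `c = 0`, and no
color otherwise. -/
def segPalette (q k : ℕ) (π : Equiv.Perm (Fin q))
    (v : Fin (q * k) × Fin (q * k)) : Finset (Fin q) :=
  Finset.univ.filter fun c =>
    v.2.val = 0 ∧ (π.symm c).val * k ≤ v.1.val ∧ v.1.val < ((π.symm c).val + 1) * k

/-- `C` is a connected component of `G − S`. -/
def IsComponentAvoiding {V : Type*} (G : SimpleGraph V) (S C : Set V) : Prop :=
  Disjoint C S ∧ (G.induce C).Connected ∧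
    ∀ x ∈ C, ∀ y, y ∉ S → G.Adj x y → y ∈ C

/-- The torso of `X` in `G`. -/
def torso {V : Type*} (G : SimpleGraph V) (X : Set V) : SimpleGraph X :=
  SimpleGraph.fromRel fun a b =>
    ∃ p : G.Walk a.1 b.1, ∀ v ∈ p.support, v ∉ X ∨ v = a.1 ∨ v = b.1

/-- `(T, β)` is a tree-decomposition of `G`. -/
structure IsTreeDecomp {V ι : Type*} (G : SimpleGraph V) (T : SimpleGraph ι)
    (β : ι → Set V) : Prop where
  isTree : T.IsTree
  covers_vertex : ∀ v : V, ∃ t : ι, v ∈ β t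
  covers_edge : ∀ ⦃u v : V⦄, G.Adj u v → ∃ t : ι, u ∈ β t ∧ v ∈ β t
  bags_connected : ∀ v : V, (T.induce {t : ι | v ∈ β t}).Connected

/-- `G` has treewidth at most `w`. -/
def TreewidthAtMost {V : Type*} (G : SimpleGraph V) (w : ℕ) : Prop :=
  ∃ (m : ℕ) (T : SimpleGraph (Fin m)) (β : Fin m → Set V),
    IsTreeDecomp G T β ∧ ∀ t, (β t).ncard ≤ w + 1

/-- The restrictive treewidth of `(G, χ)` is at most `w`: some vertex set `X` has a
torso of treewidth at most `w` while every component of `G − X` is restricted. -/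
def RtwAtMost {q n : ℕ} (G : SimpleGraph (Fin n)) (χ : Fin n → Finset (Fin q))
    (w : ℕ) : Prop :=
  ∃ X : Set (Fin n), TreewidthAtMost (torso G X) w ∧
    ∀ C : Set (Fin n), IsComponentAvoiding G X C → ∃ c : Fin q, ∀ x ∈ C, c ∉ χ x



open Set
set_option linter.unusedSectionVars false
set_option linter.unusedVariables false


/-! ## Basics: reachability inside a set -/
inductive Rch {V : Type} (G : SimpleGraph V) (S : Set V) : V → V → Prop
  | refl {a : V} (h : a ∈ S) : Rch G S a a
  | step {a b c : V} (h : Rch G S a b) (e : G.Adj b c) (hc : c ∈ S) : Rch G S a c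

namespace Rch
variable {V : Type} {G : SimpleGraph V} {S T : Set V} {a b c : V}

theorem right (h : Rch G S a b) : b ∈ S := by cases h <;> assumption
theorem left (h : Rch G S a b) : a ∈ S := by induction h <;> assumption
theorem trans (h : Rch G S a b) (h' : Rch G S b c) : Rch G S a c := by
  induction h' with
  | refl _ => exact h
  | step _ e hc ih => exact ih.step e hc
theorem edge (ha : a ∈ S) (hb : b ∈ S) (e : G.Adj a b) : Rch G S a b := (refl ha).step e hb
theorem symm (h : Rch G S a b) : Rch G S b a := by
  induction h with
  | refl h => exact refl h
  | step h e hc ih => exact (edge hc h.right e.symm).trans ih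
theorem mono (hST : S ⊆ T) (h : Rch G S a b) : Rch G T a b := by
  induction h with
  | refl h => exact refl (hST h)
  | step h e hc ih => exact ih.step e (hST hc)
theorem monoG {G' : SimpleGraph V} (hG : G ≤ G') (h : Rch G S a b) : Rch G' S a b := by
  induction h with
  | refl h => exact refl h
  | step h e hc ih => exact ih.step (hG e) hc
/-- induction along closed predicate -/
theorem closed (h : Rch G S a b) (P : V → Prop) (ha : P a)
    (hs : ∀ x y, P x → x ∈ S → y ∈ S → G.Adj x y → P y) : P b := by
  induction h with
  | refl h => exact ha
  | step h e hc ih => exact hs _ _ ih h.right hc e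
/-- first exit from a predicate -/
theorem exit (h : Rch G S a b) (P : V → Prop) (ha : P a) (hb : ¬ P b) :
    ∃ x y, P x ∧ ¬ P y ∧ x ∈ S ∧ y ∈ S ∧ G.Adj x y ∧ Rch G (S ∩ {v | P v}) a x := by
  by_contra hcon
  push Not at hcon
  have : P b ∧ Rch G (S ∩ {v | P v}) a b := by
    refine h.closed (fun v => P v ∧ Rch G (S ∩ {v | P v}) a v) ⟨ha, refl ⟨h.left, ha⟩⟩ ?_
    rintro x y ⟨hx, hr⟩ hxS hyS hxy
    have hy : P y := by
      by_contra hy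
      exact hcon x y hx hy hxS hyS hxy hr
    exact ⟨hy, hr.step hxy ⟨hyS, hy⟩⟩
  exact hb this.1
theorem toReach (h : Rch G S a b) :
    (G.induce S).Reachable ⟨a, h.left⟩ ⟨b, h.right⟩ := by
  induction h with
  | refl h => exact Reachable.refl _
  | step h e hc ih =>
    exact ih.trans (SimpleGraph.Adj.reachable (by simpa using e))
theorem ofWalk (p : G.Walk a b) (hp : ∀ v ∈ p.support, v ∈ S) : Rch G S a b := by
  induction p with
  | nil => exact refl (hp _ (by simp))
  | cons e p ih =>
    refine (edge (hp _ (by simp)) (hp _ (by simp)) e).trans (ih ?_)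
    intro v hv; exact hp v (by simp [hv])
theorem toWalk (h : Rch G S a b) : ∃ p : G.Walk a b, ∀ v ∈ p.support, v ∈ S := by
  induction h with
  | refl h => exact ⟨.nil, by simpa using h⟩
  | step h e hc ih =>
    obtain ⟨p, hp⟩ := ih
    refine ⟨p.concat e, ?_⟩
    intro v hv
    rw [Walk.support_concat] at hv
    simp at hv
    rcases hv with hv | rfl
    · exact hp v hv
    · exact hc
end Rch

/-- connected vertex set -/
def Cn {V : Type} (G : SimpleGraph V) (S : Set V) : Prop :=
  S.Nonempty ∧ ∀ a ∈ S, ∀ b ∈ S, Rch G S a b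

theorem cn_iff {V : Type} {G : SimpleGraph V} {S : Set V} :
    Cn G S ↔ (G.induce S).Connected := by
  constructor
  · rintro ⟨⟨x, hx⟩, h⟩
    have : Nonempty S := ⟨⟨x, hx⟩⟩
    refine ⟨?_⟩
    rintro ⟨a, ha⟩ ⟨b, hb⟩
    exact (h a ha b hb).toReach
  · intro h
    obtain ⟨x⟩ := h.nonempty
    refine ⟨⟨x.1, x.2⟩, fun a ha b hb => ?_⟩
    obtain ⟨p⟩ := h.preconnected ⟨a, ha⟩ ⟨b, hb⟩
    have key : ∀ (u v : S) (p : (G.induce S).Walk u v), Rch G S u.1 v.1 := by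
      intro u v p
      induction p with
      | nil => exact Rch.refl (Subtype.property _)
      | cons e p ih => exact (Rch.edge (Subtype.property _) (Subtype.property _) e).trans ih
    exact key _ _ p

namespace Cn
variable {V : Type} {G : SimpleGraph V} {S T : Set V} {a b c : V}

theorem singleton (a : V) : Cn G {a} :=
  ⟨⟨a, rfl⟩, by rintro _ rfl _ rfl; exact Rch.refl rfl⟩
theorem monoG {G' : SimpleGraph V} (hG : G ≤ G') (h : Cn G S) : Cn G' S :=
  ⟨h.1, fun a ha b hb => (h.2 a ha b hb).monoG hG⟩
theorem ofCenter (ha : a ∈ S) (h : ∀ b ∈ S, Rch G S a b) : Cn G S :=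
  ⟨⟨a, ha⟩, fun x hx y hy => (h x hx).symm.trans (h y hy)⟩
theorem union (hS : Cn G S) (hT : Cn G T) (h : (S ∩ T).Nonempty) : Cn G (S ∪ T) := by
  obtain ⟨x, hx, hx'⟩ := h
  refine ofCenter (a := x) (Or.inl hx) ?_
  rintro b (hb | hb)
  · exact (hS.2 x hx b hb).mono subset_union_left
  · exact (hT.2 x hx' b hb).mono subset_union_right
theorem unionAdj (hS : Cn G S) (hT : Cn G T) (ha : a ∈ S) (hb : b ∈ T) (e : G.Adj a b) :
    Cn G (S ∪ T) := by
  refine ofCenter (a := a) (Or.inl ha) ?_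
  rintro c (hc | hc)
  · exact (hS.2 a ha c hc).mono subset_union_left
  · exact (Rch.edge (S := S ∪ T) (Or.inl ha) (Or.inr hb) e).trans
      ((hT.2 b hb c hc).mono subset_union_right)
theorem insert (hS : Cn G S) (ha : a ∈ S) (e : G.Adj a b) : Cn G (insert b S) := by
  have := hS.unionAdj (singleton b) ha rfl e
  rwa [union_comm] at this
theorem comp (ha : a ∈ S) : Cn G {b | Rch G S a b} := by
  refine ofCenter (a := a) (Rch.refl ha) ?_
  intro b hb
  have : ({b | Rch G S a b} : Set V) b ∧ Rch G {b | Rch G S a b} a b := by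
    refine hb.closed (fun v => Rch G S a v ∧ Rch G {b | Rch G S a b} a v)
      ⟨Rch.refl ha, Rch.refl (Rch.refl ha)⟩ ?_
    rintro x y ⟨h1, h2⟩ hx hy hxy
    exact ⟨h1.step hxy hy, h2.step hxy (h1.step hxy hy)⟩
  exact this.2
/-- union of a connected set with connected sets all touching it -/
theorem biUnion {ι : Type} {U : ι → Set V} {I : Set ι} (hS : Cn G S)
    (hU : ∀ i ∈ I, Cn G (U i) ∧ (S ∩ U i).Nonempty) : Cn G (S ∪ ⋃ i ∈ I, U i) := by
  obtain ⟨x, hx⟩ := hS.1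
  refine ofCenter (a := x) (Or.inl hx) ?_
  rintro b (hb | hb)
  · exact (hS.2 x hx b hb).mono subset_union_left
  · simp only [mem_iUnion] at hb
    obtain ⟨i, hi, hb⟩ := hb
    obtain ⟨hc, y, hy, hy'⟩ := hU i hi
    exact ((hS.2 x hx y hy).mono subset_union_left).trans
      ((hc.2 y hy' b hb).mono ((subset_biUnion_of_mem (u := U) hi).trans subset_union_right))
end Cn

/-! ## Menger -/
theorem menger_aux {V : Type} {G : SimpleGraph V} {A B S : Set V} {k : ℕ} {x y : V}
    (h : ∀ T : Set V, T.ncard < k → ∃ a ∈ A, ∃ b ∈ B, Rch G Tᶜ a b)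
    (hno : ∀ a ∈ A, ∀ b ∈ B, ¬ Rch (G.deleteEdges {s(x, y)}) Sᶜ a b)
    (hy : ∀ a ∈ A, ¬ Rch (G.deleteEdges {s(x, y)}) Sᶜ a y) :
    ∀ T : Set V, T.ncard < k → ∃ a ∈ A, ∃ s ∈ insert x S,
      Rch (G.deleteEdges {s(x, y)}) Tᶜ a s := by
  intro T hT
  by_contra hcon
  push Not at hcon
  obtain ⟨a, ha, b, hb, hab⟩ := h T hT
  have key : Rch (G.deleteEdges {s(x, y)}) Sᶜ a b ∧ Rch (G.deleteEdges {s(x, y)}) Tᶜ a b := by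
    refine hab.closed (fun v => Rch (G.deleteEdges {s(x, y)}) Sᶜ a v ∧
      Rch (G.deleteEdges {s(x, y)}) Tᶜ a v) ⟨Rch.refl ?_, Rch.refl hab.left⟩ ?_
    · intro haS
      exact hcon a ha a (Or.inr haS) (Rch.refl hab.left)
    · rintro u w ⟨h1, h2⟩ hu hw huw
      have hux : u ≠ x := by
        rintro rfl; exact hcon a ha u (Or.inl rfl) h2
      have huy : u ≠ y := by
        rintro rfl; exact hy a ha h1
      have hadj : (G.deleteEdges {s(x, y)}).Adj u w := by
        rw [deleteEdges_adj]
        refine ⟨huw, ?_⟩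
        simp [hux, huy]
      have h3 := h2.step hadj hw
      refine ⟨h1.step hadj ?_, h3⟩
      intro hwS
      exact hcon a ha w (Or.inr hwS) h3
  exact hno a ha b hb key.1

theorem menger_end {V : Type} [Finite V] {G : SimpleGraph V} {A S1 : Set V} {k : ℕ}
    {P : Fin k → Set V} (hP : ∀ i, Cn G (P i) ∧ (P i ∩ A).Nonempty ∧ (P i ∩ S1).Nonempty)
    (hd : Pairwise fun i j => Disjoint (P i) (P j)) (hS : S1.ncard ≤ k) :
    ∃ (P' : Fin k → Set V) (p : Fin k → V), (∀ i, Cn G (P' i)) ∧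
      (∀ i, (P' i ∩ A).Nonempty) ∧ (∀ i, p i ∈ P' i) ∧
      (Pairwise fun i j => Disjoint (P' i) (P' j)) ∧ range p = S1 ∧
      (∀ i, ∀ v ∈ P' i, v ≠ p i → ∃ a ∈ A, Rch G S1ᶜ a v) := by
  choose hc hA hS1 using hP
  choose a ha using hA
  choose p hp using hS1
  have hpinj : Function.Injective p := by
    intro i j hij
    by_contra hne
    exact (disjoint_left.1 (hd hne)) (hp i).1 (hij ▸ (hp j).1)
  have hr : range p = S1 := by
    apply eq_of_subset_of_ncard_le
    · rintro _ ⟨i, rfl⟩; exact (hp i).2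
    · rw [← image_univ, ncard_image_of_injective _ hpinj]
      simpa using hS
    · exact toFinite _
  have honly : ∀ i, ∀ v ∈ P i, v ∈ S1 → v = p i := by
    intro i v hv hvS
    rw [← hr] at hvS
    obtain ⟨j, rfl⟩ := hvS
    by_contra hne
    have : i ≠ j := by rintro rfl; exact hne rfl
    exact (disjoint_left.1 (hd this)) hv (hp j).1
  have hsub : ∀ i, {v | Rch G (P i \ {p i}) (a i) v} ∪ {p i} ⊆ P i := by
    rintro i v (hv | rfl)
    · exact (Rch.right hv).1
    · exact (hp i).1
  refine ⟨fun i => {v | Rch G (P i \ {p i}) (a i) v} ∪ {p i}, p, ?_, ?_, ?_, ?_, hr, ?_⟩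
  · intro i
    by_cases hai : a i = p i
    · have : {v | Rch G (P i \ {p i}) (a i) v} = ∅ := by
        ext v; simp only [mem_ofPred_eq, mem_empty_iff_false, iff_false]
        intro hv; exact hv.left.2 hai
      show Cn G ({v | Rch G (P i \ {p i}) (a i) v} ∪ {p i})
      rw [this, empty_union]; exact Cn.singleton _
    · have h1 : a i ∈ P i \ {p i} := ⟨(ha i).1, hai⟩
      obtain ⟨x, y, hx, hy, hxP, hyP, hxy, hr⟩ :=
        ((hc i).2 (a i) (ha i).1 (p i) (hp i).1).exit (fun v => Rch G (P i \ {p i}) (a i) v)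
          (Rch.refl h1) (fun h => h.right.2 rfl)
      have : y = p i := by
        by_contra hne
        exact hy (hx.step hxy ⟨hyP, hne⟩)
      subst this
      exact (Cn.comp h1).unionAdj (Cn.singleton _) hx rfl hxy
  · intro i
    refine ⟨a i, ?_, (ha i).2⟩
    by_cases hai : a i = p i
    · right; exact hai
    · left; exact Rch.refl ⟨(ha i).1, hai⟩
  · intro i; right; rfl
  · intro i j hij
    exact (hd hij).mono (hsub i) (hsub j)
  · rintro i v (hv | hv) hne
    · refine ⟨a i, (ha i).2, hv.mono ?_⟩
      rintro u ⟨hu, hu'⟩ huS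
      exact hu' (honly i u hu huS)
    · exact absurd hv hne

theorem menger_sets {V : Type} [Finite V] (n : ℕ) : ∀ (G : SimpleGraph V), G.edgeSet.ncard = n →
    ∀ (A B : Set V) (k : ℕ),
    (∀ T : Set V, T.ncard < k → ∃ a ∈ A, ∃ b ∈ B, Rch G Tᶜ a b) →
    ∃ W : Fin k → Set V, (∀ i, Cn G (W i) ∧ (W i ∩ A).Nonempty ∧ (W i ∩ B).Nonempty) ∧
      Pairwise fun i j => Disjoint (W i) (W j) := by
  induction n using Nat.strong_induction_on with
  | _ n ih =>
  intro G hG A B k h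
  by_cases hE : G.edgeSet = ∅
  · have hk : k ≤ (A ∩ B).ncard := by
      by_contra hlt
      push Not at hlt
      obtain ⟨a, ha, b, hb, hab⟩ := h _ hlt
      have : b = a := hab.closed (fun v => v = a) rfl (by
        rintro x y rfl hx hy hxy
        have : s(x, y) ∈ G.edgeSet := hxy
        rw [hE] at this; exact this.elim)
      subst this
      exact hab.left ⟨ha, hb⟩
    obtain ⟨g, hg⟩ : ∃ g : Fin k → (A ∩ B : Set V), Function.Injective g := by
      have : Fintype (A ∩ B : Set V) := Fintype.ofFinite _
      have h2 : Fintype.card (Fin k) ≤ Fintype.card (A ∩ B : Set V) := by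
        rw [Fintype.card_fin, Fintype.card_eq_nat_card]; exact hk
      obtain ⟨g⟩ := Function.Embedding.nonempty_of_card_le h2
      exact ⟨g, g.injective⟩
    refine ⟨fun i => {(g i).1}, fun i => ⟨Cn.singleton _, ⟨g i, rfl, (g i).2.1⟩,
      ⟨g i, rfl, (g i).2.2⟩⟩, ?_⟩
    intro i j hij
    simp only [disjoint_singleton]
    intro he
    exact hij (hg (Subtype.ext he))
  · obtain ⟨e, he⟩ := nonempty_iff_ne_empty.2 hE
    have hlt : (G.deleteEdges {e}).edgeSet.ncard < n := by
      rw [← hG]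
      apply ncard_lt_ncard _ (toFinite _)
      rw [edgeSet_deleteEdges]
      refine ⟨sdiff_subset, fun hs => (hs he).2 rfl⟩
    by_cases hH : ∀ T : Set V, T.ncard < k → ∃ a ∈ A, ∃ b ∈ B, Rch (G.deleteEdges {e}) Tᶜ a b
    · obtain ⟨W, hW, hd⟩ := ih _ hlt _ rfl A B k hH
      exact ⟨W, fun i => ⟨(hW i).1.monoG (deleteEdges_le _), (hW i).2⟩, hd⟩
    push Not at hH
    obtain ⟨S, hSk, hno⟩ := hH
    obtain ⟨a0, ha0, b0, hb0, hab⟩ := h S hSk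
    obtain ⟨x, y, ⟨a1, ha1, hx⟩, hy, hxS, hyS, hxy, -⟩ :=
      hab.exit (fun v => ∃ a ∈ A, Rch (G.deleteEdges {e}) Sᶜ a v)
        ⟨a0, ha0, Rch.refl hab.left⟩ (by rintro ⟨a, ha, h'⟩; exact hno a ha b0 hb0 h')
    push Not at hy
    have hexy : e = s(x, y) := by
      by_contra hne
      refine hy a1 ha1 (hx.step ?_ hyS)
      rw [deleteEdges_adj]
      exact ⟨hxy, fun h' => hne (by simpa using h'.symm)⟩
    subst hexy
    have hxB : ∀ b ∈ B, ¬ Rch (G.deleteEdges {s(x, y)}) Sᶜ b x := by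
      intro b hb h'
      exact hno a1 ha1 b hb (hx.trans h'.symm)
    have h1 := menger_aux h hno hy
    have h2 : ∀ T : Set V, T.ncard < k → ∃ b ∈ B, ∃ s ∈ insert y S,
        Rch (G.deleteEdges {s(x, y)}) Tᶜ b s := by
      rw [Sym2.eq_swap] at hno hxB ⊢
      refine menger_aux (B := A) ?_ ?_ hxB
      · intro T hT
        obtain ⟨a, ha, b, hb, h'⟩ := h T hT
        exact ⟨b, hb, a, ha, h'.symm⟩
      · intro b hb a ha h'
        exact hno a ha b hb h'.symm
    obtain ⟨P0, hP0, hP0d⟩ := ih _ hlt _ rfl A (insert x S) k h1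
    obtain ⟨Q0, hQ0, hQ0d⟩ := ih _ hlt _ rfl B (insert y S) k h2
    obtain ⟨P, p, hPc, hPA, hpP, hPd, hpr, hPo⟩ := menger_end hP0 hP0d
      ((ncard_insert_le _ _).trans hSk)
    obtain ⟨Q, q, hQc, hQB, hqQ, hQd, hqr, hQo⟩ := menger_end hQ0 hQ0d
      ((ncard_insert_le _ _).trans hSk)
    have hpinj : Function.Injective p := by
      intro i j hij
      by_contra hne
      exact (disjoint_left.1 (hPd hne)) (hpP i) (hij ▸ (hpP j))
    have hmatch : ∀ i, ∃ j, (p i = x ∧ q j = y) ∨ (p i ∈ S ∧ q j = p i) := by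
      intro i
      have : p i ∈ insert x S := hpr ▸ mem_range_self i
      rcases this with hi | hi
      · have : y ∈ range q := by rw [hqr]; exact Or.inl rfl
        obtain ⟨j, hj⟩ := this
        exact ⟨j, Or.inl ⟨hi, hj⟩⟩
      · have : p i ∈ range q := by rw [hqr]; exact Or.inr hi
        obtain ⟨j, hj⟩ := this
        exact ⟨j, Or.inr ⟨hi, hj⟩⟩
    choose σ hσ using hmatch
    have hσinj : Function.Injective σ := by
      intro i j hij
      rcases hσ i with ⟨h1, h2⟩ | ⟨h1, h2⟩ <;> rcases hσ j with ⟨h3, h4⟩ | ⟨h3, h4⟩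
      · exact hpinj (h1.trans h3.symm)
      · rw [hij, h4] at h2; rw [h2] at h3; exact absurd h3 hyS
      · rw [hij, h4] at h2; rw [← h2] at h1; exact absurd h1 hyS
      · rw [hij, h4] at h2; exact hpinj h2.symm
    have hxney : x ≠ y := hxy.ne
    have hPo' : ∀ i, ∀ v ∈ P i, v ≠ p i → ∃ a ∈ A, Rch (G.deleteEdges {s(x, y)}) Sᶜ a v := by
      intro i v hv hne
      obtain ⟨a, ha, h'⟩ := hPo i v hv hne
      exact ⟨a, ha, h'.mono (compl_subset_compl.2 (subset_insert _ _))⟩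
    have hQo' : ∀ i, ∀ v ∈ Q i, v ≠ q i → ∃ a ∈ B, Rch (G.deleteEdges {s(x, y)}) Sᶜ a v := by
      intro i v hv hne
      obtain ⟨a, ha, h'⟩ := hQo i v hv hne
      exact ⟨a, ha, h'.mono (compl_subset_compl.2 (subset_insert _ _))⟩
    have hcross : ∀ i j v, v ∈ P i → v ∈ Q (σ j) → i = j := by
      intro i j v hvP hvQ
      by_cases e1 : v = p i
      · by_cases e2 : v = q (σ j)
        · rcases hσ j with ⟨h3, h4⟩ | ⟨h3, h4⟩
          · have : p i ∈ insert x S := hpr ▸ mem_range_self i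
            rw [← e1, e2, h4] at this
            rcases this with h5 | h5
            · exact absurd h5.symm hxney
            · exact absurd h5 hyS
          · exact hpinj (by rw [← e1, e2, h4])
        · obtain ⟨b, hb, h'⟩ := hQo' _ v hvQ e2
          have : p i ∈ insert x S := hpr ▸ mem_range_self i
          rw [← e1] at this
          rcases this with h5 | h5
          · subst h5; exact absurd h' (hxB b hb)
          · exact absurd h5 h'.right
      · obtain ⟨a, ha, h'⟩ := hPo' _ v hvP e1
        by_cases e2 : v = q (σ j)
        · have : q (σ j) ∈ insert y S := hqr ▸ mem_range_self (σ j)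
          rw [← e2] at this
          rcases this with h5 | h5
          · subst h5; exact absurd h' (hy a ha)
          · exact absurd h5 h'.right
        · obtain ⟨b, hb, h''⟩ := hQo' _ v hvQ e2
          exact absurd (h'.trans h''.symm) (hno a ha b hb)
    refine ⟨fun i => P i ∪ Q (σ i), fun i => ⟨?_, ?_, ?_⟩, ?_⟩
    · have c1 := (hPc i).monoG (G.deleteEdges_le {s(x, y)})
      have c2 := (hQc (σ i)).monoG (G.deleteEdges_le {s(x, y)})
      rcases hσ i with ⟨h3, h4⟩ | ⟨h3, h4⟩
      · exact c1.unionAdj c2 (hpP i) (hqQ (σ i)) (by rw [h3, h4]; exact hxy)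
      · exact c1.union c2 ⟨p i, hpP i, h4 ▸ hqQ (σ i)⟩
    · exact (hPA i).mono (inter_subset_inter_left _ subset_union_left)
    · exact (hQB (σ i)).mono (inter_subset_inter_left _ subset_union_right)
    · intro i j hij
      rw [Set.disjoint_left]
      rintro v (hv | hv) (hv' | hv')
      · exact disjoint_left.1 (hPd hij) hv hv'
      · exact hij (hcross i j v hv hv')
      · exact hij (hcross j i v hv' hv).symm
      · exact disjoint_left.1 (hQd (hσinj.ne hij)) hv hv'

/-- a family of `d` disjoint induced-ish paths from `A` to `B`, given by functions. -/
structure Lk {V : Type} (G : SimpleGraph V) (A B : Set V) (d : ℕ) (f : Fin d → ℕ → V)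
    (len : Fin d → ℕ) : Prop where
  st : ∀ j, f j 0 ∈ A
  fin : ∀ j, f j (len j) ∈ B
  adj : ∀ j t, t < len j → G.Adj (f j t) (f j (t + 1))
  inj : ∀ j t j' t', t ≤ len j → t' ≤ len j' → f j t = f j' t' → j = j' ∧ t = t'
  trA : ∀ j t, t ≤ len j → f j t ∈ A → t = 0
  trB : ∀ j t, t ≤ len j → f j t ∈ B → t = len j

/-- vertex set of the `j`-th path -/
def PS {V : Type} {d : ℕ} (f : Fin d → ℕ → V) (len : Fin d → ℕ) (j : Fin d) : Set V :=
  {v | ∃ t, t ≤ len j ∧ f j t = v}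

theorem Rch.ofSeq {V : Type} {G : SimpleGraph V} {S : Set V} {f : ℕ → V} {a b : ℕ} (hab : a ≤ b)
    (hS : ∀ t, a ≤ t → t ≤ b → f t ∈ S) (hadj : ∀ t, a ≤ t → t < b → G.Adj (f t) (f (t + 1))) :
    Rch G S (f a) (f b) := by
  induction b, hab using Nat.le_induction with
  | base => exact Rch.refl (hS a le_rfl le_rfl)
  | succ b hb ih =>
    exact (ih (fun t h1 h2 => hS t h1 (by omega)) (fun t h1 h2 => hadj t h1 (by omega))).step
      (hadj b hb (by omega)) (hS _ (by omega) le_rfl)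

theorem Cn.ofSeq {V : Type} {G : SimpleGraph V} {f : ℕ → V} {a b : ℕ} (hab : a ≤ b)
    (hadj : ∀ t, a ≤ t → t < b → G.Adj (f t) (f (t + 1))) :
    Cn G {v | ∃ t, a ≤ t ∧ t ≤ b ∧ f t = v} := by
  refine Cn.ofCenter (a := f a) ⟨a, le_rfl, hab, rfl⟩ ?_
  rintro _ ⟨t, h1, h2, rfl⟩
  exact Rch.ofSeq h1 (fun s h3 h4 => ⟨s, h3, h4.trans h2, rfl⟩)
    (fun s h3 h4 => hadj s h3 (by omega))

theorem shortest {V : Type} {G : SimpleGraph V} {A B W : Set V} (hW : Cn G W)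
    (hA : (W ∩ A).Nonempty) (hB : (W ∩ B).Nonempty) :
    ∃ (f : ℕ → V) (n : ℕ), f 0 ∈ A ∧ f n ∈ B ∧ (∀ t, t ≤ n → f t ∈ W) ∧
      (∀ t, t < n → G.Adj (f t) (f (t + 1))) ∧
      (∀ t t', t ≤ n → t' ≤ n → f t = f t' → t = t') ∧
      (∀ t, t ≤ n → f t ∈ A → t = 0) ∧ (∀ t, t ≤ n → f t ∈ B → t = n) := by
  classical
  have hex : ∃ n, ∃ f : ℕ → V, f 0 ∈ A ∧ f n ∈ B ∧ (∀ t, t ≤ n → f t ∈ W) ∧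
      (∀ t, t < n → G.Adj (f t) (f (t + 1))) := by
    obtain ⟨a, haW, haA⟩ := hA
    obtain ⟨b, hbW, hbB⟩ := hB
    obtain ⟨p, hp⟩ := (hW.2 a haW b hbW).toWalk
    exact ⟨p.length, p.getVert, by simpa using haA, by simpa using hbB,
      fun t _ => hp _ (p.getVert_mem_support t), fun t ht => p.adj_getVert_succ ht⟩
  obtain ⟨f, h0, hn, hfW, hadj⟩ := Nat.find_spec hex
  have hmin := fun m (hm : m < Nat.find hex) => Nat.find_min hex hm
  set n := Nat.find hex
  refine ⟨f, n, h0, hn, hfW, hadj, ?_, ?_, ?_⟩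
  · have key : ∀ t t', t < t' → t' ≤ n → f t ≠ f t' := by
      intro t t' htt ht' he
      refine hmin (n - (t' - t)) (by omega) ⟨fun s => if s ≤ t then f s else f (s + (t' - t)),
        by simpa using h0, ?_, ?_, ?_⟩
      · by_cases h : n - (t' - t) ≤ t
        · have h1 : n = t' := by omega
          have h2 : n - (t' - t) = t := by omega
          simp only [h2, le_refl, if_true]
          rw [he, ← h1]; exact hn
        · simp only [h, if_false]
          rw [Nat.sub_add_cancel (by omega)]; exact hn
      · intro s hs
        dsimp only
        split_ifs with h
        · exact hfW _ (by omega)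
        · exact hfW _ (by omega)
      · intro s hs
        dsimp only
        split_ifs with h h' h'
        · exact hadj _ (by omega)
        · have : s = t := by omega
          subst this
          rw [he, show s + 1 + (t' - s) = t' + 1 by omega]
          exact hadj _ (by omega)
        · omega
        · rw [show s + 1 + (t' - t) = s + (t' - t) + 1 by omega]
          exact hadj _ (by omega)
    intro t t' ht ht' he
    rcases lt_trichotomy t t' with h | h | h
    · exact absurd he (key t t' h ht')
    · exact h
    · exact absurd he.symm (key t' t h ht)
  · intro t ht htA
    by_contra h
    refine hmin (n - t) (by omega) ⟨fun s => f (s + t), by simpa using htA, ?_, ?_, ?_⟩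
    · dsimp only; rw [Nat.sub_add_cancel ht]; exact hn
    · intro s hs; exact hfW _ (by omega)
    · intro s hs
      dsimp only
      rw [show s + 1 + t = s + t + 1 by omega]
      exact hadj _ (by omega)
  · intro t ht htB
    by_contra h
    exact hmin t (by omega) ⟨f, h0, htB, fun s hs => hfW _ (by omega), fun s hs => hadj _ (by omega)⟩

theorem menger {V : Type} [Finite V] {G : SimpleGraph V} {A B : Set V} {k : ℕ}
    (h : ∀ T : Set V, T.ncard < k → ∃ a ∈ A, ∃ b ∈ B, Rch G Tᶜ a b) :
    ∃ f len, Lk G A B k f len := by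
  obtain ⟨W, hW, hd⟩ := menger_sets _ G rfl A B k h
  choose f len h1 h2 h3 h4 h5 h6 h7 using fun i => shortest (hW i).1 (hW i).2.1 (hW i).2.2
  refine ⟨f, len, h1, h2, h4, ?_, h6, h7⟩
  intro j t j' t' ht ht' he
  have : j = j' := by
    by_contra hne
    exact disjoint_left.1 (hd hne) (h3 j t ht) (he ▸ h3 j' t' ht')
  subst this
  exact ⟨rfl, h5 j t t' ht ht' he⟩


section comps
variable {V : Type} {G : SimpleGraph V} {Y Y' C D : Set V} {a b : V}

theorem Rch.subset_comp (hC : IsComponentAvoiding G Y C) (ha : a ∈ C) (h : Rch G Yᶜ a b) : b ∈ C :=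
  h.closed (fun v => v ∈ C) ha (fun x y hx _ hy hxy => hC.2.2 x hx y hy hxy)

theorem comp_cn (hC : IsComponentAvoiding G Y C) : Cn G C := cn_iff.2 hC.2.1

theorem comp_mk (hd : Disjoint C Y) (hc : Cn G C)
    (hcl : ∀ x ∈ C, ∀ y, y ∉ Y → G.Adj x y → y ∈ C) : IsComponentAvoiding G Y C :=
  ⟨hd, cn_iff.1 hc, hcl⟩

theorem comp_of (ha : a ∉ Y) : IsComponentAvoiding G Y {b | Rch G Yᶜ a b} := by
  refine comp_mk ?_ (Cn.comp ha) ?_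
  · rw [Set.disjoint_left]; intro x hx; exact Rch.right hx
  · intro x hx y hy hxy
    exact Rch.step hx hxy hy

/-- connected set avoiding `Y` that meets a component is inside it -/
theorem Cn.sub_comp (hD : Cn G D) (hDY : Disjoint D Y) (hC : IsComponentAvoiding G Y C)
    (hm : (D ∩ C).Nonempty) : D ⊆ C := by
  obtain ⟨x, hx, hxC⟩ := hm
  intro y hy
  refine Rch.subset_comp hC hxC ((hD.2 x hx y hy).mono ?_)
  exact subset_compl_iff_disjoint_right.2 hDY

theorem comp_eq (hC : IsComponentAvoiding G Y C) (hD : IsComponentAvoiding G Y D)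
    (hm : (D ∩ C).Nonempty) : D = C :=
  subset_antisymm ((comp_cn hD).sub_comp hD.1 hC hm)
    ((comp_cn hC).sub_comp hC.1 hD (by rwa [inter_comm]))

/-- open neighbourhood -/
def Nb (G : SimpleGraph V) (C : Set V) : Set V := {y | y ∉ C ∧ ∃ x ∈ C, G.Adj x y}

theorem Nb_sub (hC : IsComponentAvoiding G Y C) : Nb G C ⊆ Y := by
  rintro y ⟨hy, x, hx, hxy⟩
  by_contra h
  exact hy (hC.2.2 x hx y h hxy)

theorem comp_of_Nb (hC : Cn G C) (hd : Disjoint C Y) (hN : Nb G C ⊆ Y) :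
    IsComponentAvoiding G Y C := by
  refine comp_mk hd hC ?_
  intro x hx y hy hxy
  by_contra h
  exact hy (hN ⟨h, x, hx, hxy⟩)

end comps

/-- havens -/
structure Hav {V : Type} (G : SimpleGraph V) (w : ℕ) (β : Set V → Set V) : Prop where
  comp : ∀ Y : Set V, Y.ncard ≤ w → IsComponentAvoiding G Y (β Y)
  mono : ∀ Y Y' : Set V, Y ⊆ Y' → Y'.ncard ≤ w → β Y' ⊆ β Y

theorem Hav.le {V : Type} {G : SimpleGraph V} {w w' : ℕ} {β : Set V → Set V} (h : Hav G w β)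
    (hw : w' ≤ w) : Hav G w' β :=
  ⟨fun Y hY => h.comp Y (hY.trans hw), fun Y Y' hs hY => h.mono Y Y' hs (hY.trans hw)⟩

/-! ## Part I : large restrictive treewidth gives a rainbow haven -/
theorem leaf_tree {m : ℕ} (T : SimpleGraph (Fin m)) (hT : T.IsTree) (t : Fin m) :
    ∃ T' : SimpleGraph (Fin (m + 1)), T'.IsTree ∧
      (∀ a b, T.Adj a b → T'.Adj a.castSucc b.castSucc) ∧ T'.Adj t.castSucc (Fin.last m) := by
  classical
  have hne : t.castSucc ≠ Fin.last m := (Fin.castSucc_lt_last t).ne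
  let T' := T.map Fin.castSuccEmb ⊔ edge t.castSucc (Fin.last m)
  have h1 : ∀ a b, T.Adj a b → T'.Adj a.castSucc b.castSucc := by
    intro a b h
    left
    rw [map_adj]
    exact ⟨a, b, h, rfl, rfl⟩
  have h2 : T'.Adj t.castSucc (Fin.last m) := by
    right
    rw [edge_adj]
    exact ⟨Or.inl ⟨rfl, rfl⟩, hne⟩
  have hconn : T'.Connected := by
    have hr : ∀ a b : Fin m, T'.Reachable a.castSucc b.castSucc := by
      intro a b
      exact (hT.1.preconnected a b).map ⟨Fin.castSucc, fun {a b} h => h1 a b h⟩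
    have hl : ∀ a, T'.Reachable t.castSucc a := by
      intro a
      refine Fin.lastCases ?_ (fun i => hr t i) a
      exact h2.reachable
    exact ⟨fun a b => (hl a).symm.trans (hl b)⟩
  refine ⟨T', isTree_iff_connected_and_card.2 ⟨hconn, ?_⟩, h1, h2⟩
  have hlow := hconn.card_vert_le_card_edgeSet_add_one
  have hcT := (isTree_iff_connected_and_card.1 hT).2
  have hle : T'.edgeSet.ncard ≤ T.edgeSet.ncard + 1 := by
    have e1 : T'.edgeSet = (Fin.castSuccEmb.sym2Map '' T.edgeSet) ∪
        (edge t.castSucc (Fin.last m)).edgeSet := by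
      rw [← SimpleGraph.edgeSet_map, ← edgeSet_sup]
    rw [e1, edgeSet_edge_of_ne hne]
    refine (ncard_union_le _ _).trans ?_
    rw [ncard_singleton]
    exact Nat.add_le_add_right (ncard_image_le (toFinite _)) 1
  have e2 : Nat.card T'.edgeSet = T'.edgeSet.ncard := rfl
  have e3 : Nat.card T.edgeSet = T.edgeSet.ncard := rfl
  simp only [Nat.card_eq_fintype_card, Fintype.card_fin] at hlow hcT ⊢
  rw [← Nat.card_eq_fintype_card] at hlow hcT ⊢
  omega

structure TSt {V : Type} (G : SimpleGraph V) (w : ℕ) (R : Set V → Prop) (m : ℕ)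
    (T : SimpleGraph (Fin m)) (β : Fin m → Set V) (X : Set V) : Prop where
  tree : T.IsTree
  size : ∀ t, (β t).ncard ≤ 4 * w + 1
  sub : ∀ t, β t ⊆ X
  edge : ∀ u v, u ∈ X → v ∈ X → G.Adj u v → ∃ t, u ∈ β t ∧ v ∈ β t
  conn : ∀ v ∈ X, Cn T {t | v ∈ β t}
  comps : ∀ J, IsComponentAvoiding G X J → (∃ t, Nb G J ⊆ β t) ∧ (R J ∨ (Nb G J).ncard ≤ 3 * w)

theorem tst_step {V : Type} [Finite V] {G : SimpleGraph V} {w : ℕ} {R : Set V → Prop} {m : ℕ}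
    {T : SimpleGraph (Fin m)} {β : Fin m → Set V} {X J Y : Set V} (h : TSt G w R m T β X)
    (hJ : IsComponentAvoiding G X J) (hJw : (Nb G J).ncard ≤ 3 * w) (hYJ : Y ⊆ J)
    (hYw : Y.ncard ≤ w + 1)
    (hgood : ∀ D, IsComponentAvoiding G (X ∪ Y) D → D ⊆ J → R D ∨ (Nb G D).ncard ≤ 3 * w) :
    ∃ T' β', TSt G w R (m + 1) T' β' (X ∪ Y) := by
  obtain ⟨⟨t, ht⟩, -⟩ := h.comps J hJ
  obtain ⟨T', hT', hadj, hlast⟩ := leaf_tree T h.tree t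
  have hYX : ∀ y ∈ Y, y ∉ X := fun y hy => Set.disjoint_left.1 hJ.1 (hYJ hy)
  have hNX : Nb G J ⊆ X := Nb_sub hJ
  refine ⟨T', Fin.snoc (α := fun _ => Set V) β (Nb G J ∪ Y), hT', ?_, ?_, ?_, ?_, ?_⟩
  · intro s
    refine Fin.lastCases ?_ (fun i => ?_) s
    · rw [Fin.snoc_last]
      have := ncard_union_le (Nb G J) Y
      omega
    · rw [Fin.snoc_castSucc]; exact h.size i
  · intro s
    refine Fin.lastCases ?_ (fun i => ?_) s
    · rw [Fin.snoc_last]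
      exact union_subset_union_left _ hNX
    · rw [Fin.snoc_castSucc]; exact (h.sub i).trans subset_union_left
  · have key : ∀ u v, u ∈ Y → v ∈ X ∪ Y → G.Adj u v → v ∈ Nb G J ∪ Y := by
      rintro u v hu (hv | hv) huv
      · left
        exact ⟨fun hvJ => Set.disjoint_left.1 hJ.1 hvJ hv, u, hYJ hu, huv⟩
      · exact Or.inr hv
    rintro u v (hu | hu) hv huv
    · rcases hv with hv | hv
      · obtain ⟨s, h1, h2⟩ := h.edge u v hu hv huv
        exact ⟨s.castSucc, by rwa [Fin.snoc_castSucc], by rwa [Fin.snoc_castSucc]⟩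
      · refine ⟨Fin.last m, ?_, ?_⟩ <;> rw [Fin.snoc_last]
        · exact key v u hv (Or.inl hu) huv.symm
        · exact Or.inr hv
    · refine ⟨Fin.last m, ?_, ?_⟩ <;> rw [Fin.snoc_last]
      · exact Or.inr hu
      · exact key u v hu hv huv
  · rintro v hv
    by_cases hvX : v ∈ X
    · have hc := h.conn v hvX
      have him : ∀ a b, Rch T {t | v ∈ β t} a b →
          Rch T' {t | v ∈ (Fin.snoc (α := fun _ => Set V) β (Nb G J ∪ Y) : Fin (m+1) → Set V) t}
            a.castSucc b.castSucc := by
        intro a b hab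
        induction hab with
        | refl h => exact Rch.refl (by simpa [Fin.snoc_castSucc] using h)
        | step _ e hc ih => exact ih.step (hadj _ _ e) (by simpa [Fin.snoc_castSucc] using hc)
      by_cases hvN : v ∈ Nb G J
      · have htv : v ∈ β t := ht hvN
        refine Cn.ofCenter (a := t.castSucc) (by simpa [Fin.snoc_castSucc] using htv) ?_
        intro b
        refine Fin.lastCases ?_ (fun i => ?_) b
        · intro hb
          exact Rch.edge (by simpa [Fin.snoc_castSucc] using htv) hb hlast
        · intro hi
          exact him _ _ (hc.2 t htv i (by simpa [Fin.snoc_castSucc] using hi))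
      · obtain ⟨s, hs⟩ := hc.1
        refine Cn.ofCenter (a := s.castSucc) (by simpa [Fin.snoc_castSucc] using hs) ?_
        intro b
        refine Fin.lastCases ?_ (fun i => ?_) b
        · intro hb
          exfalso
          have hb' : v ∈ Nb G J ∪ Y := by simpa [Fin.snoc_last] using hb
          rcases hb' with hb | hb
          · exact hvN hb
          · exact hYX v hb hvX
        · intro hi
          exact him _ _ (hc.2 s hs i (by simpa [Fin.snoc_castSucc] using hi))
    · have hvY : v ∈ Y := hv.resolve_left hvX
      refine Cn.ofCenter (a := Fin.last m) (by
        rw [mem_ofPred_eq, Fin.snoc_last]; exact Or.inr hvY) ?_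
      intro b
      refine Fin.lastCases ?_ (fun i => ?_) b
      · intro hb; exact Rch.refl hb
      · intro hb
        have hb' : v ∈ β i := by simpa [Fin.snoc_castSucc] using hb
        exact absurd (h.sub i hb') hvX
  · intro D hD
    obtain ⟨d, hd⟩ := (comp_cn hD).1
    have hdX : d ∉ X := fun h' => Set.disjoint_left.1 hD.1 hd (Or.inl h')
    have hDX : Disjoint D X := hD.1.mono_right subset_union_left
    by_cases hdJ : d ∈ J
    · have hDJ : D ⊆ J := (comp_cn hD).sub_comp hDX hJ ⟨d, hd, hdJ⟩
      refine ⟨⟨Fin.last m, ?_⟩, hgood D hD hDJ⟩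
      rw [Fin.snoc_last]
      intro y hy
      have hyXY := Nb_sub hD hy
      rcases hyXY with hyX | hyY
      · left
        obtain ⟨_, x, hx, hxy⟩ := hy
        exact ⟨fun hyJ => Set.disjoint_left.1 hJ.1 hyJ hyX, x, hDJ hx, hxy⟩
      · exact Or.inr hyY
    · have hDX' : IsComponentAvoiding G X D := by
        refine comp_mk hDX (comp_cn hD) ?_
        intro x hx y hy hxy
        refine hD.2.2 x hx y ?_ hxy
        rintro (h' | h')
        · exact hy h'
        · have hxX : x ∉ X := Set.disjoint_left.1 hDX hx
          have hxJ : x ∈ J := hJ.2.2 y (hYJ h') x hxX hxy.symm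
          exact hdJ ((comp_cn hD).sub_comp hDX hJ ⟨x, hx, hxJ⟩ hd)
      obtain ⟨⟨s, hs⟩, h2⟩ := h.comps D hDX'
      exact ⟨⟨s.castSucc, by rwa [Fin.snoc_castSucc]⟩, h2⟩

theorem tst_haven {V : Type} [Finite V] {G : SimpleGraph V} {w : ℕ} (hw : 1 ≤ w)
    {R : Set V → Prop} (hR : ∀ C C', C ⊆ C' → R C' → R C) {X J : Set V}
    (hJ : IsComponentAvoiding G X J) (hJw : (Nb G J).ncard ≤ 3 * w)
    (hbad : ∀ Y, Y ⊆ J → Y.Nonempty → Y.ncard ≤ w + 1 → ∃ D, IsComponentAvoiding G (X ∪ Y) D ∧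
      D ⊆ J ∧ ¬ R D ∧ 3 * w < (Nb G D).ncard) :
    ∃ β, Hav G w β ∧ ∀ Y : Set V, Y.ncard ≤ w → ¬ R (β Y) := by
  classical
  obtain ⟨c, hc⟩ := (comp_cn hJ).1
  have hex : ∀ Y : Set V, ∃ C, Y.ncard ≤ w → IsComponentAvoiding G Y C ∧ ¬ R C ∧
      (Nb G J).ncard < 2 * (C ∩ Nb G J).ncard := by
    intro Y
    by_cases hY : Y.ncard ≤ w
    swap
    · exact ⟨∅, fun h => absurd h hY⟩
    obtain ⟨D, hD, hDJ, hDR, hDw⟩ := hbad (insert c (Y ∩ J))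
      (insert_subset hc inter_subset_right) ⟨c, Or.inl rfl⟩ (by
        have h1 := ncard_insert_le c (Y ∩ J)
        have h2 : (Y ∩ J).ncard ≤ Y.ncard := ncard_le_ncard inter_subset_left (toFinite _)
        omega)
    obtain ⟨d, hd⟩ := (comp_cn hD).1
    have hDY : ∀ x ∈ D, x ∉ Y := fun x hx hxY =>
      Set.disjoint_left.1 hD.1 hx (Or.inr (Or.inr ⟨hxY, hDJ hx⟩))
    refine ⟨{b | Rch G Yᶜ d b}, fun _ => ⟨comp_of (hDY d hd), ?_, ?_⟩⟩
    · have hDsub : D ⊆ {b | Rch G Yᶜ d b} := fun x hx => ((comp_cn hD).2 d hd x hx).mono hDY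
      exact fun h => hDR (hR _ _ hDsub h)
    · have hsub : Nb G D ⊆ ({b | Rch G Yᶜ d b} ∩ Nb G J) ∪ insert c Y := by
        intro y hy
        by_cases hyY : y ∈ Y
        · right; right; exact hyY
        rcases Nb_sub hD hy with hyX | hyc | hyYJ
        · left
          obtain ⟨_, x, hx, hxy⟩ := hy
          refine ⟨?_, ?_, x, hDJ hx, hxy⟩
          · exact Rch.step (((comp_cn hD).2 d hd x hx).mono hDY) hxy hyY
          · exact fun h => Set.disjoint_left.1 hJ.1 h hyX
        · right; left; exact hyc
        · exact absurd hyYJ.1 hyY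
      have h1 := ncard_le_ncard hsub (toFinite _)
      have h2 := ncard_union_le ({b | Rch G Yᶜ d b} ∩ Nb G J) (insert c Y)
      have h3 := ncard_insert_le c Y
      omega
  choose β hβ using hex
  have hmeet : ∀ C D : Set V, (Nb G J).ncard < 2 * (C ∩ Nb G J).ncard →
      (Nb G J).ncard < 2 * (D ∩ Nb G J).ncard → (C ∩ D).Nonempty := by
    intro C D h1 h2
    by_contra hne
    rw [not_nonempty_iff_eq_empty] at hne
    have h3 : Disjoint (C ∩ Nb G J) (D ∩ Nb G J) := by
      rw [Set.disjoint_left]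
      intro x hx hx'
      have : x ∈ C ∩ D := ⟨hx.1, hx'.1⟩
      rw [hne] at this; exact this
    have h4 := ncard_union_eq h3 (toFinite _) (toFinite _)
    have h5 : ((C ∩ Nb G J) ∪ (D ∩ Nb G J)).ncard ≤ (Nb G J).ncard :=
      ncard_le_ncard (union_subset inter_subset_right inter_subset_right) (toFinite _)
    omega
  refine ⟨β, ⟨fun Y hY => (hβ Y hY).1, ?_⟩, fun Y hY => (hβ Y hY).2.1⟩
  intro Y Y' hs hY'
  have hY : Y.ncard ≤ w := (ncard_le_ncard hs (toFinite _)).trans hY'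
  exact (comp_cn (hβ Y' hY').1).sub_comp ((hβ Y' hY').1.1.mono_right hs) (hβ Y hY).1
    (hmeet _ _ (hβ Y' hY').2.2 (hβ Y hY).2.2)

theorem tst_main {V : Type} [Finite V] {G : SimpleGraph V} {w : ℕ} (hw : 1 ≤ w)
    {R : Set V → Prop} (hR : ∀ C C', C ⊆ C' → R C' → R C)
    (hno : ¬ ∃ β, Hav G w β ∧ ∀ Y : Set V, Y.ncard ≤ w → ¬ R (β Y)) (n : ℕ) :
    ∀ (m : ℕ) (T : SimpleGraph (Fin m)) (β : Fin m → Set V) (X : Set V), TSt G w R m T β X →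
      Xᶜ.ncard = n → ∃ m T β X, TSt G w R m T β X ∧ ∀ J, IsComponentAvoiding G X J → R J := by
  induction n using Nat.strong_induction_on with
  | _ n ih =>
  intro m T β X h hn
  by_cases hall : ∀ J, IsComponentAvoiding G X J → R J
  · exact ⟨m, T, β, X, h, hall⟩
  push Not at hall
  obtain ⟨J, hJ, hJR⟩ := hall
  have hJw := (h.comps J hJ).2.resolve_left hJR
  by_cases hbad : ∀ Y, Y ⊆ J → Y.Nonempty → Y.ncard ≤ w + 1 → ∃ D,
      IsComponentAvoiding G (X ∪ Y) D ∧ D ⊆ J ∧ ¬ R D ∧ 3 * w < (Nb G D).ncard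
  · exact absurd (tst_haven hw hR hJ hJw hbad) hno
  push Not at hbad
  obtain ⟨Y, hYJ, ⟨y, hy⟩, hYw, hgood⟩ := hbad
  obtain ⟨T', β', h'⟩ := tst_step h hJ hJw hYJ hYw (by
    intro D hD hDJ
    by_cases hRD : R D
    · exact Or.inl hRD
    · exact Or.inr (hgood D hD hDJ hRD))
  refine ih _ ?_ _ _ _ _ h' rfl
  rw [← hn]
  apply ncard_lt_ncard _ (toFinite _)
  refine ⟨compl_subset_compl.2 subset_union_left, fun hs => ?_⟩
  have hyX : y ∉ X := Set.disjoint_left.1 hJ.1 (hYJ hy)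
  exact hs hyX (Or.inr hy)

theorem tst_tw {V : Type} [Finite V] {G : SimpleGraph V} {w : ℕ} {R : Set V → Prop} {m : ℕ}
    {T : SimpleGraph (Fin m)} {β : Fin m → Set V} {X : Set V} (h : TSt G w R m T β X) :
    TreewidthAtMost (torso G X) (4 * w) := by
  have hedge : ∀ (a b : X), a ≠ b → (∃ p : G.Walk a.1 b.1, ∀ v ∈ p.support, v ∉ X ∨ v = a.1 ∨ v = b.1) →
      ∃ t, a.1 ∈ β t ∧ b.1 ∈ β t := by
    rintro ⟨a, ha⟩ ⟨b, hb⟩ hab ⟨p, hp⟩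
    have hab' : a ≠ b := fun h => hab (Subtype.ext h)
    dsimp only at p hp ⊢
    have hr : Rch G {v | v ∉ X ∨ v = a ∨ v = b} a b := Rch.ofWalk p hp
    obtain ⟨x, y, hx, hy, hxS, hyS, hxy, hbx⟩ := hr.symm.exit (fun v => v ≠ a) hab'.symm (by simp)
    have hya : y = a := not_not.1 hy
    subst hya
    by_cases hxb : x = b
    · subst hxb
      exact h.edge y x ha hb hxy.symm
    have hxX : x ∉ X := by
      rcases hxS with h' | h' | h'
      · exact h'
      · exact absurd h' hx
      · exact absurd h' hxb
    have hJ := comp_of (G := G) hxX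
    set J := {b | Rch G Xᶜ x b} with hJdef
    have hxJ : x ∈ J := Rch.refl hxX
    obtain ⟨u, z, hu, hz, huS, hzS, huz, -⟩ := hbx.symm.exit (fun v => v ∈ J) hxJ
      (fun h' => Set.disjoint_left.1 hJ.1 h' hb)
    have hzb : z = b := by
      rcases hzS.1 with h' | h' | h'
      · exact absurd (hJ.2.2 u hu z h' huz) hz
      · exact absurd h' hzS.2
      · exact h'
    subst hzb
    obtain ⟨⟨t, ht⟩, -⟩ := h.comps J hJ
    exact ⟨t, ht ⟨fun h' => Set.disjoint_left.1 hJ.1 h' ha, x, hxJ, hxy⟩, ht ⟨hz, u, hu, huz⟩⟩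
  refine ⟨m, T, fun t => {x | x.1 ∈ β t}, ⟨h.tree, ?_, ?_, ?_⟩, ?_⟩
  · intro v
    obtain ⟨t, ht⟩ := (h.conn v.1 v.2).1
    exact ⟨t, ht⟩
  · intro u v huv
    rw [torso, fromRel_adj] at huv
    obtain ⟨hne, h' | h'⟩ := huv
    · exact hedge u v hne h'
    · obtain ⟨t, h1, h2⟩ := hedge v u hne.symm h'
      exact ⟨t, h2, h1⟩
  · intro v
    exact cn_iff.1 (h.conn v.1 v.2)
  · intro t
    refine le_trans ?_ (h.size t)
    exact ncard_le_ncard_of_injOn Subtype.val (fun x hx => hx) Subtype.val_injective.injOn (toFinite _)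

theorem rtw_haven {q n : ℕ} (G : SimpleGraph (Fin n)) (χ : Fin n → Finset (Fin q)) (w : ℕ)
    (hw : 1 ≤ w) (h : ¬ RtwAtMost G χ (4 * w)) :
    ∃ β, Hav G w β ∧ ∀ Y : Set (Fin n), Y.ncard ≤ w → ∀ c, ∃ x ∈ β Y, c ∈ χ x := by
  by_contra hno
  have h0 : TSt G w (fun C => ∃ c, ∀ x ∈ C, c ∉ χ x) 1 (⊥ : SimpleGraph (Fin 1)) (fun _ => ∅) ∅ := by
    refine ⟨?_, by simp, by simp, by simp, by simp, ?_⟩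
    · exact ⟨⟨fun a b => by rw [Subsingleton.elim a b]⟩, isAcyclic_bot⟩
    · intro J hJ
      have : Nb G J = ∅ := subset_empty_iff.1 (Nb_sub hJ)
      rw [this]; simp
  obtain ⟨m, T, β, X, hX, hall⟩ := tst_main hw (by
      rintro C C' hs ⟨c, hc⟩
      exact ⟨c, fun x hx => hc x (hs hx)⟩) (by
      rintro ⟨β, h1, h2⟩
      refine hno ⟨β, h1, fun Y hY c => ?_⟩
      have := h2 Y hY
      push Not at this
      exact this c) _ 1 _ _ _ h0 rfl
  exact h ⟨X, tst_tw hX, hall⟩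


/-! ## Uncrossing, free coloured sets -/
theorem uncross {V : Type} [Finite V] {G : SimpleGraph V} {w s : ℕ} {β : Set V → Set V}
    (hβ : Hav G w β) (hs : 2 * s ≤ w) {Z Y1 Y2 : Set V}
    (hZ : ∀ Y : Set V, Y.ncard < s → (β Y ∩ Z).Nonempty)
    (h1 : Y1.ncard ≤ s) (h2 : Y2.ncard ≤ s) (d1 : Disjoint (β Y1) Z) (d2 : Disjoint (β Y2) Z) :
    ∃ Y3 : Set V, Y3.ncard ≤ s ∧ β Y3 ⊆ β Y1 ∩ β Y2 := by
  have c1 := hβ.comp Y1 (by omega)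
  have c2 := hβ.comp Y2 (by omega)
  have hU : (Y1 ∪ Y2).ncard ≤ w := by
    have := ncard_union_le Y1 Y2
    omega
  have cU := hβ.comp _ hU
  have sub1 : β (Y1 ∪ Y2) ⊆ β Y1 := hβ.mono _ _ subset_union_left hU
  have sub2 : β (Y1 ∪ Y2) ⊆ β Y2 := hβ.mono _ _ subset_union_right hU
  obtain ⟨u, hu⟩ := (comp_cn cU).1
  have n1 : ∀ x, x ∈ β Y1 → x ∉ Y1 := fun x h => Set.disjoint_left.1 c1.1 h
  have n2 : ∀ x, x ∈ β Y2 → x ∉ Y2 := fun x h => Set.disjoint_left.1 c2.1 h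
  have sY4 : (Y1 \ β Y2) ∪ (Y2 \ β Y1) ⊆ Y1 ∪ Y2 :=
    union_subset_union sdiff_subset sdiff_subset
  have sY3 : (Y1 ∩ β Y2) ∪ (Y2 ∩ β Y1) ∪ (Y1 ∩ Y2) ⊆ Y1 ∪ Y2 := by
    rintro x ((⟨h, _⟩ | ⟨h, _⟩) | ⟨h, _⟩)
    · exact Or.inl h
    · exact Or.inr h
    · exact Or.inl h
  have w4 := (ncard_le_ncard sY4 (toFinite _)).trans hU
  have w3 := (ncard_le_ncard sY3 (toFinite _)).trans hU
  have e4 : β ((Y1 \ β Y2) ∪ (Y2 \ β Y1)) = β Y1 ∪ β Y2 := by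
    refine comp_eq ?_ (hβ.comp _ w4) ⟨u, hβ.mono _ _ sY4 hU hu, Or.inl (sub1 hu)⟩
    refine comp_mk ?_ ((comp_cn c1).union (comp_cn c2) ⟨u, sub1 hu, sub2 hu⟩) ?_
    · rw [Set.disjoint_left]
      rintro x (hx | hx) (⟨h, h'⟩ | ⟨h, h'⟩)
      · exact n1 x hx h
      · exact h' hx
      · exact h' hx
      · exact n2 x hx h
    · rintro x (hx | hx) y hy hxy
      · by_cases hy1 : y ∈ Y1
        · by_cases hy2 : y ∈ β Y2
          · exact Or.inr hy2
          · exact absurd (Or.inl ⟨hy1, hy2⟩) hy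
        · exact Or.inl (c1.2.2 x hx y hy1 hxy)
      · by_cases hy1 : y ∈ Y2
        · by_cases hy2 : y ∈ β Y1
          · exact Or.inl hy2
          · exact absurd (Or.inr ⟨hy1, hy2⟩) hy
        · exact Or.inr (c2.2.2 x hx y hy1 hxy)
  have k4 : s ≤ ((Y1 \ β Y2) ∪ (Y2 \ β Y1)).ncard := by
    by_contra hlt
    obtain ⟨x, hx, hxZ⟩ := hZ _ (not_le.1 hlt)
    rw [e4] at hx
    rcases hx with hx | hx
    · exact Set.disjoint_left.1 d1 hx hxZ
    · exact Set.disjoint_left.1 d2 hx hxZ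
  refine ⟨(Y1 ∩ β Y2) ∪ (Y2 ∩ β Y1) ∪ (Y1 ∩ Y2), ?_, ?_⟩
  · have a1 := ncard_inter_add_ncard_sdiff_eq_ncard Y1 (β Y2) (toFinite _)
    have a2 := ncard_inter_add_ncard_sdiff_eq_ncard Y2 (β Y1) (toFinite _)
    have a3 := ncard_union_add_ncard_inter (Y1 \ β Y2) (Y2 \ β Y1) (toFinite _) (toFinite _)
    have a4 : (Y1 \ β Y2) ∩ (Y2 \ β Y1) = Y1 ∩ Y2 := by
      ext x
      constructor
      · rintro ⟨⟨h, _⟩, h', _⟩; exact ⟨h, h'⟩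
      · rintro ⟨h, h'⟩
        exact ⟨⟨h, fun h'' => n2 x h'' h'⟩, h', fun h'' => n1 x h'' h⟩
    rw [a4] at a3
    have a5 := ncard_union_le ((Y1 ∩ β Y2) ∪ (Y2 ∩ β Y1)) (Y1 ∩ Y2)
    have a6 := ncard_union_le (Y1 ∩ β Y2) (Y2 ∩ β Y1)
    omega
  · intro x hx
    have c3 := hβ.comp _ w3
    have hu3 := hβ.mono _ _ sY3 hU hu
    have hr := (comp_cn c3).2 u hu3 x hx
    refine hr.closed (fun v => v ∈ β Y1 ∩ β Y2) ⟨sub1 hu, sub2 hu⟩ ?_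
    rintro a b ⟨ha1, ha2⟩ _ hb hab
    have hb3 := Set.disjoint_left.1 c3.1 hb
    by_cases hb1 : b ∈ Y1
    · by_cases hb2 : b ∈ Y2
      · exact absurd (Or.inr ⟨hb1, hb2⟩) hb3
      · exact absurd (Or.inl (Or.inl ⟨hb1, c2.2.2 a ha2 b hb2 hab⟩)) hb3
    · have hbb := c1.2.2 a ha1 b hb1 hab
      by_cases hb2 : b ∈ Y2
      · exact absurd (Or.inl (Or.inr ⟨hb2, hbb⟩)) hb3
      · exact ⟨hbb, c2.2.2 a ha2 b hb2 hab⟩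

/-- minimal separations: there is a least `β Y` missing `Z` -/
theorem uncross_min {V : Type} [Finite V] {G : SimpleGraph V} {w s : ℕ} {β : Set V → Set V}
    (hβ : Hav G w β) (hs : 2 * s ≤ w) {Z : Set V}
    (hZ : ∀ Y : Set V, Y.ncard < s → (β Y ∩ Z).Nonempty) (hZs : Z.ncard ≤ s) :
    ∃ Y0 : Set V, Y0.ncard ≤ s ∧ Disjoint (β Y0) Z ∧
      ∀ Y : Set V, Y.ncard ≤ s → Disjoint (β Y) Z → β Y0 ⊆ β Y := by
  classical
  have hex : ∃ n, ∃ Y : Set V, Y.ncard ≤ s ∧ Disjoint (β Y) Z ∧ (β Y).ncard = n :=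
    ⟨_, Z, hZs, (hβ.comp Z (by omega)).1, rfl⟩
  obtain ⟨Y0, h0, d0, e0⟩ := Nat.find_spec hex
  refine ⟨Y0, h0, d0, ?_⟩
  intro Y hY dY
  obtain ⟨Y3, h3, hsub⟩ := uncross hβ hs hZ h0 hY d0 dY
  have hle : (β Y0).ncard ≤ (β Y3).ncard := by
    rw [e0]
    exact Nat.find_min' hex ⟨Y3, h3, d0.mono_left (hsub.trans inter_subset_left), rfl⟩
  have := eq_of_subset_of_ncard_le (hsub.trans inter_subset_left) hle (toFinite _)
  rw [← this]
  exact hsub.trans inter_subset_right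

def Free {V : Type} (β : Set V → Set V) (Z : Set V) : Prop :=
  ∀ Y : Set V, Y.ncard < Z.ncard → (β Y ∩ Z).Nonempty

theorem free_extend {V : Type} [Finite V] {G : SimpleGraph V} {w : ℕ} {β : Set V → Set V}
    (hβ : Hav G w β) {Z P : Set V} (hs : 2 * Z.ncard ≤ w) (hZ : Free β Z)
    (hP : ∀ Y : Set V, Y.ncard ≤ w → (β Y ∩ P).Nonempty) :
    ∃ v ∈ P, v ∉ Z ∧ Free β (insert v Z) := by
  obtain ⟨Y0, h0, d0, hmin⟩ := uncross_min hβ hs hZ le_rfl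
  obtain ⟨v, hv, hvP⟩ := hP Y0 (by omega)
  have hvZ : v ∉ Z := Set.disjoint_left.1 d0 hv
  refine ⟨v, hvP, hvZ, ?_⟩
  intro Y hY
  rw [ncard_insert_of_notMem hvZ] at hY
  by_contra hne
  rw [not_nonempty_iff_eq_empty, ← disjoint_iff_inter_eq_empty] at hne
  have := hmin Y (by omega) (hne.mono_right (subset_insert _ _)) hv
  exact Set.disjoint_left.1 hne this (Or.inl rfl)

theorem free_coloured {V : Type} [Finite V] {G : SimpleGraph V} {w q : ℕ} {β : Set V → Set V}
    (hβ : Hav G w β) (χ : V → Finset (Fin q))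
    (hP : ∀ Y : Set V, Y.ncard ≤ w → ∀ c, ∃ x ∈ β Y, c ∈ χ x) (N : ℕ) (hN : 2 * N ≤ w) :
    ∀ col : Fin N → Fin q, ∃ z : Fin N → V, Function.Injective z ∧ (∀ i, col i ∈ χ (z i)) ∧
      Free β (range z) := by
  induction N with
  | zero =>
    intro col
    refine ⟨fun i => i.elim0, fun i => i.elim0, fun i => i.elim0, ?_⟩
    intro Y hY
    have : range (fun i : Fin 0 => (i.elim0 : V)) = ∅ := range_eq_empty _
    rw [this] at hY
    simp at hY
  | succ N ih =>
    intro col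
    obtain ⟨z, hinj, hcol, hfree⟩ := ih (by omega) (fun i => col i.castSucc)
    have hcard : (range z).ncard = N := by
      rw [← image_univ, ncard_image_of_injective _ hinj]; simp
    obtain ⟨v, hvP, hvZ, hf⟩ := free_extend hβ (P := {x | col (Fin.last N) ∈ χ x})
      (by rw [hcard]; omega) hfree (by
        intro Y hY
        obtain ⟨x, hx, hc⟩ := hP Y hY (col (Fin.last N))
        exact ⟨x, hx, hc⟩)
    refine ⟨Fin.snoc (α := fun _ => V) z v, ?_, ?_, ?_⟩
    · rw [Fin.snoc_injective_iff]
      exact ⟨hinj, hvZ⟩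
    · intro i
      refine Fin.lastCases ?_ (fun i => ?_) i
      · simpa using hvP
      · simpa using hcol i
    · rw [Fin.range_snoc]; exact hf


/-! ## Models and the linking lemma -/
structure Mdl {W V : Type} (H : SimpleGraph W) (G : SimpleGraph V) (μ : W → Set V) : Prop where
  cn : ∀ x, Cn G (μ x)
  dis : ∀ x y v, v ∈ μ x → v ∈ μ y → x = y
  adj : ∀ x y, H.Adj x y → ∃ u ∈ μ x, ∃ v ∈ μ y, G.Adj u v

def prj {W V : Type} (μ : W → Set V) (Y : Set V) : Set W := {x | (μ x ∩ Y).Nonempty}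

/-- the haven induced in `G` by a model -/
def indH {W V : Type} (G : SimpleGraph V) (μ : W → Set V) (βH : Set W → Set W) (Y : Set V) :
    Set V := {v | ∃ x ∈ βH (prj μ Y), ∃ u ∈ μ x, Rch G Yᶜ u v}

section
variable {W V : Type} [Finite W] [Finite V] {H : SimpleGraph W} {G : SimpleGraph V}
  {μ : W → Set V} {βH : Set W → Set W} {s w : ℕ}

theorem prj_card (hμ : Mdl H G μ) (Y : Set V) : (prj μ Y).ncard ≤ Y.ncard := by
  classical
  have : ∀ x : W, ∃ v, x ∈ prj μ Y → v ∈ μ x ∩ Y := by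
    intro x
    by_cases h : x ∈ prj μ Y
    · obtain ⟨v, hv⟩ := h; exact ⟨v, fun _ => hv⟩
    · obtain ⟨v, -⟩ := (hμ.cn x).1; exact ⟨v, fun h' => absurd h' h⟩
  choose g hg using this
  refine ncard_le_ncard_of_injOn g (fun x hx => (hg x hx).2) ?_ (toFinite _)
  intro x hx y hy hxy
  exact hμ.dis x y (g x) (hg x hx).1 (hxy ▸ (hg y hy).1)

theorem indH_hav (hμ : Mdl H G μ) (hβ : Hav H w βH) : Hav G w (indH G μ βH) := by
  have hmono : ∀ Y Y' : Set V, Y ⊆ Y' → prj μ Y ⊆ prj μ Y' := by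
    rintro Y Y' hs x ⟨v, hv, hv'⟩; exact ⟨v, hv, hs hv'⟩
  refine ⟨?_, ?_⟩
  · intro Y hY
    have hc := hβ.comp _ ((prj_card hμ Y).trans hY)
    have hdis : ∀ x ∈ βH (prj μ Y), μ x ⊆ Yᶜ := by
      intro x hx v hv hvY
      exact Set.disjoint_left.1 hc.1 hx ⟨v, hv, hvY⟩
    have key : ∀ x y, Rch H (βH (prj μ Y)) x y → ∀ u ∈ μ x, ∀ v ∈ μ y, Rch G Yᶜ u v := by
      intro x y hxy
      induction hxy with
      | refl h => intro u hu v hv; exact ((hμ.cn _).2 u hu v hv).mono (hdis _ h)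
      | step h e hc' ih =>
        intro u hu v hv
        obtain ⟨a, ha, b, hb, hab⟩ := hμ.adj _ _ e
        exact ((ih u hu a ha).step hab (hdis _ hc' hb)).trans
          (((hμ.cn _).2 b hb v hv).mono (hdis _ hc'))
    obtain ⟨x, hx⟩ := (comp_cn hc).1
    obtain ⟨u, hu⟩ := (hμ.cn x).1
    have e : indH G μ βH Y = {v | Rch G Yᶜ u v} := by
      ext v
      constructor
      · rintro ⟨y, hy, u', hu', h⟩
        exact (key x y ((comp_cn hc).2 x hx y hy) u hu u' hu').trans h
      · intro h; exact ⟨x, hx, u, hu, h⟩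
    rw [e]
    exact comp_of (hdis x hx hu)
  · rintro Y Y' hs hY' v ⟨x, hx, u, hu, h⟩
    exact ⟨x, hβ.mono _ _ (hmono _ _ hs) ((prj_card hμ Y').trans hY') hx, u, hu,
      h.mono (compl_subset_compl.2 hs)⟩

theorem mu_sub_indH (hμ : Mdl H G μ) (hβ : Hav H w βH) {Y : Set V} (hY : Y.ncard ≤ w) {x : W}
    (hx : x ∈ βH (prj μ Y)) : μ x ⊆ indH G μ βH Y := by
  intro v hv
  refine ⟨x, hx, v, hv, Rch.refl ?_⟩
  intro hvY
  exact Set.disjoint_left.1 (hβ.comp _ ((prj_card hμ Y).trans hY)).1 hx ⟨v, hv, hvY⟩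
end

/-- quotient graph -/
def quo {V V' : Type} (G : SimpleGraph V) (f : V → V') : SimpleGraph V' where
  Adj a b := a ≠ b ∧ ∃ x y, f x = a ∧ f y = b ∧ G.Adj x y
  symm := ⟨fun _ _ ⟨h, x, y, hx, hy, hxy⟩ => ⟨h.symm, y, x, hy, hx, hxy.symm⟩⟩
  loopless := ⟨fun _ h => h.1 rfl⟩

theorem Rch.quo {V V' : Type} {G : SimpleGraph V} {f : V → V'} {S : Set V} {S' : Set V'}
    (hS : ∀ x ∈ S, f x ∈ S') {a b : V} (h : Rch G S a b) : Rch (quo G f) S' (f a) (f b) := by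
  induction h with
  | refl h => exact Rch.refl (hS _ h)
  | @step b c h e hc ih =>
    by_cases hbc : f b = f c
    · rw [← hbc]; exact ih
    · exact ih.step ⟨hbc, b, c, rfl, rfl, e⟩ (hS _ hc)

theorem Rch.lift {V V' : Type} {G : SimpleGraph V} {f : V → V'}
    (hf : ∀ x y, f x = f y → x = y ∨ G.Adj x y) {S' : Set V'} {a b : V'}
    (h : Rch (_root_.quo G f) S' a b) : ∀ a' b', f a' = a → f b' = b →
      Rch G (f ⁻¹' S') a' b' := by
  induction h with
  | refl h =>
    intro a' b' ha hb
    have h1 : a' ∈ f ⁻¹' S' := by simpa [ha] using h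
    have h2 : b' ∈ f ⁻¹' S' := by simpa [hb] using h
    rcases hf a' b' (ha.trans hb.symm) with h3 | h3
    · subst h3; exact Rch.refl h1
    · exact Rch.edge h1 h2 h3
  | step h e hc ih =>
    intro a' c' ha hc'
    obtain ⟨_, x, y, hx, hy, hxy⟩ := e
    have h1 : y ∈ f ⁻¹' S' := by simpa [hy] using hc
    have h2 : c' ∈ f ⁻¹' S' := by simpa [hc'] using hc
    have h3 := (ih a' x ha hx).step hxy h1
    rcases hf y c' (hy.trans hc'.symm) with h4 | h4
    · subst h4; exact h3
    · exact h3.step h4 h2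

/-- conclusion of the linking lemma -/
def LinkConcl {W V : Type} (H : SimpleGraph W) (βH : Set W → Set W) (G : SimpleGraph V) (s : ℕ)
    (z : Fin s → V) : Prop :=
  ∃ YH : Set W, YH.ncard ≤ s ∧ ∀ Q : Set W, Q ⊆ βH YH →
    (∀ S : Set W, S.ncard < s → (Q ∩ βH S).Nonempty) →
    ∃ (ν : W → Set V) (b : Fin s → W), (∀ x ∈ Q, Cn G (ν x)) ∧
      (∀ x ∈ Q, ∀ y ∈ Q, ∀ v, v ∈ ν x → v ∈ ν y → x = y) ∧
      (∀ x ∈ Q, ∀ y ∈ Q, H.Adj x y → ∃ u ∈ ν x, ∃ v ∈ ν y, G.Adj u v) ∧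
      Function.Injective b ∧ (∀ i, b i ∈ Q ∧ z i ∈ ν (b i) ∧ ∃ y, y ∉ Q ∧ H.Adj (b i) y)

theorem linking_final {W V : Type} [Finite W] [Finite V] {H : SimpleGraph W} {βH : Set W → Set W}
    {s : ℕ} (hβ : Hav H (2 * s) βH) {G : SimpleGraph V} {μ : W → Set V} (hμ : Mdl H G μ)
    {z : Fin s → V} (hz : Function.Injective z)
    (hC : ∀ Y : Set V, Y.ncard < s → (indH G μ βH Y ∩ range z).Nonempty) {Y0 : Set V}
    (hY0 : Y0.ncard ≤ s) (hd0 : Disjoint (indH G μ βH Y0) (range z))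
    (hedge : ∀ u ∈ indH G μ βH Y0, ∀ v, G.Adj u v →
      ∃ x y, x ≠ y ∧ u ∈ μ x ∧ v ∈ μ y ∧ H.Adj x y) :
    LinkConcl H βH G s z := by
  classical
  refine ⟨prj μ Y0, (prj_card hμ Y0).trans hY0, ?_⟩
  intro Q hQ hQS
  have hQR : ∀ x ∈ Q, μ x ⊆ indH G μ βH Y0 := fun x hx =>
    mu_sub_indH hμ hβ (by omega) (hQ hx)
  have hsing : ∀ x ∈ Q, ∀ u ∈ μ x, ∀ v ∈ μ x, u = v := by
    intro x hx u hu v hv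
    by_contra hne
    obtain ⟨a, b, ha, hb, haS, hbS, hab, -⟩ := ((hμ.cn x).2 u hu v hv).exit (fun t => t = u) rfl
      (fun h => hne h.symm)
    obtain ⟨x', y', hne', hx', hy', -⟩ := hedge a (hQR x hx haS) b hab
    exact hne' ((hμ.dis x' x a hx' haS).trans (hμ.dis y' x b hy' hbS).symm)
  obtain ⟨f, len, hL⟩ := menger (G := G) (A := range z) (B := ⋃ x ∈ Q, μ x) (k := s) (by
    intro T hT
    obtain ⟨v, hv, hvZ⟩ := hC T hT
    obtain ⟨x, hxQ, hx⟩ := hQS (prj μ T) ((prj_card hμ T).trans_lt hT)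
    obtain ⟨u, hu⟩ := (hμ.cn x).1
    have hcomp := (indH_hav hμ hβ).comp T (by omega)
    have hu' := mu_sub_indH hμ hβ (by omega) hx hu
    refine ⟨v, hvZ, u, mem_biUnion hxQ hu, ((comp_cn hcomp).2 v hv u hu').mono ?_⟩
    exact subset_compl_iff_disjoint_right.2 hcomp.1)
  -- index of start
  choose σ hσ using fun j => hL.st j
  have hσinj : Function.Injective σ := by
    intro i j hij
    have : f i 0 = f j 0 := by rw [← hσ i, ← hσ j, hij]
    exact (hL.inj i 0 j 0 (Nat.zero_le _) (Nat.zero_le _) this).1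
  have hσbij := Finite.injective_iff_bijective.1 hσinj
  obtain ⟨τ, hτ1, hτ2⟩ := Function.bijective_iff_has_inverse.1 hσbij
  have hend : ∀ j, ∃ x ∈ Q, f j (len j) ∈ μ x := by
    intro j
    have := hL.fin j
    simp only [mem_iUnion] at this
    obtain ⟨x, hx, h⟩ := this
    exact ⟨x, hx, h⟩
  choose e heQ he using hend
  have hpos : ∀ j, 0 < len j := by
    intro j
    rw [Nat.pos_iff_ne_zero]
    intro h0
    have h1 := hQR _ (heQ j) (he j)
    rw [h0] at h1
    exact Set.disjoint_left.1 hd0 h1 (hL.st j)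
  have hmeet : ∀ j x v, x ∈ Q → v ∈ PS f len j → v ∈ μ x → v = f j (len j) ∧ x = e j := by
    rintro j x _ hx ⟨t, ht, rfl⟩ hv
    have h1 := hL.trB j t ht (mem_biUnion hx hv)
    subst h1
    exact ⟨rfl, hμ.dis _ _ _ hv (he j)⟩
  have heinj : Function.Injective e := by
    intro i j hij
    have h1 := hsing (e i) (heQ i) _ (he i) (f j (len j)) (hij ▸ he j)
    exact (hL.inj i _ j _ le_rfl le_rfl h1).1
  have hPScn : ∀ j, Cn G (PS f len j) := by
    intro j
    have := Cn.ofSeq (G := G) (f := f j) (Nat.zero_le (len j)) (fun t _ ht => hL.adj j t ht)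
    convert this using 1
    ext v; constructor
    · rintro ⟨t, h1, h2⟩; exact ⟨t, Nat.zero_le _, h1, h2⟩
    · rintro ⟨t, _, h1, h2⟩; exact ⟨t, h1, h2⟩
  refine ⟨fun x => μ x ∪ ⋃ j ∈ {j | e j = x}, PS f len j, fun i => e (τ i), ?_, ?_, ?_, ?_, ?_⟩
  · intro x hx
    refine (hμ.cn x).biUnion ?_
    rintro j rfl
    exact ⟨hPScn j, f j (len j), he j, len j, le_rfl, rfl⟩
  · intro x hx y hy v hvx hvy
    have hP : ∀ x, v ∈ (μ x ∪ ⋃ j ∈ {j | e j = x}, PS f len j) →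
        v ∈ μ x ∨ ∃ j, e j = x ∧ v ∈ PS f len j := by
      rintro x (h | h)
      · exact Or.inl h
      · simp only [mem_iUnion] at h
        obtain ⟨j, hj, h⟩ := h
        exact Or.inr ⟨j, hj, h⟩
    rcases hP x hvx with h1 | ⟨j, rfl, h1⟩ <;> rcases hP y hvy with h2 | ⟨j', rfl, h2⟩
    · exact hμ.dis _ _ _ h1 h2
    · exact (hmeet j' x v hx h2 h1).2
    · exact (hmeet j y v hy h1 h2).2.symm
    · obtain ⟨t, ht, h3⟩ := h1
      obtain ⟨t', ht', h4⟩ := h2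
      rw [(hL.inj j t j' t' ht ht' (h3.trans h4.symm)).1]
  · intro x hx y hy hxy
    obtain ⟨u, hu, v, hv, huv⟩ := hμ.adj x y hxy
    exact ⟨u, Or.inl hu, v, Or.inl hv, huv⟩
  · exact heinj.comp hτ2.injective
  · intro i
    refine ⟨heQ _, ?_, ?_⟩
    · right
      refine mem_biUnion (x := τ i) rfl ⟨0, Nat.zero_le _, ?_⟩
      rw [← hσ, hτ2 i]
    · set j := τ i
      have hadj := hL.adj j (len j - 1) (by have := hpos j; omega)
      rw [show len j - 1 + 1 = len j by have := hpos j; omega] at hadj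
      obtain ⟨x, y, hne, hx, hy, hxy⟩ := hedge _ (hQR _ (heQ j) (he j)) _ hadj.symm
      have h1 : x = e j := hμ.dis _ _ _ hx (he j)
      subst h1
      refine ⟨y, ?_, hxy⟩
      intro hyQ
      have := (hmeet j y _ hyQ ⟨len j - 1, by omega, rfl⟩ hy).2
      exact hne this.symm

theorem linking {W : Type} [Finite W] {H : SimpleGraph W} {βH : Set W → Set W} {s : ℕ}
    (hβ : Hav H (2 * s) βH) (n : ℕ) : ∀ (V : Type) [Finite V] (G : SimpleGraph V) (μ : W → Set V)
    (z : Fin s → V), Nat.card V + G.edgeSet.ncard = n → Mdl H G μ → Function.Injective z →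
    (∀ Y : Set V, Y.ncard < s → (indH G μ βH Y ∩ range z).Nonempty) → LinkConcl H βH G s z := by
  classical
  induction n using Nat.strong_induction_on with
  | _ n ih =>
  intro V _ G μ z hn hμ hz hC
  have hHav := indH_hav hμ hβ
  obtain ⟨Y0, hY0, hd0, hmin⟩ := uncross_min hHav le_rfl hC (by
    rw [← image_univ, ncard_image_of_injective _ hz]; simp)
  by_cases hedge : ∀ u ∈ indH G μ βH Y0, ∀ v, G.Adj u v →
      ∃ x y, x ≠ y ∧ u ∈ μ x ∧ v ∈ μ y ∧ H.Adj x y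
  · exact linking_final hβ hμ hz hC hY0 hd0 hedge
  push Not at hedge
  obtain ⟨u, huR, v, huv, hnot⟩ := hedge
  by_cases hsafe : ∃ x y, x ≠ y ∧ u ∈ μ x ∧ v ∈ μ y
  · -- delete the edge
    obtain ⟨x, y, hxy, hux, hvy⟩ := hsafe
    have hle : G.deleteEdges {s(u, v)} ≤ G := deleteEdges_le _
    have hμ' : Mdl H (G.deleteEdges {s(u, v)}) μ := by
      refine ⟨?_, hμ.dis, ?_⟩
      · intro x'
        refine ⟨(hμ.cn x').1, fun a ha b hb => ?_⟩
        refine ((hμ.cn x').2 a ha b hb).closed (fun t => Rch (G.deleteEdges {s(u, v)}) (μ x') a t)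
          (Rch.refl ha) ?_
        intro c d hc hcS hdS hcd
        refine hc.step ?_ hdS
        rw [deleteEdges_adj]
        refine ⟨hcd, ?_⟩
        intro h
        have h' : (c = u ∧ d = v) ∨ (c = v ∧ d = u) := by simpa using h
        rcases h' with ⟨rfl, rfl⟩ | ⟨rfl, rfl⟩
        · exact hxy ((hμ.dis _ _ _ hux hcS).trans (hμ.dis _ _ _ hdS hvy))
        · exact hxy ((hμ.dis _ _ _ hux hdS).trans (hμ.dis _ _ _ hcS hvy))
      · intro x' y' hadj
        obtain ⟨c, hc, d, hd, hcd⟩ := hμ.adj x' y' hadj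
        refine ⟨c, hc, d, hd, ?_⟩
        rw [deleteEdges_adj]
        refine ⟨hcd, ?_⟩
        intro h
        have h' : (c = u ∧ d = v) ∨ (c = v ∧ d = u) := by simpa using h
        rcases h' with ⟨rfl, rfl⟩ | ⟨rfl, rfl⟩
        · exact hnot x' y' hadj.ne hc hd hadj
        · exact hnot y' x' hadj.ne.symm hd hc hadj.symm
    by_cases hC' : ∀ Y : Set V, Y.ncard < s →
        (indH (G.deleteEdges {s(u, v)}) μ βH Y ∩ range z).Nonempty
    · have hlt : Nat.card V + (G.deleteEdges {s(u, v)}).edgeSet.ncard < n := by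
        rw [← hn]
        refine Nat.add_lt_add_left (ncard_lt_ncard ?_ (toFinite _)) _
        rw [edgeSet_deleteEdges]
        exact ⟨sdiff_subset, fun hs => (hs (show s(u, v) ∈ G.edgeSet from huv)).2 rfl⟩
      obtain ⟨YH, h1, h2⟩ := ih _ hlt V _ μ z rfl hμ' hz hC'
      refine ⟨YH, h1, fun Q hQ hQS => ?_⟩
      obtain ⟨ν, b, k1, k2, k3, k4, k5⟩ := h2 Q hQ hQS
      refine ⟨ν, b, fun x hx => (k1 x hx).monoG hle, k2, ?_, k4, k5⟩
      intro x hx y hy hxy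
      obtain ⟨c, hc, d, hd, hcd⟩ := k3 x hx y hy hxy
      exact ⟨c, hc, d, hd, hle hcd⟩
    exfalso
    push Not at hC'
    obtain ⟨Y, hYs, hYZ⟩ := hC'
    obtain ⟨t, ⟨x0, hx0, u0, hu0, hr⟩, htZ⟩ := hC Y hYs
    have hHav' := indH_hav hμ' hβ
    have hcY := hHav'.comp Y (by omega)
    obtain ⟨a, b, ha, hb, haS, hbS, hab, -⟩ := hr.exit
      (fun t => t ∈ indH (G.deleteEdges {s(u, v)}) μ βH Y)
      (mu_sub_indH hμ' hβ (by omega) hx0 hu0) (fun h => by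
        have : t ∈ indH (G.deleteEdges {s(u, v)}) μ βH Y ∩ range z := ⟨h, htZ⟩
        rw [hYZ] at this; exact this)
    have hab' : (u = a ∧ v = b) ∨ (u = b ∧ v = a) := by
      by_contra hne
      refine hb (hcY.2.2 a ha b hbS ?_)
      rw [deleteEdges_adj]
      refine ⟨hab, fun h => hne ?_⟩
      have h' : (a = u ∧ b = v) ∨ (a = v ∧ b = u) := by simpa using h
      rcases h' with ⟨rfl, rfl⟩ | ⟨rfl, rfl⟩
      · exact Or.inl ⟨rfl, rfl⟩
      · exact Or.inr ⟨rfl, rfl⟩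
    have hcard : (insert a Y).ncard ≤ s := (ncard_insert_le _ _).trans hYs
    have hsub : indH G μ βH (insert a Y) ⊆ indH (G.deleteEdges {s(u, v)}) μ βH Y := by
      refine subset_trans ?_ (hHav'.mono Y (insert a Y) (subset_insert _ _) (by omega))
      rintro t ⟨x1, hx1, u1, hu1, hr1⟩
      refine ⟨x1, hx1, u1, hu1, ?_⟩
      refine hr1.closed (fun t => Rch (G.deleteEdges {s(u, v)}) (insert a Y)ᶜ u1 t)
        (Rch.refl hr1.left) ?_
      intro c d hc hcS hdS hcd
      refine hc.step ?_ hdS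
      rw [deleteEdges_adj]
      refine ⟨hcd, fun h => ?_⟩
      have h' : (c = u ∧ d = v) ∨ (c = v ∧ d = u) := by simpa using h
      have hca : c ≠ a := fun h => hcS (Or.inl h)
      have hda : d ≠ a := fun h => hdS (Or.inl h)
      rcases h' with ⟨h1, h2⟩ | ⟨h1, h2⟩ <;> rcases hab' with ⟨h3, h4⟩ | ⟨h3, h4⟩
      · exact hca (h1.trans h3)
      · exact hda (h2.trans h4)
      · exact hda (h2.trans h3)
      · exact hca (h1.trans h4)
    have hR := hmin (insert a Y) hcard (by
      rw [Set.disjoint_left]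
      intro t ht htZ
      have : t ∈ indH (G.deleteEdges {s(u, v)}) μ βH Y ∩ range z := ⟨hsub ht, htZ⟩
      rw [hYZ] at this; exact this)
    have huI := hR huR
    rcases hab' with ⟨rfl, rfl⟩ | ⟨rfl, rfl⟩
    · exact Set.disjoint_left.1 (hHav.comp (insert u Y) (by omega)).1 huI (Or.inl rfl)
    · exact hb (hsub huI)
  · -- contract the edge
    push Not at hsafe
    have hsame : ∀ x y, u ∈ μ x → v ∈ μ y → x = y := by
      intro x y h1 h2
      by_contra hne
      exact hsafe x y hne h1 h2
    have hvR : ∀ Y : Set V, Y.ncard ≤ s → Disjoint (indH G μ βH Y) (range z) → u ∈ Y → False := by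
      intro Y h1 h2 h3
      exact Set.disjoint_left.1 (hHav.comp Y (by omega)).1 (hmin Y h1 h2 huR) h3
    have hnZ : ¬ (u ∈ range z) := fun h => Set.disjoint_left.1 hd0 huR h
    let f : V → {w : V // w ≠ v} := fun w => if h : w = v then ⟨u, huv.ne⟩ else ⟨w, h⟩
    have fv : f v = ⟨u, huv.ne⟩ := by simp [f]
    have fw : ∀ w (h : w ≠ v), f w = ⟨w, h⟩ := by intro w h; simp [f, h]
    have hf : ∀ a b, f a = f b → a = b ∨ (a = u ∧ b = v) ∨ (a = v ∧ b = u) := by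
      intro a b hab
      by_cases ha : a = v <;> by_cases hb : b = v
      · exact Or.inl (ha.trans hb.symm)
      · rw [ha, fv, fw b hb] at hab
        exact Or.inr (Or.inr ⟨ha, (Subtype.ext_iff.1 hab).symm⟩)
      · rw [hb, fv, fw a ha] at hab
        exact Or.inr (Or.inl ⟨Subtype.ext_iff.1 hab, hb⟩)
      · rw [fw a ha, fw b hb] at hab
        exact Or.inl (Subtype.ext_iff.1 hab)
    have hf' : ∀ a b, f a = f b → a = b ∨ G.Adj a b := by
      intro a b hab
      rcases hf a b hab with h | ⟨rfl, rfl⟩ | ⟨rfl, rfl⟩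
      · exact Or.inl h
      · exact Or.inr huv
      · exact Or.inr huv.symm
    have hz' : Function.Injective (f ∘ z) := by
      intro i j hij
      rcases hf _ _ hij with h | ⟨h, _⟩ | ⟨_, h⟩
      · exact hz h
      · exact absurd ⟨i, h⟩ hnZ
      · exact absurd ⟨j, h⟩ hnZ
    have hdis' : ∀ x y a b, a ∈ μ x → b ∈ μ y → f a = f b → x = y := by
      intro x y a b ha hb hab
      rcases hf _ _ hab with rfl | ⟨rfl, rfl⟩ | ⟨rfl, rfl⟩
      · exact hμ.dis _ _ _ ha hb
      · exact hsame _ _ ha hb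
      · exact (hsame _ _ hb ha).symm
    have hμ' : Mdl H (quo G f) (fun x => f '' μ x) := by
      refine ⟨?_, ?_, ?_⟩
      · intro x
        obtain ⟨a, ha⟩ := (hμ.cn x).1
        refine Cn.ofCenter (a := f a) ⟨a, ha, rfl⟩ ?_
        rintro _ ⟨b, hb, rfl⟩
        exact ((hμ.cn x).2 a ha b hb).quo (fun c hc => mem_image_of_mem f hc)
      · rintro x y _ ⟨a, ha, rfl⟩ ⟨b, hb, hab⟩
        exact hdis' x y a b ha hb hab.symm
      · intro x y hxy
        obtain ⟨a, ha, b, hb, hab⟩ := hμ.adj x y hxy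
        refine ⟨f a, ⟨a, ha, rfl⟩, f b, ⟨b, hb, rfl⟩, ?_, a, b, rfl, rfl, hab⟩
        intro h
        exact hxy.ne (hdis' x y a b ha hb h)
    have hC' : ∀ Y : Set {w : V // w ≠ v}, Y.ncard < s →
        (indH (quo G f) (fun x => f '' μ x) βH Y ∩ range (f ∘ z)).Nonempty := by
      intro Y hY
      have hsub1 : f ⁻¹' Y ⊆ insert v (Subtype.val '' Y) := by
        intro w hw
        by_cases h : w = v
        · exact Or.inl h
        · right
          rw [mem_preimage, fw w h] at hw
          exact ⟨_, hw, rfl⟩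
      have hc1 : (f ⁻¹' Y).ncard ≤ s := by
        refine (ncard_le_ncard hsub1 (toFinite _)).trans ((ncard_insert_le _ _).trans ?_)
        rw [ncard_image_of_injective _ Subtype.val_injective]
        exact hY
      have hpr : prj (fun x => f '' μ x) Y = prj μ (f ⁻¹' Y) := by
        ext x
        constructor
        · rintro ⟨_, ⟨a, ha, rfl⟩, h⟩; exact ⟨a, ha, h⟩
        · rintro ⟨a, ha, h⟩; exact ⟨f a, ⟨a, ha, rfl⟩, h⟩
      have himg : ∀ t, t ∈ indH G μ βH (f ⁻¹' Y) →
          f t ∈ indH (quo G f) (fun x => f '' μ x) βH Y := by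
        rintro t ⟨x, hx, a, ha, hr⟩
        refine ⟨x, by rw [hpr]; exact hx, f a, ⟨a, ha, rfl⟩, hr.quo ?_⟩
        intro c hc; exact hc
      suffices hne : (indH G μ βH (f ⁻¹' Y) ∩ range z).Nonempty by
        obtain ⟨t, ht, ⟨i, rfl⟩⟩ := hne
        exact ⟨f (z i), himg _ ht, i, rfl⟩
      by_cases hu : u ∈ f ⁻¹' Y
      · by_contra hne
        rw [not_nonempty_iff_eq_empty, ← disjoint_iff_inter_eq_empty] at hne
        exact hvR _ hc1 hne hu
      · refine hC _ (lt_of_le_of_lt ?_ hY)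
        have : f ⁻¹' Y ⊆ Subtype.val '' Y := by
          intro w hw
          rcases hsub1 hw with h | h
          · exfalso
            apply hu
            rw [mem_preimage, fw u huv.ne]
            rw [h, mem_preimage, fv] at hw
            exact hw
          · exact h
        refine (ncard_le_ncard this (toFinite _)).trans ?_
        rw [ncard_image_of_injective _ Subtype.val_injective]
    have hlt : Nat.card {w : V // w ≠ v} + (quo G f).edgeSet.ncard < n := by
      rw [← hn]
      refine Nat.add_lt_add_of_lt_of_le ?_ ?_
      · exact Finite.card_subtype_lt (p := fun w => w ≠ v) (x := v) (by simp)
      · have : (quo G f).edgeSet ⊆ Sym2.map f '' G.edgeSet := by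
          intro e
          induction e using Sym2.ind with
          | _ a b =>
          rintro ⟨_, x, y, rfl, rfl, hxy⟩
          exact ⟨s(x, y), hxy, rfl⟩
        exact (ncard_le_ncard this (toFinite _)).trans (ncard_image_le (toFinite _))
    obtain ⟨YH, h1, h2⟩ := ih _ hlt _ (quo G f) _ (f ∘ z) rfl hμ' hz' hC'
    refine ⟨YH, h1, fun Q hQ hQS => ?_⟩
    obtain ⟨ν, b, k1, k2, k3, k4, k5⟩ := h2 Q hQ hQS
    have fsurj : ∀ t, f t.1 = t := fun t => fw t.1 t.2
    refine ⟨fun x => f ⁻¹' ν x, b, ?_, ?_, ?_, k4, k5⟩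
    · intro x hx
      obtain ⟨t, ht⟩ := (k1 x hx).1
      have ht2 : t.1 ∈ f ⁻¹' ν x := by rw [mem_preimage, fsurj]; exact ht
      refine ⟨⟨t.1, ht2⟩, ?_⟩
      intro c hc d hd
      exact ((k1 x hx).2 (f c) hc (f d) hd).lift hf' c d rfl rfl
    · intro x hx y hy t h3 h4
      exact k2 x hx y hy (f t) h3 h4
    · intro x hx y hy hxy
      obtain ⟨c, hc, d, hd, _, c', d', rfl, rfl, hcd⟩ := k3 x hx y hy hxy
      exact ⟨c', hc, d', hd, hcd⟩


/-! ## Segregation -/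
theorem select {q k : ℕ} (hq : 0 < q) (hk : 1 ≤ k) (P : Fin q → Finset ℕ) (l : ℕ) :
    ∀ (L : Finset (Fin q)) (B : ℕ), L.card = l →
      (∀ c ∈ L, l * k ≤ ((P c).filter (fun x => B ≤ x)).card) →
      ∃ (σ : ℕ → Fin q) (y : ℕ → ℕ), (∀ i < l, σ i ∈ L) ∧
        (∀ i < l, ∀ j < l, σ i = σ j → i = j) ∧ (∀ u < l * k, B ≤ y u) ∧
        (∀ u < l * k, ∀ v < l * k, u < v → y u < y v) ∧ (∀ u < l * k, y u ∈ P (σ (u / k))) := by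
  classical
  induction l with
  | zero =>
    intro L B hL h
    exact ⟨fun _ => ⟨0, hq⟩, id, by simp, by simp, by simp, by simp, by simp⟩
  | succ l ih =>
    intro L B hL h
    have hex : ∃ t, ∃ c ∈ L, k ≤ ((P c).filter (fun x => B ≤ x ∧ x < t)).card := by
      obtain ⟨c, hc⟩ := Finset.card_pos.1 (by omega : 0 < L.card)
      refine ⟨(P c).sup id + 1, c, hc, ?_⟩
      have : (P c).filter (fun x => B ≤ x ∧ x < (P c).sup id + 1) =
          (P c).filter (fun x => B ≤ x) := by
        apply Finset.filter_congr
        intro x hx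
        have : x ≤ (P c).sup id := Finset.le_sup (f := id) hx
        constructor
        · exact fun h => h.1
        · exact fun h => ⟨h, by omega⟩
      rw [this]
      refine le_trans ?_ (h c hc)
      nlinarith
    obtain ⟨c0, hc0, hk0⟩ := Nat.find_spec hex
    have hmin := fun m (hm : m < Nat.find hex) => Nat.find_min hex hm
    set t := Nat.find hex
    have ht0 : 0 < t := by
      rw [Nat.pos_iff_ne_zero]
      intro h0
      rw [h0] at hk0
      simp at hk0
      omega
    have hBt : B ≤ t := by
      by_contra hlt
      have : (P c0).filter (fun x => B ≤ x ∧ x < t) = ∅ := by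
        apply Finset.filter_eq_empty_iff.2
        intro x _ hx
        omega
      rw [this] at hk0
      simp at hk0; omega
    obtain ⟨A, hA, hAk⟩ := Finset.exists_subset_card_eq hk0
    obtain ⟨σ, y, s1, s2, s3, s4, s5⟩ := ih (L.erase c0) t (by
        rw [Finset.card_erase_of_mem hc0, hL]; rfl) (by
      intro c hc
      have hcL := Finset.mem_of_mem_erase hc
      have h1 : ((P c).filter (fun x => B ≤ x ∧ x < t - 1)).card < k := by
        have := hmin (t - 1) (by omega)
        push Not at this
        exact this c hcL
      have h2 := h c hcL
      have h3 : (P c).filter (fun x => B ≤ x) ⊆ ((P c).filter (fun x => B ≤ x ∧ x < t - 1)) ∪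
          (insert (t - 1) ((P c).filter (fun x => t ≤ x))) := by
        intro x hx
        simp only [Finset.mem_union, Finset.mem_filter, Finset.mem_insert] at hx ⊢
        rcases lt_trichotomy x (t - 1) with h | h | h
        · exact Or.inl ⟨hx.1, hx.2, h⟩
        · exact Or.inr (Or.inl h)
        · exact Or.inr (Or.inr ⟨hx.1, by omega⟩)
      have h4 := Finset.card_le_card h3
      have h5 := Finset.card_union_le ((P c).filter (fun x => B ≤ x ∧ x < t - 1))
          (insert (t - 1) ((P c).filter (fun x => t ≤ x)))
      have h6 := Finset.card_insert_le (t - 1) ((P c).filter (fun x => t ≤ x))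
      have h7 : (l + 1) * k = l * k + k := by ring
      omega)
    let oe := A.orderEmbOfFin hAk
    have hoe : ∀ i, oe i ∈ A := fun i => Finset.orderEmbOfFin_mem A hAk i
    have hoe' : ∀ i, oe i ∈ P c0 ∧ B ≤ oe i ∧ oe i < t := by
      intro i
      have := hA (hoe i)
      simpa using this
    have hlk : (l + 1) * k = l * k + k := by ring
    refine ⟨fun i => if i = 0 then c0 else σ (i - 1),
      fun u => if h : u < k then oe ⟨u, h⟩ else y (u - k), ?_, ?_, ?_, ?_, ?_⟩
    · intro i hi
      dsimp only
      split_ifs with h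
      · exact hc0
      · exact Finset.mem_of_mem_erase (s1 (i - 1) (by omega))
    · intro i hi j hj
      dsimp only
      split_ifs with h h' h'
      · intro _; omega
      · intro he
        exact absurd he.symm (Finset.ne_of_mem_erase (s1 (j - 1) (by omega)))
      · intro he
        exact absurd he (Finset.ne_of_mem_erase (s1 (i - 1) (by omega)))
      · intro he
        have := s2 (i - 1) (by omega) (j - 1) (by omega) he
        omega
    · intro u hu
      dsimp only
      split_ifs with h
      · exact (hoe' _).2.1
      · exact hBt.trans (s3 (u - k) (by omega))
    · intro u hu v hv huv
      dsimp only
      split_ifs with h h' h'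
      · exact oe.strictMono (by simpa using huv)
      · exact lt_of_lt_of_le (hoe' _).2.2 (s3 (v - k) (by omega))
      · omega
      · exact s4 _ (by omega) _ (by omega) (by omega)
    · intro u hu
      dsimp only
      by_cases h : u < k
      · rw [dif_pos h, if_pos (Nat.div_eq_of_lt h)]
        exact (hoe' _).1
      · have h0 : 0 < u / k := Nat.div_pos (by omega) (by omega)
        rw [dif_neg h, if_neg (by omega)]
        have h1 := s5 (u - k) (by omega)
        have h2 : u / k = (u - k) / k + 1 := Nat.div_eq_sub_div (by omega) (by omega)
        rw [h2]
        exact h1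

theorem segregate {V : Type} {G : SimpleGraph V} {q k M : ℕ} (hq : 1 ≤ q) (hk : 1 ≤ k)
    (χ : V → Finset (Fin q)) (T : ℕ → ℕ → Set V)
    (hcn : ∀ c < M, ∀ d < M, Cn G (T c d))
    (hdis : ∀ c < M, ∀ d < M, ∀ c' < M, ∀ d' < M, ∀ v, v ∈ T c d → v ∈ T c' d' → c = c' ∧ d = d')
    (hh : ∀ c d, c + 1 < M → d < M → ∃ x ∈ T c d, ∃ y ∈ T (c + 1) d, G.Adj x y)
    (hv : ∀ c d, c < M → d + 1 < M → ∃ x ∈ T c d, ∃ y ∈ T c (d + 1), G.Adj x y)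
    (hM : q * k ≤ M) (pos : Fin q → Fin (q * k) → ℕ)
    (pinj : ∀ c r c' r', pos c r = pos c' r' → c = c' ∧ r = r')
    (plt : ∀ c r, pos c r < M) (pcol : ∀ c r, ∃ x ∈ T (pos c r) 0, c ∈ χ x) :
    ∃ π : Equiv.Perm (Fin q), IsColorfulMinor (gridGraph (q * k)) (segPalette q k π) G χ := by
  classical
  obtain ⟨σ, y, -, s2, -, s4, s5⟩ := select hq hk (fun c => Finset.univ.image (pos c)) q
    Finset.univ 0 (by simp) (by
      intro c _
      simp only [Nat.zero_le, Finset.filter_true]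
      rw [Finset.card_image_of_injective _ (fun r r' h => (pinj c r c r' h).2)]
      simp)
  have hσ : Function.Bijective (fun i : Fin q => σ i.val) := by
    rw [← Finite.injective_iff_bijective]
    intro i j hij
    exact Fin.ext (s2 i i.2 j j.2 hij)
  let π : Equiv.Perm (Fin q) := Equiv.ofBijective _ hσ
  have hy : ∀ u < q * k, y u < M ∧ ∃ x ∈ T (y u) 0, σ (u / k) ∈ χ x := by
    intro u hu
    have := s5 u hu
    simp only [Finset.mem_image, Finset.mem_univ, true_and] at this
    obtain ⟨r, hr⟩ := this
    rw [← hr]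
    exact ⟨plt _ _, pcol _ _⟩
  let hi : ℕ → ℕ := fun u => if u + 1 < q * k then y (u + 1) - 1 else y u
  have hlohi : ∀ u < q * k, y u ≤ hi u ∧ hi u < M := by
    intro u hu
    dsimp only [hi]
    split_ifs with h
    · have h1 := s4 u hu (u + 1) h (by omega)
      have h2 := (hy (u + 1) h).1
      omega
    · exact ⟨le_rfl, (hy u hu).1⟩
  have hiv : ∀ u < q * k, ∀ u' < q * k, u < u' → hi u < y u' := by
    intro u hu u' hu' huu
    dsimp only [hi]
    rw [if_pos (by omega)]
    have h1 := s4 u hu (u + 1) (by omega) (by omega)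
    have h2 : y (u + 1) ≤ y u' := by
      rcases Nat.lt_or_ge (u + 1) u' with h | h
      · exact (s4 (u + 1) (by omega) u' hu' h).le
      · rw [show u' = u + 1 by omega]
    omega
  let B : Fin (q * k) × Fin (q * k) → Set V := fun p =>
    {v | ∃ c, y p.1 ≤ c ∧ c ≤ hi p.1 ∧ v ∈ T c p.2}
  have hadj1 : ∀ (u : Fin (q * k)) (b b' : Fin (q * k)), b.val + 1 = b'.val →
      ∃ x ∈ B (u, b), ∃ z ∈ B (u, b'), G.Adj x z := by
    intro u b b' hb
    obtain ⟨x, hx, z, hz, hxz⟩ := hv (y u) b (hy u u.2).1 (by have := b'.2; omega)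
    have := hlohi u u.2
    refine ⟨x, ⟨y u, le_rfl, this.1, hx⟩, z, ⟨y u, le_rfl, this.1, ?_⟩, hxz⟩
    rw [← hb]; exact hz
  have hadj2 : ∀ (u u' : Fin (q * k)) (b : Fin (q * k)), u.val + 1 = u'.val →
      ∃ x ∈ B (u, b), ∃ z ∈ B (u', b), G.Adj x z := by
    intro u u' b hu
    have hu1 : u.val + 1 < q * k := by have := u'.2; omega
    have h1 := s4 u u.2 u' u'.2 (by omega)
    have h2 := (hy u' u'.2).1
    have h3 := hlohi u' u'.2
    obtain ⟨x, hx, z, hz, hxz⟩ := hh (y u' - 1) b (by omega) (by have := b.2; omega)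
    rw [show y u' - 1 + 1 = y u' by omega] at hz
    refine ⟨x, ⟨y u' - 1, ?_, ?_, hx⟩, z, ⟨y u', le_rfl, h3.1, hz⟩, hxz⟩
    · show y u.val ≤ _
      omega
    · show _ ≤ hi u.val
      dsimp only [hi]
      rw [if_pos hu1, hu]
  refine ⟨π, B, ?_, ?_, ?_, ?_⟩
  · rintro ⟨u, b⟩
    rw [← cn_iff]
    have hb : b.val < M := by have := b.2; omega
    have key : ∀ m, y u ≤ m → m < M → Cn G {v | ∃ c, y u ≤ c ∧ c ≤ m ∧ v ∈ T c b} := by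
      intro m hm
      induction m, hm using Nat.le_induction with
      | base =>
        intro hM'
        have : {v | ∃ c, y u ≤ c ∧ c ≤ y u ∧ v ∈ T c b} = T (y u) b := by
          ext v; constructor
          · rintro ⟨c, h1, h2, h3⟩; rwa [le_antisymm h2 h1] at h3
          · intro h; exact ⟨_, le_rfl, le_rfl, h⟩
        rw [this]; exact hcn _ hM' _ hb
      | succ m hm ih =>
        intro hM'
        have : {v | ∃ c, y u ≤ c ∧ c ≤ m + 1 ∧ v ∈ T c b} =
            {v | ∃ c, y u ≤ c ∧ c ≤ m ∧ v ∈ T c b} ∪ T (m + 1) b := by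
          ext v; constructor
          · rintro ⟨c, h1, h2, h3⟩
            rcases Nat.lt_or_ge m c with h | h
            · right; rwa [show c = m + 1 by omega] at h3
            · left; exact ⟨c, h1, h, h3⟩
          · rintro (⟨c, h1, h2, h3⟩ | h)
            · exact ⟨c, h1, by omega, h3⟩
            · exact ⟨m + 1, by omega, le_rfl, h⟩
        rw [this]
        obtain ⟨x, hx, z, hz, hxz⟩ := hh m b hM' hb
        exact (ih (by omega)).unionAdj (hcn _ hM' _ hb) ⟨m, hm, le_rfl, hx⟩ hz hxz
    exact key _ (hlohi u u.2).1 (hlohi u u.2).2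
  · rintro ⟨u, b⟩ ⟨u', b'⟩ hne
    refine Set.disjoint_left.2 ?_
    rintro v ⟨c, h1, h2, h3⟩ ⟨c', h1', h2', h3'⟩
    dsimp only at *
    have hu := hlohi u u.2
    have hu' := hlohi u' u'.2
    have := hdis c (by omega) b (by have := b.2; omega) c' (by omega) b' (by have := b'.2; omega) v h3 h3'
    obtain ⟨hc, hb⟩ := this
    apply hne
    have huu : u.val = u'.val := by
      rcases lt_trichotomy u.val u'.val with h | h | h
      · have := hiv u u.2 u' u'.2 h; omega
      · exact h
      · have := hiv u' u'.2 u u.2 h; omega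
    exact Prod.ext (Fin.ext huu) (Fin.ext hb)
  · rintro ⟨u, b⟩ ⟨u', b'⟩ h
    rw [gridGraph, fromRel_adj] at h
    obtain ⟨-, (⟨h1, h2⟩ | ⟨h1, h2⟩) | (⟨h1, h2⟩ | ⟨h1, h2⟩)⟩ := h <;> dsimp only at h1 h2 <;> subst h1
    · exact hadj1 u b b' h2
    · exact hadj2 u u' b h2
    · obtain ⟨x, hx, z, hz, hxz⟩ := hadj1 u' b' b h2
      exact ⟨z, hz, x, hx, hxz.symm⟩
    · obtain ⟨x, hx, z, hz, hxz⟩ := hadj2 u' u b' h2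
      exact ⟨z, hz, x, hx, hxz.symm⟩
  · rintro ⟨u, b⟩ c hc
    simp only [segPalette, Finset.mem_filter, Finset.mem_univ, true_and] at hc
    obtain ⟨hb, h1, h2⟩ := hc
    have h3 : u.val / k = (π.symm c).val := Nat.div_eq_of_lt_le h1 h2
    obtain ⟨-, x, hx, hxc⟩ := hy u u.2
    refine ⟨x, ⟨y u, le_rfl, (hlohi u u.2).1, ?_⟩, ?_⟩
    · show x ∈ T (y u) b.val
      rw [hb]; exact hx
    · rw [h3] at hxc
      have : σ (π.symm c).val = c := π.apply_symm_apply c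
      rwa [this] at hxc


/-! ## The castle -/
def castle (s : ℕ) : SimpleGraph (Fin ((s + 1) * (s + 1)) × Fin (3 * s + 2)) :=
  SimpleGraph.fromRel fun x y => (x.1 = y.1 ∧ x.2.val + 1 = y.2.val) ∨
    (x.2 = y.2 ∧ x.1.val + 1 = y.1.val ∧
      (x.2.val < 2 * s + 1 ∨ x.1.val / (s + 1) = y.1.val / (s + 1)))

abbrev CV (s : ℕ) := Fin ((s + 1) * (s + 1)) × Fin (3 * s + 2)

def castleH (s : ℕ) (Y : Set (CV s)) : Set (CV s) :=
  {x | ∃ a, (∀ r, (a, r) ∉ Y) ∧ ∃ r, Rch (castle s) Yᶜ (a, r) x}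

theorem castle_col {s : ℕ} {Y : Set (CV s)} {a} (h : ∀ r, (a, r) ∉ Y) (r r') :
    Rch (castle s) Yᶜ (a, r) (a, r') := by
  have key : ∀ m (hm : m < 3 * s + 2), Rch (castle s) Yᶜ (a, ⟨0, by omega⟩) (a, ⟨m, hm⟩) := by
    intro m
    induction m with
    | zero => intro hm; exact Rch.refl (h _)
    | succ m ih =>
      intro hm
      refine (ih (by omega)).step ?_ (h _)
      rw [castle, fromRel_adj]
      refine ⟨?_, Or.inl (Or.inl ⟨rfl, rfl⟩)⟩
      intro h; simp at h
  exact (key r r.2).symm.trans (key r' r'.2)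

theorem castle_row {s : ℕ} {Y : Set (CV s)} {r} (hr : r.val < 2 * s + 1) (h : ∀ a, (a, r) ∉ Y)
    (a a') : Rch (castle s) Yᶜ (a, r) (a', r) := by
  have h0 : 0 < (s + 1) * (s + 1) := by positivity
  have key : ∀ m (hm : m < (s + 1) * (s + 1)),
      Rch (castle s) Yᶜ (⟨0, h0⟩, r) (⟨m, hm⟩, r) := by
    intro m
    induction m with
    | zero => intro hm; exact Rch.refl (h _)
    | succ m ih =>
      intro hm
      refine (ih (by omega)).step ?_ (h _)
      rw [castle, fromRel_adj]
      refine ⟨?_, Or.inl (Or.inr ⟨rfl, rfl, Or.inl hr⟩)⟩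
      intro h; simp at h
  exact (key a a.2).symm.trans (key a' a'.2)

/-- a small set misses a fibre -/
theorem miss {α : Type} [Finite α] (Y : Set α) (f : α → ℕ) (lo n : ℕ) (h : Y.ncard < n) :
    ∃ i, lo ≤ i ∧ i < lo + n ∧ ∀ x ∈ Y, f x ≠ i := by
  by_contra hcon
  push Not at hcon
  have h1 : (Set.Ico lo (lo + n)) ⊆ f '' Y := by
    intro i hi
    obtain ⟨x, hx, hxi⟩ := hcon i hi.1 hi.2
    exact ⟨x, hx, hxi⟩
  have h2 := ncard_le_ncard h1 (toFinite _)
  have h3 := ncard_image_le (f := f) (toFinite Y)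
  have h4 : (Set.Ico lo (lo + n)).ncard = n := by
    rw [← Finset.coe_Ico, ncard_coe_finset]; simp
  omega

theorem castle_hav (s : ℕ) : Hav (castle s) (2 * s) (castleH s) := by
  refine ⟨?_, ?_⟩
  · intro Y hY
    obtain ⟨a, -, ha, haY⟩ := miss Y (fun x => x.1.val) 0 ((s + 1) * (s + 1)) (by nlinarith)
    obtain ⟨r, -, hr, hrY⟩ := miss Y (fun x => x.2.val) 0 (2 * s + 1) (by omega)
    have hcl : ∀ r', ((⟨a, by omega⟩ : Fin ((s + 1) * (s + 1))), r') ∉ Y := fun r' h => haY _ h rfl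
    have hcr : ∀ a', (a', (⟨r, by omega⟩ : Fin (3 * s + 2))) ∉ Y := fun r' h => hrY _ h rfl
    have : castleH s Y = {b | Rch (castle s) Yᶜ (⟨a, by omega⟩, ⟨r, by omega⟩) b} := by
      ext x
      constructor
      · rintro ⟨a', ha', r', h⟩
        exact ((castle_row (by simpa using hr) hcr _ a').trans (castle_col ha' _ r')).trans h
      · intro h; exact ⟨_, hcl, _, h⟩
    rw [this]
    exact comp_of (hcl _)
  · rintro Y Y' hs hY' x ⟨a, ha, r, h⟩
    exact ⟨a, fun r hr => ha r (hs hr), r, h.mono (compl_subset_compl.2 hs)⟩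

theorem castle_finish {V : Type} [Finite V] {G : SimpleGraph V} {q k s w : ℕ} (hq : 1 ≤ q)
    (hk : 1 ≤ k) (hs : s = q * (q * k)) (χ : V → Finset (Fin q)) {β : Set V → Set V}
    (hβ : Hav G w β) (hsw : s ≤ w) (z : Fin s → V) (zinj : Function.Injective z)
    (zcol : ∀ c r, ∀ i, i.val = (finProdFinEquiv (c, r) : Fin (q * (q * k))).val → c ∈ χ (z i))
    (zfree : Free β (range z))
    (μ : CV s → Set V) (hμ : Mdl (castle s) G μ)
    (hal : ∀ Y : Set V, Y.ncard < s → ∃ a, (∀ r, Disjoint (μ (a, r)) Y) ∧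
      ∃ r, (μ (a, r) ∩ β Y).Nonempty) :
    ∃ π : Equiv.Perm (Fin q), IsColorfulMinor (gridGraph (q * k)) (segPalette q k π) G χ := by
  classical
  have hcard : (range z).ncard = s := by
    rw [← image_univ, ncard_image_of_injective _ zinj, ncard_univ]; simp
  obtain ⟨YH, hYH, hL⟩ := linking (castle_hav s) _ V G μ z rfl hμ zinj (by
    intro Y hY
    obtain ⟨a, ha, r, v, hv, hvb⟩ := hal Y hY
    obtain ⟨x, hx, hxz⟩ := zfree Y (by omega)
    have hcomp := hβ.comp Y (by omega)
    refine ⟨x, ⟨(a, r), ⟨a, ?_, r, Rch.refl ?_⟩, v, hv, ?_⟩, hxz⟩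
    · rintro r' ⟨u, hu, hu'⟩
      exact Set.disjoint_left.1 (ha r') hu hu'
    · rintro ⟨u, hu, hu'⟩
      exact Set.disjoint_left.1 (ha r) hu hu'
    · exact ((comp_cn hcomp).2 v hvb x hx).mono (fun y hy hy' => Set.disjoint_left.1 hcomp.1 hy hy'))
  obtain ⟨i, -, hi, hiY⟩ := miss YH (fun x => x.1.val / (s + 1)) 0 (s + 1) (by omega)
  let Q : Set (CV s) := {x | x.1.val / (s + 1) = i ∧ 2 * s + 1 ≤ x.2.val}
  obtain ⟨ν, b, n1, n2, n3, n4, n5⟩ := hL Q (by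
    rintro ⟨a, r⟩ ⟨h1, h2⟩
    have : ∀ r, (a, r) ∉ YH := fun r h => hiY _ h h1
    exact ⟨a, this, r, Rch.refl (this r)⟩) (by
    intro S hS
    obtain ⟨a, ha1, ha2, haS⟩ := miss S (fun x => x.1.val) (i * (s + 1)) (s + 1) (by omega)
    have hlt : a < (s + 1) * (s + 1) := by
      have : i + 1 ≤ s + 1 := by omega
      have := Nat.mul_le_mul_right (s + 1) this
      have h3 : (i + 1) * (s + 1) = i * (s + 1) + (s + 1) := by ring
      omega
    have hcl : ∀ r, ((⟨a, hlt⟩ : Fin ((s + 1) * (s + 1))), r) ∉ S := fun r h => haS _ h rfl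
    refine ⟨(⟨a, hlt⟩, ⟨2 * s + 1, by omega⟩), ⟨?_, le_rfl⟩, ⟨_, hcl, _, Rch.refl (hcl _)⟩⟩
    show a / (s + 1) = i
    exact Nat.div_eq_of_lt_le ha1 (by
      have h3 : (i + 1) * (s + 1) = i * (s + 1) + (s + 1) := by ring
      omega))
  have hbd : ∀ j, (b j).1.val / (s + 1) = i ∧ (b j).2.val = 2 * s + 1 := by
    intro j
    obtain ⟨⟨h1, h2⟩, -, y, hy, hadj⟩ := n5 j
    refine ⟨h1, ?_⟩
    by_contra hne
    apply hy
    rw [castle, fromRel_adj] at hadj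
    obtain ⟨-, (⟨h3, h4⟩ | ⟨h3, h4, h5⟩) | (⟨h3, h4⟩ | ⟨h3, h4, h5⟩)⟩ := hadj
    · exact ⟨by rw [← h3]; exact h1, by omega⟩
    · refine ⟨?_, by rw [← h3]; exact h2⟩
      rcases h5 with h5 | h5
      · omega
      · rw [← h5]; exact h1
    · exact ⟨by rw [h3]; exact h1, by omega⟩
    · refine ⟨?_, by rw [h3]; exact h2⟩
      rcases h5 with h5 | h5
      · rw [h3] at h5; omega
      · rw [h5]; exact h1
  have hlt : ∀ c < s + 1, i * (s + 1) + c < (s + 1) * (s + 1) := by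
    intro c hc
    have : i + 1 ≤ s + 1 := by omega
    have := Nat.mul_le_mul_right (s + 1) this
    have h3 : (i + 1) * (s + 1) = i * (s + 1) + (s + 1) := by ring
    omega
  let e : ℕ → ℕ → CV s := fun c d =>
    if h : c < s + 1 ∧ d < s + 1 then (⟨i * (s + 1) + c, hlt c h.1⟩, ⟨2 * s + 1 + d, by omega⟩)
    else (⟨0, by positivity⟩, ⟨0, by omega⟩)
  have he1 : ∀ c < s + 1, ∀ d < s + 1, (e c d).1.val = i * (s + 1) + c ∧
      (e c d).2.val = 2 * s + 1 + d := by
    intro c hc d hd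
    simp only [e]
    rw [dif_pos ⟨hc, hd⟩]
    exact ⟨rfl, rfl⟩
  have hdiv : ∀ c < s + 1, (i * (s + 1) + c) / (s + 1) = i := by
    intro c hc
    exact Nat.div_eq_of_lt_le (by omega) (by
      have h3 : (i + 1) * (s + 1) = i * (s + 1) + (s + 1) := by ring
      omega)
  have heQ : ∀ c < s + 1, ∀ d < s + 1, e c d ∈ Q := by
    intro c hc d hd
    obtain ⟨h1, h2⟩ := he1 c hc d hd
    refine ⟨by rw [h1]; exact hdiv c hc, by omega⟩
  have hbe : ∀ j, ∃ c, c < s + 1 ∧ e c 0 = b j := by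
    intro j
    obtain ⟨h1, h2⟩ := hbd j
    have h3 := Nat.div_add_mod (b j).1.val (s + 1)
    have h4 := Nat.mod_lt (b j).1.val (show 0 < s + 1 by omega)
    rw [h1, mul_comm] at h3
    refine ⟨(b j).1.val % (s + 1), h4, ?_⟩
    obtain ⟨h5, h6⟩ := he1 _ h4 0 (by omega)
    exact Prod.ext (Fin.ext (by omega)) (Fin.ext (by omega))
  choose p hp1 hp2 using hbe
  let ix : Fin q → Fin (q * k) → Fin s := fun c r => Fin.cast hs.symm (finProdFinEquiv (c, r))
  refine segregate (M := s + 1) hq hk χ (fun c d => ν (e c d)) ?_ ?_ ?_ ?_ ?_ (fun c r => p (ix c r))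
    ?_ ?_ ?_
  · intro c hc d hd; exact n1 _ (heQ c hc d hd)
  · intro c hc d hd c' hc' d' hd' v hv hv'
    have h := n2 _ (heQ c hc d hd) _ (heQ c' hc' d' hd') v hv hv'
    have h1 := he1 c hc d hd
    have h2 := he1 c' hc' d' hd'
    rw [h] at h1
    omega
  · intro c d hc hd
    refine n3 _ (heQ c (by omega) d hd) _ (heQ _ hc d hd) ?_
    have h1 := he1 c (by omega) d hd
    have h2 := he1 _ hc d hd
    rw [castle, fromRel_adj]
    refine ⟨?_, Or.inl (Or.inr ⟨Fin.ext (by omega), by omega, Or.inr ?_⟩)⟩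
    · intro h; rw [h] at h1; omega
    · rw [h1.1, h2.1, hdiv _ hc, hdiv _ (by omega)]
  · intro c d hc hd
    refine n3 _ (heQ c hc d (by omega)) _ (heQ _ hc _ hd) ?_
    have h1 := he1 c hc d (by omega)
    have h2 := he1 _ hc _ hd
    rw [castle, fromRel_adj]
    refine ⟨?_, Or.inl (Or.inl ⟨Fin.ext (by omega), by omega⟩)⟩
    · intro h; rw [h] at h1; omega
  · rw [hs]; nlinarith [Nat.mul_le_mul_right (q * k) hq]
  · intro c r c' r' h
    have h1 : b (ix c r) = b (ix c' r') := by rw [← hp2, ← hp2]; exact congrArg (e · 0) h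
    have h2 := n4 h1
    have h3 : finProdFinEquiv (c, r) = finProdFinEquiv (c', r') := by
      have h4 := congrArg Fin.val h2
      exact Fin.ext h4
    have := finProdFinEquiv.injective h3
    simpa using this
  · intro c r; exact hp1 _
  · intro c r
    refine ⟨z (ix c r), ?_, zcol c r _ rfl⟩
    show _ ∈ ν (e (p _) 0)
    rw [hp2]
    exact (n5 _).2.1


/-! ## Blobs -/
structure Blob {V : Type} (G : SimpleGraph V) (β : Set V → Set V) (m p : ℕ) (T : Fin m → Set V)
    (X : Set V) : Prop where
  cn : ∀ i, T i = ∅ ∨ Cn G (T i)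
  dis : ∀ i j v, v ∈ T i → v ∈ T j → i = j
  sub : ∀ v ∈ X, ∃ i, v ∈ T i
  off : ∀ i, ∀ v ∈ T i, v ∉ β X
  card : ∀ i, (X ∩ T i).ncard ≤ p
  nb : Nb G (β X) = X

theorem card_le_of_fibres {V : Type} [Finite V] {X : Set V} {m p : ℕ} {T : Fin m → Set V}
    (hs : ∀ v ∈ X, ∃ i, v ∈ T i) (hc : ∀ i, (X ∩ T i).ncard ≤ p) : X.ncard ≤ m * p := by
  classical
  have := Fintype.ofFinite V
  have h1 : X.toFinset ⊆ Finset.univ.biUnion (fun i => (X ∩ T i).toFinset) := by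
    intro v hv
    obtain ⟨i, hi⟩ := hs v (by simpa using hv)
    simp only [Finset.mem_biUnion, Finset.mem_univ, true_and, Set.mem_toFinset]
    exact ⟨i, by simpa using hv, hi⟩
  have h2 := (Finset.card_le_card h1).trans Finset.card_biUnion_le
  rw [ncard_eq_toFinset_card']
  refine h2.trans ((Finset.sum_le_card_nsmul _ _ p ?_).trans ?_)
  · intro i _
    rw [← ncard_eq_toFinset_card']; exact hc i
  · simp

section
variable {V : Type} [Finite V] {G : SimpleGraph V} {β : Set V → Set V} {w m p : ℕ}

/-- shrinking a separator to the neighbourhood -/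
theorem hav_nb (hβ : Hav G w β) {Y : Set V} (hY : Y.ncard ≤ w) :
    Nb G (β Y) ⊆ Y ∧ β (Nb G (β Y)) = β Y := by
  have hc := hβ.comp Y hY
  have h1 : Nb G (β Y) ⊆ Y := Nb_sub hc
  have h2 : (Nb G (β Y)).ncard ≤ w := (ncard_le_ncard h1 (toFinite _)).trans hY
  refine ⟨h1, ?_⟩
  refine comp_eq (Y := Nb G (β Y)) ?_ (hβ.comp _ h2) ?_
  · exact comp_of_Nb (comp_cn hc) (hc.1.mono_right h1) le_rfl
  · obtain ⟨x, hx⟩ := (comp_cn hc).1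
    exact ⟨x, hβ.mono _ _ h1 hY hx, hx⟩

theorem Blob.le {T : Fin m → Set V} {X : Set V} (h : Blob G β m p T X) : X.ncard ≤ m * p :=
  card_le_of_fibres h.sub h.card

theorem blob_grow (hβ : Hav G w β) (hw : m * p + 1 ≤ w) {T : Fin m → Set V} {X : Set V}
    (h : Blob G β m p T X) {i : Fin m} (hi : (X ∩ T i).ncard < p) :
    ∃ T' X', Blob G β m p T' X' ∧ (β X').ncard < (β X).ncard := by
  classical
  have hX := h.le
  have hc := hβ.comp X (by omega)
  obtain ⟨y, D, hyC, hD, hDs, hyD, hDX, hDX'⟩ : ∃ y D, y ∈ β X ∧ Cn G D ∧ D ⊆ insert y (T i) ∧ y ∈ D ∧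
      X ∩ T i ⊆ D ∧ X ∩ D ⊆ T i := by
    by_cases hne : (X ∩ T i).Nonempty
    · obtain ⟨x, hx, hxT⟩ := hne
      rw [← h.nb] at hx
      obtain ⟨-, y, hy, hyx⟩ := hx
      refine ⟨y, insert y (T i), hy, ?_, le_rfl, mem_insert _ _,
        fun v hv => mem_insert_of_mem _ hv.2, ?_⟩
      · rcases h.cn i with h0 | h0
        · rw [h0] at hxT; exact absurd hxT (by simp)
        · exact h0.insert hxT hyx.symm
      · rintro v ⟨hv, rfl | hv'⟩
        · exact absurd hv (fun h' => Set.disjoint_left.1 hc.1 hy h')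
        · exact hv'
    · obtain ⟨y, hy⟩ := (comp_cn hc).1
      refine ⟨y, {y}, hy, Cn.singleton y, by simp, rfl, fun v hv => absurd ⟨v, hv⟩ hne, ?_⟩
      rintro v ⟨hv, rfl⟩
      exact absurd hv (fun h' => Set.disjoint_left.1 hc.1 hy h')
  have hX1 : (insert y X).ncard ≤ w := (ncard_insert_le y X).trans (by omega)
  have hyX : y ∉ X := fun h' => Set.disjoint_left.1 hc.1 hyC h'
  obtain ⟨n1, n2⟩ := hav_nb hβ hX1
  have hsub : β (insert y X) ⊆ β X := hβ.mono _ _ (subset_insert _ _) hX1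
  have hyC' : y ∉ β (insert y X) := fun h' =>
    Set.disjoint_left.1 (hβ.comp _ hX1).1 h' (mem_insert _ _)
  have hTy : ∀ j, y ∉ T j := fun j hj => h.off j y hj hyC
  refine ⟨Function.update T i D, Nb G (β (insert y X)), ⟨?_, ?_, ?_, ?_, ?_, ?_⟩, ?_⟩
  · intro j
    by_cases hj : j = i
    · subst hj; right; simpa using hD
    · rw [Function.update_of_ne hj]; exact h.cn j
  · intro j j' v hv hv'
    by_cases hj : j = i
    · by_cases hj' : j' = i
      · rw [hj, hj']
      · subst hj
        rw [Function.update_self] at hv; rw [Function.update_of_ne hj'] at hv'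
        rcases hDs hv with rfl | hv
        · exact absurd hv' (hTy j')
        · exact h.dis _ _ v hv hv'
    · rw [Function.update_of_ne hj] at hv
      by_cases hj' : j' = i
      · subst hj'
        rw [Function.update_self] at hv'
        rcases hDs hv' with rfl | hv'
        · exact absurd hv (hTy j)
        · exact h.dis _ _ v hv hv'
      · rw [Function.update_of_ne hj'] at hv'
        exact h.dis _ _ v hv hv'
  · intro v hv
    rcases n1 hv with rfl | hv
    · exact ⟨i, by simpa using hyD⟩
    · obtain ⟨j, hj⟩ := h.sub v hv
      refine ⟨j, ?_⟩
      by_cases hji : j = i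
      · subst hji; simpa using hDX ⟨hv, hj⟩
      · rwa [Function.update_of_ne hji]
  · intro j v hv
    rw [n2]
    by_cases hji : j = i
    · subst hji
      rw [Function.update_self] at hv
      rcases hDs hv with rfl | hv
      · exact hyC'
      · exact fun h' => h.off _ v hv (hsub h')
    · rw [Function.update_of_ne hji] at hv
      exact fun h' => h.off _ v hv (hsub h')
  · intro j
    by_cases hji : j = i
    · subst hji
      rw [Function.update_self]
      have : Nb G (β (insert y X)) ∩ D ⊆ insert y (X ∩ T j) := by
        rintro v ⟨hv, hv'⟩
        rcases n1 hv with rfl | hv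
        · exact mem_insert _ _
        · exact mem_insert_of_mem _ ⟨hv, hDX' ⟨hv, hv'⟩⟩
      have h1 := ncard_le_ncard this (toFinite _)
      have h2 := ncard_insert_le y (X ∩ T j)
      omega
    · rw [Function.update_of_ne hji]
      refine (ncard_le_ncard ?_ (toFinite _)).trans (h.card j)
      rintro v ⟨hv, hv'⟩
      rcases n1 hv with rfl | hv
      · exact absurd hv' (hTy j)
      · exact ⟨hv, hv'⟩
  · rw [n2]
  · rw [n2]
    exact ncard_lt_ncard ⟨hsub, fun h' => hyC' (h' hyC)⟩ (toFinite _)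

/-- subgraph of edges inside `D` -/
def rst (G : SimpleGraph V) (D : Set V) : SimpleGraph V where
  Adj x y := G.Adj x y ∧ x ∈ D ∧ y ∈ D
  symm := ⟨fun _ _ ⟨h, h1, h2⟩ => ⟨h.symm, h2, h1⟩⟩
  loopless := ⟨fun _ h => h.1.ne rfl⟩

theorem Rch.toRst {D S : Set V} {a b : V} (h : Rch G (S ∩ D) a b) : Rch (rst G D) S a b := by
  induction h with
  | refl h => exact Rch.refl h.1
  | step h e hc ih => exact ih.step ⟨e, h.right.2, hc.2⟩ hc.1

theorem blob_link (hβ : Hav G w β) (hw : 2 * (m * p) + 1 ≤ w) {T : Fin m → Set V} {X : Set V}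
    (h : Blob G β m p T X) (hfr : ¬ Free β X) :
    ∃ T' X', Blob G β m p T' X' ∧ (β X').ncard < (β X).ncard := by
  classical
  have hX := h.le
  have hc := hβ.comp X (by omega)
  have hex : ∃ d, ∃ Y : Set V, Y.ncard = d ∧ Y.ncard < X.ncard ∧ ¬ (β Y ∩ X).Nonempty := by
    unfold _root_.Free at hfr
    push Not at hfr
    obtain ⟨Y, h1, h2⟩ := hfr
    exact ⟨_, Y, rfl, h1, by rw [h2]; simp⟩
  obtain ⟨Y0, hY0d, hY0X, hY0e⟩ := Nat.find_spec hex
  have hmin := fun d (hd : d < Nat.find hex) => Nat.find_min hex hd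
  set d := Nat.find hex
  obtain ⟨n1, n2⟩ := hav_nb hβ (show Y0.ncard ≤ w by omega)
  obtain ⟨Y, hY⟩ : ∃ Y, Y = Nb G (β Y0) := ⟨_, rfl⟩
  rw [← hY] at n1 n2
  have hYd : Y.ncard = d := by
    have h1 := ncard_le_ncard n1 (toFinite _)
    rcases Nat.lt_or_ge Y.ncard d with h2 | h2
    · exact absurd ⟨Y, rfl, by omega, by rwa [n2]⟩ (hmin _ h2)
    · omega
  have hNb : Nb G (β Y) = Y := by rw [n2]; exact hY.symm
  have hcY := hβ.comp Y (by omega)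
  have hYe : ∀ v ∈ β Y, v ∉ X := by
    intro v hv hvX; rw [n2] at hv; exact hY0e ⟨v, hv, hvX⟩
  have hsub : β Y ⊆ β X := by
    refine (comp_cn hcY).sub_comp (Set.disjoint_left.2 hYe) hc ?_
    have hu : (X ∪ Y).ncard ≤ w := (ncard_union_le X Y).trans (by omega)
    obtain ⟨x, hx⟩ := (comp_cn (hβ.comp _ hu)).1
    exact ⟨x, hβ.mono _ _ subset_union_right hu hx, hβ.mono _ _ subset_union_left hu hx⟩
  have hlt : (β Y).ncard < (β X).ncard := by
    refine ncard_lt_ncard ⟨hsub, fun h' => ?_⟩ (toFinite _)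
    have : β Y = β X := subset_antisymm hsub h'
    rw [this, h.nb] at hNb
    rw [hNb] at hX
    rw [hNb] at hY0X; omega
  obtain ⟨f, len, L⟩ : ∃ f len, Lk (rst G (β X ∪ X)) X Y d f len := by
    apply menger
    intro S hS
    have hm := hmin _ hS
    have hmeet : (β S ∩ X).Nonempty := by
      by_contra hne
      exact hm ⟨S, rfl, by omega, hne⟩
    obtain ⟨x, hx, hxX⟩ := hmeet
    have hu : (S ∪ Y).ncard ≤ w := (ncard_union_le S Y).trans (by omega)
    obtain ⟨c, hcc⟩ := (comp_cn (hβ.comp _ hu)).1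
    have hcS := hβ.mono _ _ subset_union_left hu hcc
    have hcY' := hβ.mono _ _ subset_union_right hu hcc
    have hSc := hβ.comp S (by omega)
    have hr : Rch G Sᶜ c x := ((comp_cn hSc).2 c hcS x hx).mono
      (fun v hv hv' => Set.disjoint_left.1 hSc.1 hv hv')
    obtain ⟨x1, x2, h1, h2, h3, h4, h5, h6⟩ := hr.exit (fun v => v ∈ β X) (hsub hcY')
      (fun h' => Set.disjoint_left.1 hc.1 h' hxX)
    have hx2 : x2 ∈ X := by rw [← h.nb]; exact ⟨h2, x1, h1, h5⟩
    have hr2 : Rch G (Sᶜ ∩ (β X ∪ X)) c x2 :=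
      (h6.mono (fun v hv => ⟨hv.1, Or.inl hv.2⟩ : Sᶜ ∩ {v | v ∈ β X} ⊆ Sᶜ ∩ (β X ∪ X))).step h5
        ⟨h4, Or.inr hx2⟩
    obtain ⟨y1, y2, k1, k2, k3, k4, k5, k6⟩ := hr2.symm.exit (fun v => v ∉ β Y)
      (fun h' => hYe _ h' hx2) (fun h' => h' hcY')
    refine ⟨x2, hx2, y1, ?_, (k6.mono inter_subset_left).toRst⟩
    rw [← hNb]
    exact ⟨k1, y2, not_not.1 k2, k5.symm⟩
  have hGle : rst G (β X ∪ X) ≤ G := fun a b hab => hab.1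
  have hin : ∀ j t, t ≤ len j → f j t ∈ β X ∪ X := by
    intro j t ht
    rcases Nat.eq_zero_or_pos t with h0 | h0
    · subst h0; exact Or.inr (L.st j)
    · have := L.adj j (t - 1) (by omega)
      rw [show t - 1 + 1 = t by omega] at this
      exact this.2.2
  have hTX : ∀ i j t, t ≤ len j → f j t ∈ T i → t = 0 := by
    intro i j t ht hT
    rcases hin j t ht with h1 | h1
    · exact absurd h1 (h.off i _ hT)
    · exact L.trA j t ht h1
  have hoff : ∀ j t, t ≤ len j → f j t ∉ β Y := by
    intro j t
    induction t with
    | zero => intro _ h'; exact hYe _ h' (L.st j)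
    | succ t ih =>
      intro ht h'
      have h1 : f j t ∈ Y := by
        rw [← hNb]
        exact ⟨ih (by omega), _, h', (L.adj j t (by omega)).1.symm⟩
      have := L.trB j t (by omega) h1
      omega
  have hend : ∀ y ∈ Y, ∃ j, f j (len j) = y := by
    have hinj : Function.Injective (fun j => f j (len j)) := by
      intro j j' hjj
      exact (L.inj j _ j' _ le_rfl le_rfl hjj).1
    have h1 : range (fun j => f j (len j)) ⊆ Y := by
      rintro _ ⟨j, rfl⟩; exact L.fin j
    have h2 : (range (fun j => f j (len j))).ncard = d := by
      rw [← image_univ, ncard_image_of_injective _ hinj, ncard_univ]; simp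
    have h3 := eq_of_subset_of_ncard_le h1 (by omega) (toFinite _)
    intro y hy
    rw [← h3] at hy
    exact hy
  let T' : Fin m → Set V := fun i => T i ∪ ⋃ j ∈ {j | f j 0 ∈ T i}, PS f len j
  have hT' : ∀ i v, v ∈ T' i ↔ v ∈ T i ∨ ∃ j t, f j 0 ∈ T i ∧ t ≤ len j ∧ f j t = v := by
    intro i v
    simp only [T', mem_union, mem_iUnion, PS, mem_ofPred_eq]
    constructor
    · rintro (h | ⟨j, h1, t, h2, h3⟩)
      · exact Or.inl h
      · exact Or.inr ⟨j, t, h1, h2, h3⟩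
    · rintro (h | ⟨j, t, h1, h2, h3⟩)
      · exact Or.inl h
      · exact Or.inr ⟨j, h1, t, h2, h3⟩
  have hdis : ∀ i j v, v ∈ T' i → v ∈ T' j → i = j := by
    intro i i' v hv hv'
    rw [hT'] at hv hv'
    rcases hv with hv | ⟨j, t, h1, h2, h3⟩
    · rcases hv' with hv' | ⟨j', t', h1', h2', h3'⟩
      · exact h.dis _ _ v hv hv'
      · rw [← h3'] at hv
        have := hTX _ _ _ h2' hv
        subst this
        exact h.dis _ _ _ hv h1'
    · rcases hv' with hv' | ⟨j', t', h1', h2', h3'⟩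
      · rw [← h3] at hv'
        have := hTX _ _ _ h2 hv'
        subst this
        exact h.dis _ _ _ h1 hv'
      · obtain ⟨rfl, -⟩ := L.inj _ _ _ _ h2 h2' (h3.trans h3'.symm)
        exact h.dis _ _ _ h1 h1'
  refine ⟨T', Y, ⟨?_, hdis, ?_, ?_, ?_, hNb⟩, hlt⟩
  · intro i
    rcases h.cn i with h0 | h0
    · left
      ext v
      rw [hT', h0]
      simp
    · right
      refine h0.biUnion ?_
      intro j hj
      refine ⟨?_, ⟨_, hj, 0, Nat.zero_le _, rfl⟩⟩
      have := Cn.ofSeq (G := G) (f := f j) (Nat.zero_le (len j))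
        (fun t _ ht => (L.adj j t ht).1)
      convert this using 1
      ext v; simp [PS]
  · intro y hy
    obtain ⟨j, hj⟩ := hend y hy
    obtain ⟨i, hi⟩ := h.sub _ (L.st j)
    exact ⟨i, (hT' _ _).2 (Or.inr ⟨j, _, hi, le_rfl, hj⟩)⟩
  · intro i v hv
    rw [hT'] at hv
    rcases hv with hv | ⟨j, t, h1, h2, h3⟩
    · exact fun h' => h.off i v hv (hsub h')
    · rw [← h3]; exact hoff j t h2
  · intro i
    refine le_trans ?_ (h.card i)
    have : ∀ y : V, ∃ x : V, y ∈ Y → ∃ j, f j (len j) = y ∧ f j 0 = x := by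
      intro y
      by_cases hy : y ∈ Y
      · obtain ⟨j, hj⟩ := hend y hy
        exact ⟨_, fun _ => ⟨j, hj, rfl⟩⟩
      · exact ⟨y, fun h' => absurd h' hy⟩
    choose g hg using this
    refine ncard_le_ncard_of_injOn g ?_ ?_ (toFinite _)
    · rintro y ⟨hy, hyT⟩
      obtain ⟨j, h1, h2⟩ := hg y hy
      rw [← h2]
      obtain ⟨i', hi'⟩ := h.sub _ (L.st j)
      have := hdis i i' y hyT ((hT' _ _).2 (Or.inr ⟨j, _, hi', le_rfl, h1⟩))
      subst this
      exact ⟨L.st j, hi'⟩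
    · rintro y ⟨hy, -⟩ y' ⟨hy', -⟩ hyy
      obtain ⟨j, h1, h2⟩ := hg y hy
      obtain ⟨j', h1', h2'⟩ := hg y' hy'
      obtain ⟨rfl, -⟩ := L.inj j 0 j' 0 (Nat.zero_le _) (Nat.zero_le _) (h2.trans (hyy.trans h2'.symm))
      rw [← h1, ← h1']

theorem blobs (hβ : Hav G w β) (hp : 1 ≤ p) (hw : 2 * (m * p) + 1 ≤ w) :
    ∃ (T : Fin m → Set V) (X : Set V), Blob G β m p T X ∧ (∀ i, Cn G (T i)) ∧
      (∀ i, (X ∩ T i).ncard = p) ∧ Free β X := by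
  classical
  have hex : ∃ d, ∃ T X, Blob G β m p T X ∧ (β X).ncard = d := by
    refine ⟨_, fun _ => ∅, ∅, ⟨?_, ?_, ?_, ?_, ?_, ?_⟩, rfl⟩
    · intro i; left; rfl
    · intro i j v hv; exact absurd hv (by simp)
    · intro v hv; exact absurd hv (by simp)
    · intro i v hv; exact absurd hv (by simp)
    · intro i; simp
    · exact subset_empty_iff.1 (Nb_sub (hβ.comp ∅ (by simp)))
  obtain ⟨T, X, hB, hd⟩ := Nat.find_spec hex
  have hmin := fun d (hd : d < Nat.find hex) => Nat.find_min hex hd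
  have hcard : ∀ i, (X ∩ T i).ncard = p := by
    intro i
    by_contra hne
    obtain ⟨T', X', h1, h2⟩ := blob_grow hβ (by omega) hB
      (lt_of_le_of_ne (hB.card i) hne)
    exact hmin _ (by omega) ⟨T', X', h1, rfl⟩
  refine ⟨T, X, hB, ?_, hcard, ?_⟩
  · intro i
    rcases hB.cn i with h0 | h0
    · have := hcard i
      rw [h0] at this
      simp at this; omega
    · exact h0
  · by_contra hf
    obtain ⟨T', X', h1, h2⟩ := blob_link hβ hw hB hf
    exact hmin _ (by omega) ⟨T', X', h1, rfl⟩

theorem free_sub (hβ : Hav G w β) {X X' Y : Set V} (hX : X.ncard ≤ w) (hf : Free β X)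
    (hs : X' ⊆ X) (hY : Y.ncard < X'.ncard) : (β Y ∩ X').Nonempty := by
  have h1 : (Y ∪ (X \ X')).ncard < X.ncard := by
    have h2 := ncard_union_le Y (X \ X')
    have h3 := ncard_sdiff_add_ncard_of_subset hs (toFinite _)
    omega
  obtain ⟨x, hx, hxX⟩ := hf _ h1
  refine ⟨x, hβ.mono _ _ subset_union_left (by omega) hx, ?_⟩
  by_contra h
  exact Set.disjoint_left.1 (hβ.comp _ (by omega)).1 hx (Or.inr ⟨hxX, h⟩)

/-- edges inside `D ∪ A ∪ B` with an end in `D` -/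
def thr (G : SimpleGraph V) (D A : Set V) : SimpleGraph V where
  Adj x y := G.Adj x y ∧ ((x ∈ D ∧ y ∈ D) ∨ (x ∈ D ∧ y ∈ A) ∨ (x ∈ A ∧ y ∈ D))
  symm := ⟨fun _ _ ⟨h, h1⟩ => ⟨h.symm, by tauto⟩⟩
  loopless := ⟨fun _ h => h.1.ne rfl⟩

theorem blob_paths (hβ : Hav G w β) (hw : 2 * (m * p) + 1 ≤ w) {T : Fin m → Set V}
    {X : Set V} (h : Blob G β m p T X) (hcard : ∀ i, (X ∩ T i).ncard = p) (hf : Free β X)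
    {i j : Fin m} (hij : i ≠ j) :
    ∃ f len, Lk (thr G (β X) ((X ∩ T i) ∪ (X ∩ T j))) (X ∩ T i) (X ∩ T j) p f len := by
  classical
  apply menger
  intro S hS
  have hX := h.le
  have hc := hβ.comp X (by omega)
  have hmp : p ≤ m * p := Nat.le_mul_of_pos_left p (lt_of_le_of_lt (Nat.zero_le _) i.2)
  have hu : (X ∪ S).ncard ≤ w := (ncard_union_le X S).trans (by omega)
  have hcu := hβ.comp _ hu
  have hsub : β (X ∪ S) ⊆ β X := hβ.mono _ _ subset_union_left hu
  have key : ∀ i, ∃ x ∈ X ∩ T i, x ∉ S ∧ ∃ y ∈ β (X ∪ S), G.Adj x y := by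
    intro i
    have h1 : (S ∪ (X \ (X ∩ T i))).ncard < X.ncard := by
      have h2 := ncard_union_le S (X \ (X ∩ T i))
      have h3 := ncard_sdiff_add_ncard_of_subset (inter_subset_left : X ∩ T i ⊆ X) (toFinite _)
      have := hcard i
      omega
    obtain ⟨x, hx, hxX⟩ := hf _ h1
    have hle : β (X ∪ S) ⊆ β (S ∪ (X \ (X ∩ T i))) :=
      hβ.mono _ _ (by rintro v (hv | hv); exact Or.inr hv; exact Or.inl hv.1) hu
    have hcc := hβ.comp (S ∪ (X \ (X ∩ T i))) (by omega)
    obtain ⟨c, hcm⟩ := (comp_cn hcu).1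
    obtain ⟨a, b, e1, e2, e3, e4, e5, e6⟩ := ((comp_cn hcc).2 c (hle hcm) x hx).exit
      (fun v => v ∈ β (X ∪ S)) hcm (fun h' => Set.disjoint_left.1 hcu.1 h' (Or.inl hxX))
    have hb := Nb_sub hcu ⟨e2, a, e1, e5⟩
    have hb' := Set.disjoint_left.1 hcc.1 e4
    have hbS : b ∉ S := fun h' => hb' (Or.inl h')
    have hbX : b ∈ X := by
      rcases hb with hb | hb
      · exact hb
      · exact absurd hb hbS
    refine ⟨b, ?_, hbS, a, e1, e5.symm⟩
    by_contra hh
    exact hb' (Or.inr ⟨hbX, hh⟩)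
  obtain ⟨x, hx, hxS, a, ha, hxa⟩ := key i
  obtain ⟨y, hy, hyS, b, hb, hyb⟩ := key j
  have hin : ∀ v ∈ β (X ∪ S), v ∈ Sᶜ ∩ β X := fun v hv =>
    ⟨fun h' => Set.disjoint_left.1 hcu.1 hv (Or.inr h'), hsub hv⟩
  have hab : Rch (rst G (β X)) Sᶜ a b := (((comp_cn hcu).2 a ha b hb).mono hin).toRst
  have hle : rst G (β X) ≤ thr G (β X) ((X ∩ T i) ∪ (X ∩ T j)) :=
    fun u v huv => ⟨huv.1, Or.inl huv.2⟩
  refine ⟨x, hx, y, hy, ((Rch.edge hxS (hin _ ha).1 ?_).trans (hab.monoG hle)).step ?_ hyS⟩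
  · exact ⟨hxa, Or.inr (Or.inr ⟨Or.inl hx, hsub ha⟩)⟩
  · exact ⟨hyb.symm, Or.inr (Or.inl ⟨hsub hb, Or.inr hy⟩)⟩
end


/-! ## Patterns in connected graphs -/
theorem ball_card {d n : ℕ} {R : SimpleGraph (Fin d)} (hR : R.Connected) (v : Fin d)
    (hdeg : ∀ u, (R.neighborSet u).ncard < n) (r : ℕ) : {u | R.dist v u ≤ r}.ncard ≤ n ^ r := by
  classical
  induction r with
  | zero =>
    have : {u | R.dist v u ≤ 0} = {v} := by
      ext u
      simp [hR.dist_eq_zero_iff, eq_comm]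
    rw [this]; simp
  | succ r ih =>
    have hsub : {u | R.dist v u ≤ r + 1} ⊆
        ⋃ x : {u | R.dist v u ≤ r}, insert x.1 (R.neighborSet x.1) := by
      intro u hu
      rw [mem_iUnion]
      by_cases h : R.dist v u ≤ r
      · exact ⟨⟨u, h⟩, mem_insert _ _⟩
      · obtain ⟨p, hp⟩ := hR.exists_walk_length_eq_dist v u
        have hu' : R.dist v u ≤ r + 1 := hu
        have hlen : p.length = r + 1 := by omega
        refine ⟨⟨p.getVert r, ?_⟩, mem_insert_of_mem _ ?_⟩
        · refine (dist_le (p.take r)).trans ?_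
          simp [Walk.take_length]
        · have := p.adj_getVert_succ (i := r) (by omega)
          rw [← hlen, Walk.getVert_length] at this
          exact this
    refine (ncard_le_ncard hsub (toFinite _)).trans ((ncard_iUnion_le_of_finite _).trans ?_)
    rw [finsum_eq_sum_of_fintype]
    refine (Finset.sum_le_card_nsmul _ _ n ?_).trans ?_
    · intro x _
      have h1 := ncard_insert_le x.1 (R.neighborSet x.1)
      have := hdeg x.1
      omega
    · rw [smul_eq_mul, pow_succ]
      refine Nat.mul_le_mul_right _ (le_trans ?_ ih)
      rw [Finset.card_univ, ← Nat.card_eq_fintype_card]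
      exact le_of_eq (Nat.card_coe_set_eq _)

theorem pattern {d n : ℕ} {R : SimpleGraph (Fin d)} (hR : R.Connected) (hd : n ^ n < d) :
    ∃ J : ℕ → Fin d, (∀ a < n, ∀ b < n, J a = J b → a = b) ∧
      ∀ a, a + 1 < n → Rch R {u | u = J a ∨ u = J (a + 1) ∨ ∀ b < n, u ≠ J b} (J a) (J (a + 1)) := by
  classical
  have hd0 : 0 < d := by omega
  by_cases hdeg : ∀ u, (R.neighborSet u).ncard < n
  · obtain ⟨u, hu⟩ : ∃ u, ¬ R.dist ⟨0, hd0⟩ u ≤ n := by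
      by_contra hcon
      push Not at hcon
      have h1 := ball_card hR ⟨0, hd0⟩ hdeg n
      have h2 : {u | R.dist ⟨0, hd0⟩ u ≤ n} = univ := by ext u; simpa using hcon u
      rw [h2, ncard_univ] at h1
      simp at h1; omega
    obtain ⟨p, hp⟩ := hR.exists_walk_length_eq_dist ⟨0, hd0⟩ u
    have hpath := p.isPath_of_length_eq_dist hp
    refine ⟨fun a => p.getVert a, ?_, ?_⟩
    · intro a ha b hb hab
      exact hpath.getVert_injOn (by simp; omega) (by simp; omega) hab
    · intro a ha
      exact Rch.edge (Or.inl rfl) (Or.inr (Or.inl rfl)) (p.adj_getVert_succ (by omega))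
  · push Not at hdeg
    obtain ⟨u, hu⟩ := hdeg
    rcases Nat.eq_zero_or_pos n with h0 | h0
    · exact ⟨fun _ => ⟨0, hd0⟩, by intro a ha; omega, by intro a ha; omega⟩
    rw [ncard_eq_toFinset_card'] at hu
    obtain ⟨A, hA, hAn⟩ := Finset.exists_subset_card_eq hu
    let e := A.orderEmbOfFin hAn
    have he : ∀ i, R.Adj u (e i) := fun i => by
      have := hA (Finset.orderEmbOfFin_mem A hAn i)
      simpa using this
    refine ⟨fun a => if h : a < n then e ⟨a, h⟩ else ⟨0, hd0⟩, ?_, ?_⟩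
    · intro a ha b hb hab
      simp only [dif_pos ha, dif_pos hb] at hab
      have := e.injective hab
      simpa using this
    · intro a ha
      simp only [dif_pos ha, dif_pos (show a < n by omega)]
      have h1 := he ⟨a, by omega⟩
      have h2 := he ⟨a + 1, ha⟩
      refine ((Rch.refl ?_).step h1.symm ?_).step h2 ?_
      · exact Or.inl rfl
      · right; right
        intro b hb
        rw [dif_pos hb]
        exact (he _).ne
      · exact Or.inr (Or.inl rfl)

/-- connecting pattern of a connected set `K` through disjoint sets `P j` -/
def offR {V : Type} {d : ℕ} (G : SimpleGraph V) (P : Fin d → Set V) (K : Set V) :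
    SimpleGraph (Fin d) :=
  SimpleGraph.fromRel fun j j' => ∃ x ∈ P j, ∃ y ∈ P j',
    Rch G (K ∩ {v | v ∈ P j ∨ v ∈ P j' ∨ ∀ i, v ∉ P i}) x y

theorem offR_conn {V : Type} {d : ℕ} {G : SimpleGraph V} {P : Fin d → Set V} {K : Set V}
    (hd : 0 < d) (hK : Cn G K) (hP : ∀ j, (K ∩ P j).Nonempty) : (offR G P K).Connected := by
  classical
  have : Nonempty (Fin d) := ⟨⟨0, hd⟩⟩
  refine ⟨fun j j' => ?_⟩
  obtain ⟨x, hxK, hx⟩ := hP j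
  obtain ⟨y, hyK, hy⟩ := hP j'
  have key : ∃ j1, (offR G P K).Reachable j j1 ∧ ∃ x1 ∈ P j1,
      Rch G (K ∩ {v | v ∈ P j1 ∨ ∀ i, v ∉ P i}) x1 y := by
    refine (hK.2 x hxK y hyK).closed (fun v => ∃ j1, (offR G P K).Reachable j j1 ∧ ∃ x1 ∈ P j1,
      Rch G (K ∩ {v | v ∈ P j1 ∨ ∀ i, v ∉ P i}) x1 v) ?_ ?_
    · exact ⟨j, Reachable.refl _, x, hx, Rch.refl ⟨hxK, Or.inl hx⟩⟩
    · rintro v v' ⟨j1, hr, x1, hx1, h⟩ hv hv' e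
      by_cases hoff : ∀ i, v' ∉ P i
      · exact ⟨j1, hr, x1, hx1, h.step e ⟨hv', Or.inr hoff⟩⟩
      · push Not at hoff
        obtain ⟨j2, hj2⟩ := hoff
        by_cases h12 : j1 = j2
        · subst h12
          exact ⟨j1, hr, x1, hx1, h.step e ⟨hv', Or.inl hj2⟩⟩
        · refine ⟨j2, hr.trans (Adj.reachable ?_), v', hj2, Rch.refl ⟨hv', Or.inl hj2⟩⟩
          rw [offR, fromRel_adj]
          refine ⟨h12, Or.inl ⟨x1, hx1, v', hj2, (h.mono ?_).step e ⟨hv', Or.inr (Or.inl hj2)⟩⟩⟩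
          rintro z ⟨hz, hz' | hz'⟩
          · exact ⟨hz, Or.inl hz'⟩
          · exact ⟨hz, Or.inr (Or.inr hz')⟩
  obtain ⟨j1, hr, x1, hx1, h⟩ := key
  by_cases h1 : j1 = j'
  · rwa [h1] at hr
  · refine hr.trans (Adj.reachable ?_)
    rw [offR, fromRel_adj]
    refine ⟨h1, Or.inl ⟨x1, hx1, y, hy, h.mono ?_⟩⟩
    rintro z ⟨hz, hz' | hz'⟩
    · exact ⟨hz, Or.inl hz'⟩
    · exact ⟨hz, Or.inr (Or.inr hz')⟩


/-! ## Strips -/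
section strips
variable {V : Type} [Finite V] {G : SimpleGraph V} {A B : Set V} {d : ℕ} {f : Fin d → ℕ → V}
  {len : Fin d → ℕ} {ι : Type} {H : ι → Set V}

def Fgr (G : SimpleGraph V) (f : Fin d → ℕ → V) (len : Fin d → ℕ) (H : ι → Set V) :
    SimpleGraph V where
  Adj x y := G.Adj x y ∧ ((∃ j t, t < len j ∧ s(x, y) = s(f j t, f j (t + 1))) ∨
    ∃ i, x ∈ H i ∧ y ∈ H i)
  symm := ⟨by
    rintro x y ⟨h, h1⟩
    refine ⟨h.symm, ?_⟩
    rw [Sym2.eq_swap]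
    exact h1.imp id (fun ⟨i, a, b⟩ => ⟨i, b, a⟩)⟩
  loopless := ⟨fun _ h => h.1.ne rfl⟩

theorem Lk.edge_inj (L : Lk G A B d f len) {j j' : Fin d} {t t' : ℕ} (ht : t < len j)
    (ht' : t' < len j') (h : s(f j t, f j (t + 1)) = s(f j' t', f j' (t' + 1))) :
    j = j' ∧ t = t' := by
  rw [Sym2.eq_iff] at h
  rcases h with ⟨h1, h2⟩ | ⟨h1, h2⟩
  · exact L.inj _ _ _ _ ht.le ht'.le h1
  · have h3 := L.inj j t j' (t' + 1) (by omega) (by omega) h1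
    have h4 := L.inj j (t + 1) j' t' (by omega) (by omega) h2
    omega

theorem cut (L : Lk G A B d f len) (hdis : ∀ i i' v, v ∈ H i → v ∈ H i' → i = i')
    (hcn : ∀ i, Cn G (H i)) (hHA : ∀ i, ∀ v ∈ H i, v ∉ A) (j0 : Fin d) (m : ι → ℕ)
    (hm : ∀ i, m i ≤ len j0 ∧ f j0 (m i) ∈ H i ∧ ∀ t < m i, f j0 t ∉ H i) (i : ι)
    (hNR : ¬ ∃ f' len', Lk ((Fgr G f len H).deleteEdges {s(f j0 (m i - 1), f j0 (m i))}) A B d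
      f' len') :
    ∃ (c : Fin d → ℕ) (S : Set V), S.ncard < d ∧ ∀ k, Disjoint (H k) S →
      (m k < m i → ∀ j t, t ≤ len j → f j t ∈ H k → t < c j) ∧
      (m i ≤ m k → ∀ j t, t ≤ len j → f j t ∈ H k → c j ≤ t) := by
  classical
  obtain ⟨F', hF'⟩ : ∃ F', F' = (Fgr G f len H).deleteEdges {s(f j0 (m i - 1), f j0 (m i))} :=
    ⟨_, rfl⟩
  rw [← hF'] at hNR
  have hm1 : 1 ≤ m i := by
    rcases Nat.eq_zero_or_pos (m i) with h | h
    · have := (hm i).2.1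
      rw [h] at this
      exact absurd (L.st j0) (hHA i _ this)
    · exact h
  have hmsucc : m i - 1 + 1 = m i := by omega
  obtain ⟨S, hS, hsep⟩ : ∃ S : Set V, S.ncard < d ∧ ∀ a ∈ A, ∀ b ∈ B, ¬ Rch F' Sᶜ a b := by
    by_contra hcon
    push Not at hcon
    exact hNR (menger hcon)
  have hedge : ∀ j t, t < len j → (j = j0 → t + 1 ≠ m i) → F'.Adj (f j t) (f j (t + 1)) := by
    intro j t ht hne
    rw [hF', deleteEdges_adj]
    refine ⟨⟨L.adj j t ht, Or.inl ⟨j, t, ht, rfl⟩⟩, ?_⟩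
    intro h
    rw [mem_singleton_iff] at h
    have h2 := L.edge_inj (j' := j0) (t' := m i - 1) ht (by have := (hm i).1; omega)
      (by rw [hmsucc]; exact h)
    exact hne h2.1 (by omega)
  have hσ : ∀ j, ∃ σ, j ≠ j0 → σ ≤ len j ∧ f j σ ∈ S := by
    intro j
    by_cases hj : j = j0
    · exact ⟨0, fun h => absurd hj h⟩
    · by_contra hcon
      push Not at hcon
      refine hsep _ (L.st j) _ (L.fin j) (Rch.ofSeq (f := f j) (Nat.zero_le _) ?_ ?_)
      · intro t _ ht hS'
        exact (hcon t).2 ht hS'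
      · intro t _ ht
        exact hedge j t ht (fun h => absurd h hj)
  choose σ hσ using hσ
  have hSeq : ∀ j t, t ≤ len j → f j t ∈ S → j ≠ j0 ∧ t = σ j := by
    have h1 : (fun j => f j (σ j)) '' {j | j ≠ j0} ⊆ S := by
      rintro _ ⟨j, hj, rfl⟩; exact (hσ j hj).2
    have h2 : ((fun j => f j (σ j)) '' {j | j ≠ j0}).ncard = d - 1 := by
      rw [ncard_image_of_injOn]
      · have : {j | j ≠ j0} = (({j0} : Set (Fin d)))ᶜ := by ext; simp
        rw [this, ncard_compl]; simp
      · intro j hj j' hj' hjj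
        exact (L.inj _ _ _ _ (hσ j hj).1 (hσ j' hj').1 hjj).1
    have h3 := eq_of_subset_of_ncard_le h1 (by omega) (toFinite _)
    intro j t ht hS'
    rw [← h3] at hS'
    obtain ⟨j', hj', he⟩ := hS'
    obtain ⟨h4, h5⟩ := L.inj _ _ _ _ (hσ j' hj').1 ht he
    subst h4
    exact ⟨hj', h5.symm⟩
  let P : V → Prop := fun v => ∃ a ∈ A, Rch F' Sᶜ a v
  let c : Fin d → ℕ := fun j => if j = j0 then m i else σ j
  have hc0 : c j0 = m i := if_pos rfl
  have hcj : ∀ j, j ≠ j0 → c j = σ j := fun j hj => if_neg hj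
  have p1 : ∀ j t, t ≤ len j → t < c j → P (f j t) := by
    intro j t ht htc
    refine ⟨_, L.st j, Rch.ofSeq (f := f j) (Nat.zero_le _) ?_ ?_⟩
    · intro t' _ ht' hS'
      obtain ⟨h1, h2⟩ := hSeq j t' (by omega) hS'
      rw [hcj j h1] at htc; omega
    · intro t' _ ht'
      refine hedge j t' (by omega) ?_
      intro hj; subst hj; omega
  have p2 : ∀ j t, t ≤ len j → (j = j0 → m i ≤ t) → (j ≠ j0 → σ j < t) → ¬ P (f j t) := by
    rintro j t ht h1 h2 ⟨a, ha, hr⟩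
    refine hsep a ha _ (L.fin j) (hr.trans (Rch.ofSeq (f := f j) ht ?_ ?_))
    · intro t' ht' ht'' hS'
      obtain ⟨h3, h4⟩ := hSeq j t' (by omega) hS'
      have := h2 h3; omega
    · intro t' ht' ht''
      refine hedge j t' (by omega) ?_
      intro hj; have := h1 hj; omega
  have p3 : ∀ k, Disjoint (H k) S → ∀ u ∈ H k, ∀ v ∈ H k, P u → P v := by
    rintro k hk u hu v hv ⟨a, ha, hr⟩
    refine ⟨a, ha, hr.trans ?_⟩
    refine ((hcn k).2 u hu v hv).closed (fun v => Rch F' Sᶜ u v) (Rch.refl hr.right) ?_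
    intro x y hx hxk hyk hxy
    refine hx.step ?_ (fun h => Set.disjoint_left.1 hk hyk h)
    rw [hF', deleteEdges_adj]
    refine ⟨⟨hxy, Or.inr ⟨k, hxk, hyk⟩⟩, ?_⟩
    intro h
    rw [mem_singleton_iff, Sym2.eq_iff] at h
    have hlast := (hm i).2.2 (m i - 1) (by omega)
    have hfi := (hm i).2.1
    rcases h with ⟨h1, h2⟩ | ⟨h1, h2⟩
    · rw [← h2] at hfi
      rw [← h1] at hlast
      rw [hdis k i y hyk hfi] at hxk
      exact hlast hxk
    · rw [← h1] at hfi
      rw [← h2] at hlast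
      rw [hdis k i x hxk hfi] at hyk
      exact hlast hyk
  refine ⟨c, S, hS, ?_⟩
  intro k hk
  constructor
  · intro hlt j t ht hf
    have h1 : P (f j0 (m k)) := p1 j0 _ (hm k).1 (by rw [hc0]; exact hlt)
    have h2 := p3 k hk _ (hm k).2.1 _ hf h1
    by_contra hge
    refine p2 j t ht ?_ ?_ h2
    · intro hj; subst hj; rw [hc0] at hge; omega
    · intro hj
      rw [hcj j hj] at hge
      rcases Nat.lt_or_ge (σ j) t with h3 | h3
      · exact h3
      · have : t = σ j := by omega
        subst this
        exact absurd (hσ j hj).2 (fun h' => Set.disjoint_left.1 hk hf h')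
  · intro hle j t ht hf
    by_contra hlt
    have h1 := p3 k hk _ hf _ (hm k).2.1 (p1 j t ht (by omega))
    exact p2 j0 _ (hm k).1 (fun _ => hle) (fun h => absurd rfl h) h1
end strips

theorem ladder {V : Type} [Finite V] {G : SimpleGraph V} {A B : Set V} {d n0 N : ℕ}
    {f : Fin d → ℕ → V} {len : Fin d → ℕ} {H : Fin n0 → Set V} (hd : 0 < d) (hN : 0 < N)
    (hn0 : N * (N * d) ≤ n0) (L : Lk G A B d f len)
    (hdis : ∀ i i' v, v ∈ H i → v ∈ H i' → i = i') (hcn : ∀ i, Cn G (H i))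
    (hHA : ∀ i, ∀ v ∈ H i, v ∉ A) (hhit : ∀ i j, ∃ t, t ≤ len j ∧ f j t ∈ H i)
    (hNR : ∀ i j t, t < len j → f j t ∉ H i → f j (t + 1) ∈ H i →
      ¬ ∃ f' len', Lk ((Fgr G f len H).deleteEdges {s(f j t, f j (t + 1))}) A B d f' len') :
    ∃ (K : ℕ → Fin n0) (c : Fin d → ℕ → ℕ), (∀ i < N, ∀ i' < N, K i = K i' → i = i') ∧
      (∀ j, c j 0 = 0) ∧ (∀ j, c j N = len j + 1) ∧ (∀ j, ∀ i < N, c j i < c j (i + 1)) ∧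
      (∀ i < N, ∀ j t, t ≤ len j → f j t ∈ H (K i) → c j i ≤ t ∧ t < c j (i + 1)) := by
  classical
  let j0 : Fin d := ⟨0, hd⟩
  have hex : ∀ i, ∃ t, t ≤ len j0 ∧ f j0 t ∈ H i := fun i => hhit i j0
  let m : Fin n0 → ℕ := fun i => Nat.find (hex i)
  have hm : ∀ i, m i ≤ len j0 ∧ f j0 (m i) ∈ H i ∧ ∀ t < m i, f j0 t ∉ H i := by
    intro i
    have h1 := Nat.find_spec (hex i)
    refine ⟨h1.1, h1.2, ?_⟩
    intro t ht h2
    exact Nat.find_min (hex i) ht ⟨by have : t < Nat.find (hex i) := ht; omega, h2⟩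
  have hminj : Function.Injective m := by
    intro i i' h
    have h1 := (hm i').2.1
    rw [← h] at h1
    exact hdis _ _ _ (hm i).2.1 h1
  have hcut : ∀ i, ∃ (c : Fin d → ℕ) (S : Set V), S.ncard < d ∧ ∀ k, Disjoint (H k) S →
      (m k < m i → ∀ j t, t ≤ len j → f j t ∈ H k → t < c j) ∧
      (m i ≤ m k → ∀ j t, t ≤ len j → f j t ∈ H k → c j ≤ t) := by
    intro i
    refine cut L hdis hcn hHA j0 m hm i ?_
    have hm1 : 1 ≤ m i := by
      rcases Nat.eq_zero_or_pos (m i) with h | h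
      · have := (hm i).2.1
        rw [h] at this
        exact absurd (L.st j0) (hHA i _ this)
      · exact h
    have hh := hNR i j0 (m i - 1) (by have := (hm i).1; omega) ((hm i).2.2 _ (by omega))
      (by rw [show m i - 1 + 1 = m i by omega]; exact (hm i).2.1)
    rwa [show m i - 1 + 1 = m i by omega] at hh
  choose c S hS hc using hcut
  let τ := Tuple.sort m
  have hτ : StrictMono (m ∘ τ) := (Tuple.monotone_sort m).strictMono_of_injective
    (hminj.comp τ.injective)
  set D := N * d with hD
  have hidx : ∀ i < N, ∀ r < D, i * D + r < n0 := by
    intro i hi r hr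
    have : (i + 1) * D ≤ N * D := Nat.mul_le_mul_right _ hi
    have h2 : (i + 1) * D = i * D + D := by ring
    omega
  have hD0 : 0 < D := Nat.mul_pos hN hd
  have hn0p : 0 < n0 := by have := hidx 0 hN 0 hD0; omega
  let ix : ℕ → Fin n0 := fun k => if h : k < n0 then τ ⟨k, h⟩ else ⟨0, hn0p⟩
  have hix : ∀ k (h : k < n0), ix k = τ ⟨k, h⟩ := fun k h => dif_pos h
  have hixm : ∀ k k', k < n0 → k' < n0 → k < k' → m (ix k) < m (ix k') := by
    intro k k' h h' hlt
    rw [hix k h, hix k' h']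
    exact hτ (by simpa using hlt)
  let bad : Set V := ⋃ i : Fin N, S (ix (i.val * D))
  have hbad : bad.ncard < D := by
    refine lt_of_le_of_lt (ncard_iUnion_le_of_fintype _) ?_
    refine lt_of_le_of_lt (Finset.sum_le_card_nsmul _ _ (d - 1) ?_) ?_
    · intro i _
      have := hS (ix (i.val * D)); omega
    · simp only [Finset.card_univ, Fintype.card_fin, smul_eq_mul, hD]
      exact Nat.mul_lt_mul_of_pos_left (by omega) hN
  have hg : ∀ v : V, ∃ k, ∀ k' < n0, v ∈ H (ix k') → k' = k := by
    intro v
    by_cases h : ∃ k < n0, v ∈ H (ix k)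
    · obtain ⟨k, hk, hv⟩ := h
      refine ⟨k, ?_⟩
      intro k' hk' hv'
      have := hdis _ _ v hv hv'
      by_contra hne
      rcases Nat.lt_or_gt_of_ne hne with h1 | h1
      · have := hixm _ _ hk' hk h1; rw [‹ix k = _›] at this; omega
      · have := hixm _ _ hk hk' h1; rw [‹ix k = _›] at this; omega
    · push Not at h
      exact ⟨0, fun k' hk' hv => absurd hv (h k' hk')⟩
  choose g hg using hg
  have hpick : ∀ i, ∃ k, i < N → i * D ≤ k ∧ k < i * D + D ∧ Disjoint (H (ix k)) bad := by
    intro i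
    obtain ⟨k, h1, h2, h3⟩ := miss bad g (i * D) D hbad
    refine ⟨k, fun hi => ⟨h1, h2, Set.disjoint_left.2 ?_⟩⟩
    intro v hv hvb
    have hk : k < n0 := by have := hidx i hi (k - i * D) (by omega); omega
    exact h3 v hvb (hg v k hk hv).symm
  choose κ hκ using hpick
  have hκlt : ∀ i < N, κ i < n0 := by
    intro i hi
    obtain ⟨h1, h2, -⟩ := hκ i hi
    have := hidx i hi (κ i - i * D) (by omega); omega
  have hmulle : ∀ i i', i ≤ i' → i * D ≤ i' * D := fun i i' h => Nat.mul_le_mul_right _ h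
  have hmullt : ∀ i i', i < i' → i * D + D ≤ i' * D := fun i i' h => by
    have := Nat.mul_le_mul_right D (show i + 1 ≤ i' from h)
    have h2 : (i + 1) * D = i * D + D := by ring
    omega
  have hkey1 : ∀ i < N, ∀ i' < N, i' ≤ i → ∀ j t, t ≤ len j → f j t ∈ H (ix (κ i)) →
      c (ix (i' * D)) j ≤ t := by
    intro i hi i' hi' hle
    obtain ⟨h1, h2, h3⟩ := hκ i hi
    refine (hc (ix (i' * D)) (ix (κ i)) (h3.mono_right
      (subset_iUnion (fun i : Fin N => S (ix (i.val * D))) ⟨i', hi'⟩))).2 ?_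
    have h4 := hmulle i' i hle
    rcases Nat.lt_or_ge (i' * D) (κ i) with h5 | h5
    · exact (hixm _ _ (by have := hκlt i hi; omega) (hκlt i hi) h5).le
    · rw [show κ i = i' * D by omega]
  have hkey2 : ∀ i < N, ∀ i' < N, i < i' → ∀ j t, t ≤ len j → f j t ∈ H (ix (κ i)) →
      t < c (ix (i' * D)) j := by
    intro i hi i' hi' hlt
    obtain ⟨h1, h2, h3⟩ := hκ i hi
    refine (hc (ix (i' * D)) (ix (κ i)) (h3.mono_right
      (subset_iUnion (fun i : Fin N => S (ix (i.val * D))) ⟨i', hi'⟩))).1 ?_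
    have h4 := hmullt i i' hlt
    have := hidx i' hi' 0 hD0
    exact hixm _ _ (hκlt i hi) (by omega) (by omega)
  let c' : Fin d → ℕ → ℕ := fun j i => if i = 0 then 0 else if i = N then len j + 1 else
    c (ix (i * D)) j
  have hfin : ∀ i < N, ∀ j t, t ≤ len j → f j t ∈ H (ix (κ i)) → c' j i ≤ t ∧ t < c' j (i + 1) := by
    intro i hi j t ht hf
    simp only [c']
    constructor
    · split_ifs with h1 h2
      · omega
      · omega
      · exact hkey1 i hi i hi le_rfl j t ht hf
    · rw [if_neg (by omega)]
      split_ifs with h2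
      · omega
      · exact hkey2 i hi (i + 1) (by omega) (by omega) j t ht hf
  refine ⟨fun i => ix (κ i), c', ?_, ?_, ?_, ?_, hfin⟩
  · intro i hi i' hi' h
    by_contra hne
    have a1 := hκ i hi
    have a2 := hκ i' hi'
    have b1 := hκlt i hi
    have b2 := hκlt i' hi'
    have h' : m (ix (κ i)) = m (ix (κ i')) := congrArg m h
    rcases Nat.lt_or_gt_of_ne hne with h1 | h1
    · have := hmullt _ _ h1
      have := hixm (κ i) (κ i') b1 b2 (by omega)
      omega
    · have := hmullt _ _ h1
      have := hixm (κ i') (κ i) b2 b1 (by omega)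
      omega
  · intro j; simp [c']
  · intro j; simp only [c']; rw [if_neg (by omega)]; simp
  · intro j i hi
    obtain ⟨t, ht, hf⟩ := hhit (ix (κ i)) j
    have := hfin i hi j t ht hf
    omega


/-! ## Grid from strips -/
theorem Cn.chain {V : Type} {G : SimpleGraph V} {E : ℕ → Set V} {lo hi : ℕ} (h : lo ≤ hi)
    (hc : ∀ i, lo ≤ i → i ≤ hi → Cn G (E i))
    (ha : ∀ i, lo ≤ i → i < hi → ∃ u ∈ E i, ∃ v ∈ E (i + 1), G.Adj u v) :
    Cn G {v | ∃ i, lo ≤ i ∧ i ≤ hi ∧ v ∈ E i} := by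
  induction hi, h using Nat.le_induction with
  | base =>
    have : {v | ∃ i, lo ≤ i ∧ i ≤ lo ∧ v ∈ E i} = E lo := by
      ext v; constructor
      · rintro ⟨i, h1, h2, h3⟩
        obtain rfl : i = lo := by omega
        exact h3
      · intro h; exact ⟨lo, le_rfl, le_rfl, h⟩
    rw [this]; exact hc lo le_rfl le_rfl
  | succ b hb ih =>
    have ih' := ih (fun i h1 h2 => hc i h1 (by omega)) (fun i h1 h2 => ha i h1 (by omega))
    obtain ⟨u, hu, v, hv, e⟩ := ha b hb (by omega)
    have := ih'.unionAdj (hc (b + 1) (by omega) le_rfl) ⟨b, hb, le_rfl, hu⟩ hv e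
    convert this using 1
    ext x; constructor
    · rintro ⟨i, h1, h2, h3⟩
      rcases Nat.lt_or_ge b i with h | h
      · obtain rfl : i = b + 1 := by omega
        exact Or.inr h3
      · exact Or.inl ⟨i, h1, h, h3⟩
    · rintro (⟨i, h1, h2, h3⟩ | h)
      · exact ⟨i, h1, by omega, h3⟩
      · exact ⟨b + 1, by omega, le_rfl, h⟩

theorem layer {V : Type} {G : SimpleGraph V} {d n : ℕ} {P B : Fin d → Set V} {K : Set V}
    {J : ℕ → Fin d} {a : ℕ} (hBP : ∀ j, B j ⊆ P j) (hPd : ∀ j j' v, v ∈ P j → v ∈ P j' → j = j')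
    (hB : ∀ j, Cn G (B j)) (hKB : ∀ j, ∀ v ∈ K, v ∈ P j → v ∈ B j)
    (hw : Rch (offR G P K) {u | u = J a ∨ u = J (a + 1) ∨ ∀ b < n, u ≠ J b} (J a) (J (a + 1)))
    {x y : V} (hx : x ∈ B (J a)) (hy : y ∈ B (J (a + 1))) :
    Rch G (B (J a) ∪ B (J (a + 1)) ∪ {v | (v ∈ K ∨ ∃ j, v ∈ B j) ∧ ∀ b < n, v ∉ P (J b)}) x y := by
  set W := B (J a) ∪ B (J (a + 1)) ∪ {v | (v ∈ K ∨ ∃ j, v ∈ B j) ∧ ∀ b < n, v ∉ P (J b)} with hW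
  have hsub : ∀ u : Fin d, (u = J a ∨ u = J (a + 1) ∨ ∀ b < n, u ≠ J b) → B u ⊆ W := by
    rintro u (rfl | rfl | hu) v hv
    · exact Or.inl (Or.inl hv)
    · exact Or.inl (Or.inr hv)
    · exact Or.inr ⟨Or.inr ⟨u, hv⟩, fun b hb hv' => hu b hb (hPd _ _ v (hBP _ hv) hv')⟩
  have key : ∀ u u' : Fin d, B u ⊆ W → B u' ⊆ W → ∀ p ∈ P u, ∀ r ∈ P u',
      Rch G (K ∩ {v | v ∈ P u ∨ v ∈ P u' ∨ ∀ i, v ∉ P i}) p r →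
      ∃ p ∈ B u, ∃ r ∈ B u', Rch G W p r := by
    intro u u' hu hu' p hp r hr h
    refine ⟨p, hKB u p h.left.1 hp, r, hKB u' r h.right.1 hr, h.mono ?_⟩
    rintro v ⟨hvK, hv | hv | hv⟩
    · exact hu (hKB u v hvK hv)
    · exact hu' (hKB u' v hvK hv)
    · exact Or.inr ⟨Or.inl hvK, fun b _ => hv _⟩
  refine hw.closed (fun u => ∀ y ∈ B u, Rch G W x y)
    (fun y hy => ((hB _).2 x hx y hy).mono (hsub _ (Or.inl rfl))) ?_ y hy
  intro u u' ih hu hu' e z hz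
  obtain ⟨p, hp, r, hr, h⟩ : ∃ p ∈ B u, ∃ r ∈ B u', Rch G W p r := by
    rw [offR, fromRel_adj] at e
    rcases e.2 with ⟨p, hp, r, hr, h⟩ | ⟨p, hp, r, hr, h⟩
    · exact key u u' (hsub u hu) (hsub u' hu') p hp r hr h
    · obtain ⟨p, hp, r, hr, h⟩ := key u' u (hsub u' hu') (hsub u hu) p hp r hr h
      exact ⟨r, hr, p, hp, h.symm⟩
  exact ((ih p hp).trans h).trans (((hB u').2 r hr z hz).mono (hsub u' hu'))

theorem strip_grid {V : Type} {G : SimpleGraph V} {d n l : ℕ} (hn : 0 < n) {P : Fin d → Set V}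
    {B : Fin d → ℕ → Set V} {K : ℕ → Set V} {J : ℕ → Fin d}
    (hBP : ∀ j i, B j i ⊆ P j) (hPd : ∀ j j' v, v ∈ P j → v ∈ P j' → j = j')
    (hBd : ∀ j, ∀ i i', ∀ v, v ∈ B j i → v ∈ B j i' → i = i')
    (hB : ∀ j, ∀ i < n * l, Cn G (B j i))
    (hBa : ∀ j i, i + 1 < n * l → ∃ u ∈ B j i, ∃ v ∈ B j (i + 1), G.Adj u v)
    (hKd : ∀ i < n * l, ∀ i' < n * l, ∀ v, v ∈ K i → v ∈ K i' → i = i')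
    (hKB : ∀ i < n * l, ∀ j, ∀ v ∈ K i, v ∈ P j → v ∈ B j i)
    (hJ : ∀ a < n, ∀ b < n, J a = J b → a = b)
    (hw : ∀ i < n * l, ∀ a, a + 1 < n → Rch (offR G P (K i))
      {u | u = J a ∨ u = J (a + 1) ∨ ∀ b < n, u ≠ J b} (J a) (J (a + 1))) :
    ∃ D : ℕ → ℕ → Set V, (∀ a < n, ∀ r < l, Cn G (D a r)) ∧
      (∀ a < n, ∀ r < l, ∀ a' < n, ∀ r' < l, ∀ v, v ∈ D a r → v ∈ D a' r' → a = a' ∧ r = r') ∧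
      (∀ a < n, ∀ r, r + 1 < l → ∃ u ∈ D a r, ∃ v ∈ D a (r + 1), G.Adj u v) ∧
      (∀ a, a + 1 < n → ∀ r < l, ∃ u ∈ D a r, ∃ v ∈ D (a + 1) r, G.Adj u v) ∧
      (∀ a < n, B (J a) 0 ⊆ D a 0) := by
  classical
  let U : ℕ → Set V := fun i => {v | (v ∈ K i ∨ ∃ j, v ∈ B j i) ∧ ∀ b < n, v ∉ P (J b)}
  let E : ℕ → ℕ → Set V := fun a i => {v | v ∈ B (J a) i ∨
    (i % n = a ∧ ∃ x ∈ B (J a) i, Rch G (B (J a) i ∪ U i) x v)}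
  have hEsub : ∀ a i v, v ∈ E a i → v ∈ B (J a) i ∨ (i % n = a ∧ v ∈ U i) := by
    rintro a i v (h | ⟨h, x, hx, hr⟩)
    · exact Or.inl h
    · rcases hr.right with h1 | h1
      · exact Or.inl h1
      · exact Or.inr ⟨h, h1⟩
  have hUd : ∀ i < n * l, ∀ i' < n * l, ∀ v, v ∈ U i → v ∈ U i' → i = i' := by
    rintro i hi i' hi' v ⟨h1, -⟩ ⟨h2, -⟩
    rcases h1 with h1 | ⟨j, h1⟩ <;> rcases h2 with h2 | ⟨j', h2⟩
    · exact hKd i hi i' hi' v h1 h2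
    · exact hBd j' _ _ v (hKB i hi j' v h1 (hBP _ _ h2)) h2
    · exact hBd j _ _ v h1 (hKB i' hi' j v h2 (hBP _ _ h1))
    · obtain rfl := hPd _ _ v (hBP _ _ h1) (hBP _ _ h2)
      exact hBd j _ _ v h1 h2
  have hEd : ∀ a < n, ∀ i < n * l, ∀ a' < n, ∀ i' < n * l, ∀ v, v ∈ E a i → v ∈ E a' i' →
      a = a' ∧ i = i' := by
    intro a ha i hi a' ha' i' hi' v h h'
    rcases hEsub _ _ _ h with h1 | ⟨h1, h2⟩ <;> rcases hEsub _ _ _ h' with h1' | ⟨h1', h2'⟩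
    · obtain rfl := hJ a ha a' ha' (hPd _ _ v (hBP _ _ h1) (hBP _ _ h1'))
      exact ⟨rfl, hBd _ _ _ v h1 h1'⟩
    · exact absurd (hBP _ _ h1) (h2'.2 a ha)
    · exact absurd (hBP _ _ h1') (h2.2 a' ha')
    · obtain rfl := hUd i hi i' hi' v h2 h2'
      exact ⟨h1.symm.trans h1', rfl⟩
  have hBE : ∀ a i, B (J a) i ⊆ E a i := fun a i v hv => Or.inl hv
  have hEc : ∀ a, ∀ i < n * l, Cn G (E a i) := by
    intro a i hi
    by_cases h : i % n = a
    · obtain ⟨x, hx⟩ := (hB (J a) i hi).1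
      have hc : Cn G {v | Rch G (B (J a) i ∪ U i) x v} := Cn.comp (Or.inl hx)
      have heq : E a i = {v | Rch G (B (J a) i ∪ U i) x v} := by
        ext v; constructor
        · rintro (h1 | ⟨-, y, hy, hr⟩)
          · exact ((hB (J a) i hi).2 x hx v h1).mono subset_union_left
          · exact (((hB (J a) i hi).2 x hx y hy).mono subset_union_left).trans hr
        · intro h1; exact Or.inr ⟨h, x, hx, h1⟩
      rw [heq]; exact hc
    · have heq : E a i = B (J a) i := by
        ext v; constructor
        · rintro (h1 | ⟨h1, -⟩)
          · exact h1
          · exact absurd h1 h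
        · intro h1; exact Or.inl h1
      rw [heq]; exact hB _ i hi
  have hidx : ∀ r < l, ∀ i, i ≤ r * n + (n - 1) → i < n * l := by
    intro r hr i hi
    have : (r + 1) * n ≤ l * n := Nat.mul_le_mul_right n hr
    rw [Nat.add_mul, Nat.mul_comm l n] at this
    omega
  have hdivu : ∀ r r' i, r * n ≤ i → i ≤ r * n + (n - 1) → r' * n ≤ i → i ≤ r' * n + (n - 1) →
      r = r' := by
    intro r r' i h1 h2 h3 h4
    have e1 : i / n = r := Nat.div_eq_of_lt_le (by linarith) (by rw [Nat.add_mul]; omega)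
    have e2 : i / n = r' := Nat.div_eq_of_lt_le (by linarith) (by rw [Nat.add_mul]; omega)
    omega
  refine ⟨fun a r => {v | ∃ i, r * n ≤ i ∧ i ≤ r * n + (n - 1) ∧ v ∈ E a i}, ?_, ?_, ?_, ?_, ?_⟩
  · intro a ha r hr
    refine Cn.chain (by omega) (fun i h1 h2 => hEc a i (hidx r hr i h2)) ?_
    intro i h1 h2
    obtain ⟨u, hu, v, hv, e⟩ := hBa (J a) i (hidx r hr _ h2)
    exact ⟨u, hBE _ _ hu, v, hBE _ _ hv, e⟩
  · rintro a ha r hr a' ha' r' hr' v ⟨i, h1, h2, h3⟩ ⟨i', h1', h2', h3'⟩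
    obtain ⟨rfl, rfl⟩ := hEd a ha i (hidx r hr i h2) a' ha' i' (hidx r' hr' i' h2') v h3 h3'
    exact ⟨rfl, hdivu r r' i h1 h2 h1' h2'⟩
  · intro a ha r hr
    have e1 : (r + 1) * n = r * n + n := by ring
    obtain ⟨u, hu, v, hv, e⟩ := hBa (J a) (r * n + (n - 1))
      (hidx (r + 1) hr _ (by omega))
    exact ⟨u, ⟨_, by omega, le_rfl, hBE _ _ hu⟩, v, ⟨_, by omega, by omega, hBE _ _ hv⟩, e⟩
  · intro a ha r hr
    have hi : r * n + a < n * l := hidx r hr _ (by omega)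
    have hmod : (r * n + a) % n = a := by
      rw [Nat.add_comm, Nat.add_mul_mod_self_right, Nat.mod_eq_of_lt (by omega)]
    obtain ⟨x, hx⟩ := (hB (J a) _ hi).1
    obtain ⟨y, hy⟩ := (hB (J (a + 1)) _ hi).1
    have hr := layer (B := fun j => B j (r * n + a)) (fun j => hBP j _) hPd (fun j => hB j _ hi)
      (hKB _ hi) (hw _ hi a ha) hx hy
    have hyE : ¬ y ∈ E a (r * n + a) := by
      intro h
      have := hEd a (by omega) _ hi (a + 1) ha _ hi y h (hBE _ _ hy)
      omega
    obtain ⟨u, v, hu, hv, huS, hvS, e, -⟩ := hr.exit (fun v => v ∈ E a (r * n + a)) (hBE _ _ hx) hyE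
    refine ⟨u, ⟨_, by omega, by omega, hu⟩, v, ⟨r * n + a, by omega, by omega, hBE _ _ ?_⟩, e⟩
    have hcl : v ∈ B (J a) (r * n + a) ∪ U (r * n + a) → False := by
      intro h
      apply hv
      refine Or.inr ⟨hmod, ?_⟩
      rcases hu with hu | ⟨-, x, hx, hxu⟩
      · exact ⟨u, hu, Rch.edge (Set.mem_union_left _ hu) h e⟩
      · exact ⟨x, hx, hxu.step e h⟩
    rcases hvS with (h | h) | h
    · exact (hcl (Or.inl h)).elim
    · exact h
    · exact (hcl (Or.inr h)).elim
  · intro a ha v hv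
    exact ⟨0, by omega, by omega, hBE _ _ hv⟩

theorem Lk.monoG {V : Type} {G G' : SimpleGraph V} {A B : Set V} {d : ℕ} {f : Fin d → ℕ → V}
    {len : Fin d → ℕ} (h : G ≤ G') (L : Lk G A B d f len) : Lk G' A B d f len :=
  ⟨L.st, L.fin, fun j t ht => h (L.adj j t ht), L.inj, L.trA, L.trB⟩

/-- pigeonhole with an embedding of `Fin M` -/
theorem pigeon {n0 M c : ℕ} {α : Type} [Finite α] (hα : Nat.card α ≤ c) (g : Fin n0 → α)
    (h : c * M < n0) : ∃ (x : α) (e : Fin M → Fin n0), Function.Injective e ∧ ∀ i, g (e i) = x := by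
  classical
  have := Fintype.ofFinite α
  rw [Nat.card_eq_fintype_card] at hα
  obtain ⟨x, -, hx⟩ := Finset.exists_lt_card_fiber_of_mul_lt_card_of_maps_to
    (s := (Finset.univ : Finset (Fin n0))) (t := (Finset.univ : Finset α)) (f := g) (n := M)
    (fun _ _ => Finset.mem_univ _) (by
      simp only [Finset.card_univ, Fintype.card_fin]
      exact lt_of_le_of_lt (Nat.mul_le_mul_right M hα) h)
  refine ⟨x, fun i => (Finset.univ.filter fun a => g a = x).orderEmbOfFin rfl (Fin.castLE hx.le i), ?_, ?_⟩
  · intro i i' h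
    simpa using h
  · intro i
    have := Finset.orderEmbOfFin_mem (Finset.univ.filter fun a => g a = x) rfl (Fin.castLE hx.le i)
    exact (Finset.mem_filter.1 this).2

theorem grid_lemma {V : Type} [Finite V] {G : SimpleGraph V} {A B : Set V} {d n0 n l : ℕ}
    {f : Fin d → ℕ → V} {len : Fin d → ℕ} {H : Fin n0 → Set V} (hn : 0 < n) (hl : 0 < l)
    (hd : n ^ n < d)
    (hn0 : d ^ n * ((n * l) * ((n * l) * d)) < n0) (L : Lk G A B d f len)
    (hdis : ∀ i i' v, v ∈ H i → v ∈ H i' → i = i') (hcn : ∀ i, Cn G (H i))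
    (hHA : ∀ i, ∀ v ∈ H i, v ∉ A) (hhit : ∀ i j, ∃ t, t ≤ len j ∧ f j t ∈ H i)
    (hNR : ∀ i j t, t < len j → f j t ∉ H i → f j (t + 1) ∈ H i →
      ¬ ∃ f' len', Lk ((Fgr G f len H).deleteEdges {s(f j t, f j (t + 1))}) A B d f' len') :
    ∃ D : ℕ → ℕ → Set V, (∀ a < n, ∀ r < l, Cn G (D a r)) ∧
      (∀ a < n, ∀ r < l, ∀ a' < n, ∀ r' < l, ∀ v, v ∈ D a r → v ∈ D a' r' → a = a' ∧ r = r') ∧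
      (∀ a < n, ∀ r, r + 1 < l → ∃ u ∈ D a r, ∃ v ∈ D a (r + 1), G.Adj u v) ∧
      (∀ a, a + 1 < n → ∀ r < l, ∃ u ∈ D a r, ∃ v ∈ D (a + 1) r, G.Adj u v) ∧
      (∀ a < n, (D a 0 ∩ A).Nonempty) := by
  classical
  have hd0 : 0 < d := by omega
  have hpat : ∀ i, ∃ J : ℕ → Fin d, (∀ a < n, ∀ b < n, J a = J b → a = b) ∧
      ∀ a, a + 1 < n → Rch (offR G (PS f len) (H i))
        {u | u = J a ∨ u = J (a + 1) ∨ ∀ b < n, u ≠ J b} (J a) (J (a + 1)) := by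
    intro i
    refine pattern (offR_conn hd0 (hcn i) ?_) hd
    intro j
    obtain ⟨t, ht, hf⟩ := hhit i j
    exact ⟨_, hf, t, ht, rfl⟩
  choose J hJ hJw using hpat
  obtain ⟨J0, e, he, hJ0⟩ := pigeon (c := d ^ n) (M := (n * l) * ((n * l) * d))
    (α := Fin n → Fin d) (by simp) (fun i a => J i a) hn0
  obtain ⟨K, c, hK, hc0, hcN, hclt, hcK⟩ := ladder (N := n * l) (H := fun i => H (e i)) hd0
    (Nat.mul_pos hn hl) le_rfl L (fun i i' v h h' => he (hdis _ _ v h h')) (fun i => hcn _)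
    (fun i => hHA _) (fun i => hhit _) (by
      rintro i j t ht h1 h2 ⟨f', len', L'⟩
      refine hNR (e i) j t ht h1 h2 ⟨f', len', L'.monoG ?_⟩
      intro x y hxy
      rw [deleteEdges_adj] at hxy ⊢
      refine ⟨⟨hxy.1.1, ?_⟩, hxy.2⟩
      exact hxy.1.2.imp id (fun ⟨i, h⟩ => ⟨e i, h⟩))
  have hcm : ∀ j i i', i ≤ i' → i' ≤ n * l → c j i ≤ c j i' := by
    intro j i i' h
    induction i', h using Nat.le_induction with
    | base => intro; exact le_rfl
    | succ m hm ih =>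
      intro h
      have := ih (by omega)
      have := hclt j m (by omega)
      omega
  let Jx : ℕ → Fin d := J (e (K 0))
  have hJx : ∀ i a, a < n → J (e (K i)) a = Jx a := by
    intro i a ha
    have h1 := congrFun (hJ0 (K i)) ⟨a, ha⟩
    have h2 := congrFun (hJ0 (K 0)) ⟨a, ha⟩
    exact h1.trans h2.symm
  let Bs : Fin d → ℕ → Set V := fun j i => {v | i < n * l ∧ ∃ t, c j i ≤ t ∧ t < c j (i + 1) ∧ f j t = v}
  have hBl : ∀ j i t, i < n * l → t < c j (i + 1) → t ≤ len j := by
    intro j i t hi ht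
    have := hcm j (i + 1) (n * l) (by omega) le_rfl
    rw [hcN] at this
    omega
  obtain ⟨D, h1, h2, h3, h4, h5⟩ := strip_grid (G := G) (l := l) hn (P := PS f len) (B := Bs)
    (K := fun i => H (e (K i))) (J := Jx)
    (by rintro j i v ⟨hi, t, h1, h2, rfl⟩; exact ⟨t, hBl j i t hi h2, rfl⟩)
    (by rintro j j' v ⟨t, ht, rfl⟩ ⟨t', ht', h⟩; exact (L.inj _ _ _ _ ht ht' h.symm).1)
    (by
      rintro j i i' v ⟨hi, t, h1, h2, rfl⟩ ⟨hi', t', h1', h2', h⟩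
      have := (L.inj _ _ _ _ (hBl j i t hi h2) (hBl j i' t' hi' h2') h.symm).2
      subst this
      by_contra hne
      rcases Nat.lt_or_gt_of_ne hne with hlt | hlt
      · have := hcm j (i + 1) i' hlt hi'.le
        omega
      · have := hcm j (i' + 1) i hlt hi.le
        omega)
    (by
      intro j i hi
      have hlt := hclt j i hi
      have := Cn.ofSeq (G := G) (f := f j) (a := c j i) (b := c j (i + 1) - 1) (by omega)
        (fun t h1 h2 => L.adj j t (by have := hBl j i (t + 1) hi (by omega); omega))
      convert this using 1
      ext v; constructor
      · rintro ⟨-, t, h1, h2, h3⟩; exact ⟨t, h1, by omega, h3⟩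
      · rintro ⟨t, h1, h2, h3⟩; exact ⟨hi, t, h1, by omega, h3⟩)
    (by
      intro j i hi
      have hlt := hclt j i (by omega)
      have hlt' := hclt j (i + 1) hi
      refine ⟨f j (c j (i + 1) - 1), ⟨by omega, _, by omega, by omega, rfl⟩, f j (c j (i + 1)),
        ⟨hi, _, le_rfl, hlt', rfl⟩, ?_⟩
      have := L.adj j (c j (i + 1) - 1) (by have := hBl j (i + 1) _ hi hlt'; omega)
      rwa [show c j (i + 1) - 1 + 1 = c j (i + 1) by omega] at this)
    (fun i hi i' hi' v h h' => hK i hi i' hi' (he (hdis _ _ v h h')))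
    (by
      rintro i hi j v hv ⟨t, ht, rfl⟩
      have := hcK i hi j t ht hv
      exact ⟨hi, t, this.1, this.2, rfl⟩)
    (hJ _)
    (by
      intro i hi a ha
      have := hJw (e (K i)) a ha
      rw [hJx i a (by omega), hJx i (a + 1) ha] at this
      refine this.mono ?_
      rintro u (h | h | h)
      · exact Or.inl h
      · exact Or.inr (Or.inl h)
      · refine Or.inr (Or.inr fun b hb => ?_)
        rw [← hJx i b hb]; exact h b hb)
  refine ⟨D, h1, h2, h3, h4, fun a ha => ⟨f (Jx a) 0, h5 a ha ?_, L.st _⟩⟩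
  have := hclt (Jx a) 0 (Nat.mul_pos hn hl)
  exact ⟨Nat.mul_pos hn hl, 0, by rw [hc0], by omega, rfl⟩


/-! ## Clique or grid -/
section cog
variable {V : Type} [Finite V] {G : SimpleGraph V} {A B : Set V} {d D : ℕ} {ι : Type}

theorem Lk.sub {f : Fin D → ℕ → V} {len : Fin D → ℕ} (L : Lk G A B D f len) (z : Fin d → Fin D)
    (hz : Function.Injective z) : Lk G A B d (fun j => f (z j)) (fun j => len (z j)) :=
  ⟨fun j => L.st _, fun j => L.fin _, fun j => L.adj _,
    fun j t j' t' h h' e => ⟨hz (L.inj _ _ _ _ h h' e).1, (L.inj _ _ _ _ h h' e).2⟩,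
    fun j => L.trA _, fun j => L.trB _⟩

/-- linkage edges not inside a member of `H` -/
def cst (H : ι → Set V) (f : Fin D → ℕ → V) (len : Fin D → ℕ) : Set (Sym2 V) :=
  {e | (∃ j t, t < len j ∧ e = s(f j t, f j (t + 1))) ∧ ¬ ∃ i, ∀ v ∈ e, v ∈ H i}

theorem optimal (H : ι → Set V) (h : ∃ f len, Lk G A B D f len) :
    ∃ f len, Lk G A B D f len ∧ ∀ f' len', Lk G A B D f' len' →
      (cst H f len).ncard ≤ (cst H f' len').ncard := by
  classical
  have hex : ∃ c, ∃ f len, Lk G A B D f len ∧ (cst H f len).ncard = c := by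
    obtain ⟨f, len, L⟩ := h
    exact ⟨_, f, len, L, rfl⟩
  obtain ⟨f, len, L, hc⟩ := Nat.find_spec hex
  refine ⟨f, len, L, fun f' len' L' => ?_⟩
  rw [hc]
  exact Nat.find_min' hex ⟨f', len', L', rfl⟩

theorem no_reroute {H : ι → Set V} {f : Fin D → ℕ → V} {len : Fin D → ℕ} (L : Lk G A B D f len)
    (hopt : ∀ f' len', Lk G A B D f' len' → (cst H f len).ncard ≤ (cst H f' len').ncard)
    (hAB : Disjoint A B) (hdis : ∀ i i' v, v ∈ H i → v ∈ H i' → i = i')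
    (z : Fin d → Fin D) (hz : Function.Injective z) {κ : Type} (e : κ → ι)
    (hoff : ∀ i j t, t ≤ len j → f j t ∈ H (e i) → j ∈ range z)
    (i : κ) (j : Fin d) (t : ℕ) (ht : t < len (z j)) (h1 : f (z j) t ∉ H (e i))
    (h2 : f (z j) (t + 1) ∈ H (e i)) :
    ¬ ∃ f' len', Lk ((Fgr G (fun j => f (z j)) (fun j => len (z j)) (fun i => H (e i))).deleteEdges
      {s(f (z j) t, f (z j) (t + 1))}) A B d f' len' := by
  classical
  rintro ⟨f', len', L'⟩
  have hgz : ∀ j', ∃ (g : ℕ → V) (l : ℕ), (∃ a, z a = j' ∧ g = f' a ∧ l = len' a) ∨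
      (j' ∉ range z ∧ g = f j' ∧ l = len j') := by
    intro j'
    by_cases h : ∃ a, z a = j'
    · obtain ⟨a, ha⟩ := h
      exact ⟨_, _, Or.inl ⟨a, ha, rfl, rfl⟩⟩
    · exact ⟨_, _, Or.inr ⟨h, rfl, rfl⟩⟩
  choose g l hg using hgz
  have hlen : ∀ a, 0 < len' a := by
    intro a
    by_contra h
    have h0 : len' a = 0 := by omega
    have := L'.fin a
    rw [h0] at this
    exact Set.disjoint_left.1 hAB (L'.st a) this
  have hFadj : ∀ a s, s < len' a → G.Adj (f' a s) (f' a (s + 1)) ∧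
      ((∃ j' t', t' < len (z j') ∧ s(f' a s, f' a (s + 1)) = s(f (z j') t', f (z j') (t' + 1))) ∨
        ∃ i, f' a s ∈ H (e i) ∧ f' a (s + 1) ∈ H (e i)) ∧
      s(f' a s, f' a (s + 1)) ≠ s(f (z j) t, f (z j) (t + 1)) := by
    intro a s hs
    have := L'.adj a s hs
    rw [deleteEdges_adj] at this
    exact ⟨this.1.1, this.1.2, this.2⟩
  have hvert : ∀ a s, s ≤ len' a → (∃ j' t', t' ≤ len (z j') ∧ f' a s = f (z j') t') ∨
      ∃ i, f' a s ∈ H (e i) := by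
    intro a s hs
    rcases Nat.lt_or_ge s (len' a) with h | h
    · rcases (hFadj a s h).2.1 with ⟨j', t', ht', hE⟩ | ⟨i, hi, -⟩
      · rw [Sym2.eq_iff] at hE
        rcases hE with ⟨h1, -⟩ | ⟨h1, -⟩
        · exact Or.inl ⟨j', t', ht'.le, h1⟩
        · exact Or.inl ⟨j', t' + 1, ht', h1⟩
      · exact Or.inr ⟨i, hi⟩
    · have hl := hlen a
      have hs' : s = s - 1 + 1 := by omega
      have := hFadj a (s - 1) (by omega)
      rw [← hs'] at this
      rcases this.2.1 with ⟨j', t', ht', hE⟩ | ⟨i, -, hi⟩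
      · rw [Sym2.eq_iff] at hE
        rcases hE with ⟨-, h1⟩ | ⟨-, h1⟩
        · exact Or.inl ⟨j', t' + 1, ht', h1⟩
        · exact Or.inl ⟨j', t', ht'.le, h1⟩
      · exact Or.inr ⟨i, hi⟩
  have hcross : ∀ a s j' t', s ≤ len' a → t' ≤ len j' → j' ∉ range z → f' a s ≠ f j' t' := by
    intro a s j' t' hs ht' hj' heq
    rcases hvert a s hs with ⟨j2, t2, h2, h3⟩ | ⟨i, hi⟩
    · have := (L.inj _ _ _ _ ht' h2 (heq.symm.trans h3)).1
      exact hj' ⟨j2, this.symm⟩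
    · rw [heq] at hi
      exact hj' (hoff i j' t' ht' hi)
  have Lg : Lk G A B D g l := by
    refine ⟨?_, ?_, ?_, ?_, ?_, ?_⟩
    · intro j'
      rcases hg j' with ⟨a, ha, h1, h2⟩ | ⟨h0, h1, h2⟩ <;> rw [h1]
      exacts [L'.st a, L.st _]
    · intro j'
      rcases hg j' with ⟨a, ha, h1, h2⟩ | ⟨h0, h1, h2⟩ <;> rw [h1, h2]
      exacts [L'.fin a, L.fin _]
    · intro j' s hs
      rcases hg j' with ⟨a, ha, h1, h2⟩ | ⟨h0, h1, h2⟩ <;> rw [h1] <;> rw [h2] at hs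
      exacts [(hFadj a s hs).1, L.adj _ _ hs]
    · intro j1 s1 j2 s2 hs1 hs2 heq
      rcases hg j1 with ⟨a, ha, h1, h2⟩ | ⟨h0, h1, h2⟩ <;>
      rcases hg j2 with ⟨a', ha', h1', h2'⟩ | ⟨h0', h1', h2'⟩ <;>
      rw [h1, h1'] at heq <;> rw [h2] at hs1 <;> rw [h2'] at hs2
      · obtain ⟨h3, h4⟩ := L'.inj _ _ _ _ hs1 hs2 heq
        subst h3
        exact ⟨ha.symm.trans ha', h4⟩
      · exact (hcross _ _ _ _ hs1 hs2 h0' heq).elim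
      · exact (hcross _ _ _ _ hs2 hs1 h0 heq.symm).elim
      · exact L.inj _ _ _ _ hs1 hs2 heq
    · intro j' s hs hA
      rcases hg j' with ⟨a, ha, h1, h2⟩ | ⟨h0, h1, h2⟩ <;> rw [h1] at hA <;> rw [h2] at hs
      exacts [L'.trA a s hs hA, L.trA _ s hs hA]
    · intro j' s hs hA
      rcases hg j' with ⟨a, ha, h1, h2⟩ | ⟨h0, h1, h2⟩ <;> rw [h1] at hA <;> rw [h2] at hs ⊢
      exacts [L'.trB a s hs hA, L.trB _ s hs hA]
  have hlt : (cst H g l).ncard < (cst H f len).ncard := by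
    have hnot : s(f (z j) t, f (z j) (t + 1)) ∉ cst H g l := by
      rintro ⟨⟨j', s, hs, heq⟩, -⟩
      rcases hg j' with ⟨a, ha, h1', h2'⟩ | ⟨h0, h1', h2'⟩ <;> rw [h1'] at heq <;> rw [h2'] at hs
      · exact (hFadj a s hs).2.2 heq.symm
      · exact h0 ⟨j, (L.edge_inj ht hs heq).1⟩
    have hin : s(f (z j) t, f (z j) (t + 1)) ∈ cst H f len := by
      refine ⟨⟨z j, t, ht, rfl⟩, ?_⟩
      rintro ⟨i', hi'⟩
      have a1 := hi' (f (z j) t) (by simp)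
      have a2 := hi' (f (z j) (t + 1)) (by simp)
      rw [hdis _ _ _ a2 h2] at a1
      exact h1 a1
    refine ncard_lt_ncard ⟨?_, fun h => hnot (h hin)⟩ (toFinite _)
    rintro E ⟨⟨j', s, hs, rfl⟩, hE⟩
    refine ⟨?_, hE⟩
    rcases hg j' with ⟨a, ha, h1', h2'⟩ | ⟨h0, h1', h2'⟩ <;> rw [h1'] at hE ⊢ <;> rw [h2'] at hs
    · rcases (hFadj a s hs).2.1 with ⟨j2, t2, h3, h4⟩ | ⟨i', h3, h4⟩
      · exact ⟨z j2, t2, h3, h4⟩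
      · refine (hE ⟨e i', ?_⟩).elim
        intro v hv
        rw [Sym2.mem_iff] at hv
        rcases hv with rfl | rfl <;> assumption
    · exact ⟨j', s, hs, rfl⟩
  exact absurd (hopt g l Lg) (by omega)

theorem enum_set {N : ℕ} (Z : Set (Fin N)) (k : ℕ) (h : k ≤ Z.ncard) :
    ∃ z : Fin k → Fin N, Function.Injective z ∧ ∀ a, z a ∈ Z := by
  classical
  have e : Fin Z.ncard ≃ Z := (Finite.equivFinOfCardEq (by rw [Nat.card_coe_set_eq])).symm
  exact ⟨fun a => e (Fin.castLE h a), fun a b hab => by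
    have := e.injective (Subtype.ext hab)
    simpa using this, fun a => (e _).2⟩

def IsGr (G : SimpleGraph V) (A : Set V) (n l : ℕ) (D : ℕ → ℕ → Set V) : Prop :=
  (∀ a < n, ∀ r < l, Cn G (D a r)) ∧
      (∀ a < n, ∀ r < l, ∀ a' < n, ∀ r' < l, ∀ v, v ∈ D a r → v ∈ D a' r' → a = a' ∧ r = r') ∧
      (∀ a < n, ∀ r, r + 1 < l → ∃ u ∈ D a r, ∃ v ∈ D a (r + 1), G.Adj u v) ∧
      (∀ a, a + 1 < n → ∀ r < l, ∃ u ∈ D a r, ∃ v ∈ D (a + 1) r, G.Adj u v) ∧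
      (∀ a < n, (D a 0 ∩ A).Nonempty)

theorem IsGr.monoG {G' : SimpleGraph V} {n l : ℕ} {D : ℕ → ℕ → Set V} (h : G ≤ G')
    (hg : IsGr G A n l D) : IsGr G' A n l D := by
  obtain ⟨h1, h2, h3, h4, h5⟩ := hg
  refine ⟨fun a ha r hr => (h1 a ha r hr).monoG h, h2, ?_, ?_, h5⟩
  · intro a ha r hr
    obtain ⟨u, hu, v, hv, e⟩ := h3 a ha r hr
    exact ⟨u, hu, v, hv, h e⟩
  · intro a ha r hr
    obtain ⟨u, hu, v, hv, e⟩ := h4 a ha r hr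
    exact ⟨u, hu, v, hv, h e⟩

theorem thr_le {C A : Set V} : thr G C A ≤ G := fun _ _ h => h.1

/-- bounds -/
def pB (n l s : ℕ) : ℕ → ℕ
  | 0 => n ^ n + s + 1
  | x + 1 => 2 * pB n l s x + (x * 2 ^ (2 * pB n l s x)) *
      ((2 * pB n l s x) ^ n * ((n * l) * ((n * l) * (2 * pB n l s x))) + 1) + 1

theorem pB_ge (n l s x : ℕ) : n ^ n + s + 1 ≤ pB n l s x := by
  induction x with
  | zero => exact le_rfl
  | succ x ih => rw [pB]; omega

set_option maxHeartbeats 2000000 in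
theorem cog {ε : Type} {A B : ε → Set V} {C : Set V} {n l s : ℕ} (hn : 0 < n) (hl : 0 < l)
    (hAB : ∀ e, Disjoint (A e) (B e)) (hAC : ∀ e, Disjoint (A e) C) (hBC : ∀ e, Disjoint (B e) C)
    (x : ℕ) : ∀ (S : Finset ε) (Ω : Set V), S.card = x →
    (∀ e ∈ S, ∃ f len, Lk (thr G (C \ Ω) (A e ∪ B e)) (A e) (B e) (pB n l s x) f len) →
    (∃ e ∈ S, ∃ D, IsGr G (A e) n l D) ∨
    ∃ W : ε → Set V, (∀ e ∈ S, Cn G (W e) ∧ W e ⊆ C \ Ω ∧ (∃ u ∈ W e, ∃ v ∈ A e, G.Adj u v) ∧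
      ∃ u ∈ W e, ∃ v ∈ B e, G.Adj u v) ∧
      ∀ e ∈ S, ∀ e' ∈ S, ∀ v, v ∈ W e → v ∈ W e' → e = e' := by
  classical
  induction x with
  | zero =>
    intro S Ω hS _
    rw [Finset.card_eq_zero] at hS
    subst hS
    exact Or.inr ⟨fun _ => ∅, by simp, by simp⟩
  | succ x ih =>
    intro S Ω hS hlk
    obtain ⟨e0, he0⟩ : S.Nonempty := Finset.card_pos.1 (by omega)
    obtain ⟨p, hp⟩ : ∃ p, p = pB n l s x := ⟨_, rfl⟩
    obtain ⟨P, hP⟩ : ∃ P, P = pB n l s (x + 1) := ⟨_, rfl⟩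
    rw [← hP] at hlk
    obtain ⟨g, lg, Lg⟩ := hlk e0 he0
    have hpge : n ^ n + s + 1 ≤ p := hp ▸ pB_ge n l s x
    have hPeq : P = 2 * p + (x * 2 ^ (2 * p)) * ((2 * p) ^ n * ((n * l) * ((n * l) * (2 * p))) + 1) + 1 := by
      rw [hP, hp, pB]
    have hS' : (S.erase e0).card = x := by rw [Finset.card_erase_of_mem he0]; omega
    -- the sets H
    let H : Fin P → Set V := fun Q => {v | ∃ t, 1 ≤ t ∧ t ≤ lg Q - 1 ∧ g Q t = v}
    have hlg : ∀ Q, 2 ≤ lg Q := by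
      intro Q
      by_contra hcon
      have h0 := Lg.st Q
      have h1 := Lg.fin Q
      rcases Nat.lt_or_ge (lg Q) 1 with h | h
      · rw [show lg Q = 0 by omega] at h1
        exact Set.disjoint_left.1 (hAB e0) h0 h1
      · have h2 := Lg.adj Q 0 (by omega)
        rw [show lg Q = 0 + 1 by omega] at h1
        rcases h2.2 with h | h | h
        · exact Set.disjoint_left.1 (hAC e0) h0 h.1.1
        · exact Set.disjoint_left.1 (hAC e0) h0 h.1.1
        · exact Set.disjoint_left.1 (hBC e0) h1 h.2.1
    have hHin : ∀ Q t, 1 ≤ t → t ≤ lg Q - 1 → g Q t ∈ C \ Ω := by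
      intro Q t h1 h2
      have h3 := hlg Q
      have h4 := Lg.adj Q t (by omega)
      rcases h4.2 with h | h | h
      · exact h.1
      · exact h.1
      · exfalso
        rcases h.1 with h | h
        · have := Lg.trA Q t (by omega) h; omega
        · have := Lg.trB Q t (by omega) h; omega
    have hHC : ∀ Q, H Q ⊆ C \ Ω := by
      rintro Q v ⟨t, h1, h2, rfl⟩
      exact hHin Q t h1 h2
    have hHcn : ∀ Q Z, Cn (thr G (C \ Ω) Z) (H Q) := by
      intro Q Z
      have h3 := hlg Q
      refine Cn.ofSeq (by omega) ?_
      intro t h1 h2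
      exact ⟨(Lg.adj Q t (by omega)).1, Or.inl ⟨hHin Q t h1 (by omega), hHin Q (t + 1) (by omega) (by omega)⟩⟩
    have hHd : ∀ i i' v, v ∈ H i → v ∈ H i' → i = i' := by
      rintro i i' v ⟨t, h1, h2, rfl⟩ ⟨t', h1', h2', h⟩
      exact (Lg.inj _ _ _ _ (by omega) (by omega) h.symm).1
    -- optimal linkages
    have hop : ∀ e : {e // e ∈ S.erase e0}, ∃ f len,
        Lk (thr G (C \ Ω) (A e ∪ B e)) (A e) (B e) (2 * p) f len ∧ ∀ f' len',
          Lk (thr G (C \ Ω) (A e ∪ B e)) (A e) (B e) (2 * p) f' len' →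
          (cst H f len).ncard ≤ (cst H f' len').ncard := by
      intro e
      apply optimal
      obtain ⟨f, len, L⟩ := hlk e (Finset.mem_of_mem_erase e.2)
      exact ⟨_, _, L.sub (Fin.castLE (by omega : 2 * p ≤ P)) (Fin.castLE_injective _)⟩
    choose f len L hopt using hop
    let hit : {e // e ∈ S.erase e0} → Fin P → Set (Fin (2 * p)) :=
      fun e Q => {j | ∃ t, t ≤ len e j ∧ f e j t ∈ H Q}
    by_cases hc : ∃ Q, ∀ e, (hit e Q).ncard ≤ p
    · obtain ⟨Q, hQ⟩ := hc
      have := ih (S.erase e0) (Ω ∪ H Q) hS' (by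
        intro e he
        rw [← hp]
        have h1 := hQ ⟨e, he⟩
        have h2 := ncard_add_ncard_compl (hit ⟨e, he⟩ Q)
        rw [Nat.card_eq_fintype_card, Fintype.card_fin] at h2
        obtain ⟨z, hz, hzZ⟩ := enum_set (hit ⟨e, he⟩ Q)ᶜ p (by omega)
        have L' := (L ⟨e, he⟩).sub z hz
        refine ⟨_, _, L'.st, L'.fin, ?_, L'.inj, L'.trA, L'.trB⟩
        intro j t ht
        have h3 := L'.adj j t ht
        have h4 : ∀ t' ≤ len ⟨e, he⟩ (z j), f ⟨e, he⟩ (z j) t' ∉ H Q :=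
          fun t' ht' hh => hzZ j ⟨t', ht', hh⟩
        have h5 := h4 t ht.le
        have h6 := h4 (t + 1) ht
        refine ⟨h3.1, ?_⟩
        have key : ∀ v, v ∉ H Q → v ∈ C \ Ω → v ∈ C \ (Ω ∪ H Q) :=
          fun v h1 h2 => ⟨h2.1, fun h => h.elim h2.2 h1⟩
        rcases h3.2 with h7 | h7 | h7
        · exact Or.inl ⟨key _ h5 h7.1, key _ h6 h7.2⟩
        · exact Or.inr (Or.inl ⟨key _ h5 h7.1, h7.2⟩)
        · exact Or.inr (Or.inr ⟨h7.1, key _ h6 h7.2⟩))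
      rcases this with ⟨e, he, h⟩ | ⟨W, hW, hWd⟩
      · exact Or.inl ⟨e, Finset.mem_of_mem_erase he, h⟩
      · have h3 := hlg Q
        refine Or.inr ⟨Function.update W e0 (H Q), ?_, ?_⟩
        · intro e he
          by_cases h : e = e0
          · subst h
            rw [Function.update_self]
            refine ⟨(hHcn Q ∅).monoG thr_le, hHC Q, ⟨g Q 1, ⟨1, le_rfl, by omega, rfl⟩, g Q 0,
              Lg.st Q, (Lg.adj Q 0 (by omega)).1.symm⟩, ⟨g Q (lg Q - 1), ⟨lg Q - 1, by omega, le_rfl, rfl⟩,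
              g Q (lg Q), Lg.fin Q, ?_⟩⟩
            have := (Lg.adj Q (lg Q - 1) (by omega)).1
            rwa [show lg Q - 1 + 1 = lg Q by omega] at this
          · rw [Function.update_of_ne h]
            obtain ⟨a1, a2, a3⟩ := hW e (Finset.mem_erase.2 ⟨h, he⟩)
            exact ⟨a1, fun v hv => ⟨(a2 hv).1, fun hh => (a2 hv).2 (Or.inl hh)⟩, a3⟩
        · intro e he e' he' v hv hv'
          by_cases h : e = e0 <;> by_cases h' : e' = e0
          · rw [h, h']
          · subst h
            rw [Function.update_self] at hv
            rw [Function.update_of_ne h'] at hv'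
            exact absurd (Or.inr hv) ((hW e' (Finset.mem_erase.2 ⟨h', he'⟩)).2.1 hv').2
          · subst h'
            rw [Function.update_self] at hv'
            rw [Function.update_of_ne h] at hv
            exact absurd (Or.inr hv') ((hW e (Finset.mem_erase.2 ⟨h, he⟩)).2.1 hv).2
          · rw [Function.update_of_ne h] at hv
            rw [Function.update_of_ne h'] at hv'
            exact hWd e (Finset.mem_erase.2 ⟨h, he⟩) e' (Finset.mem_erase.2 ⟨h', he'⟩) v hv hv'
    · push Not at hc
      choose E hE using hc
      obtain ⟨⟨e, Z⟩, emb, hemb, hZ⟩ := pigeon (c := x * 2 ^ (2 * p))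
        (M := (2 * p) ^ n * ((n * l) * ((n * l) * (2 * p))) + 1)
        (α := {e // e ∈ S.erase e0} × Set (Fin (2 * p))) (by
          have h1 : Nat.card {e // e ∈ S.erase e0} = x := by
            rw [Nat.card_eq_fintype_card, Fintype.card_coe, hS']
          have h2 : Nat.card (Set (Fin (2 * p))) = 2 ^ (2 * p) := by simp
          rw [Nat.card_prod, h1, h2])
        (fun Q => (E Q, hit (E Q) Q)) (by omega)
      have hZ' : ∀ i, hit e (emb i) = Z := by
        intro i
        have h1 := hZ i
        rw [Prod.mk.injEq] at h1
        rw [← h1.1]; exact h1.2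
      have hZp : p < Z.ncard := by
        have h1 := hZ ⟨0, by omega⟩
        rw [Prod.mk.injEq] at h1
        rw [← h1.2]; exact hE _
      have hZ2 : Z.ncard ≤ 2 * p := by
        have := ncard_le_ncard (subset_univ Z) (toFinite _)
        rwa [ncard_univ, Nat.card_eq_fintype_card, Fintype.card_fin] at this
      obtain ⟨z, hz, hzZ⟩ := enum_set Z Z.ncard le_rfl
      have hzr : range z = Z := by
        apply eq_of_subset_of_ncard_le (by rintro _ ⟨a, rfl⟩; exact hzZ a)
        rw [← image_univ, ncard_image_of_injective _ hz, ncard_univ]; simp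
      obtain ⟨D, hD⟩ := grid_lemma (n := n) (l := l) (H := fun i => H (emb i)) hn hl (by omega) (by
          apply Nat.lt_succ_of_le
          gcongr) ((L e).sub z hz) (fun i i' v h h' => hemb (hHd _ _ v h h'))
        (fun i => hHcn _ _) (fun i v hv hA => Set.disjoint_left.1 (hAC e) hA (hHC _ hv).1)
        (by
          intro i j
          have : z j ∈ hit e (emb i) := by rw [hZ']; exact hzZ j
          exact this)
        (by
          intro i j t ht h1 h2
          refine no_reroute (L e) (hopt e) (hAB e) hHd z hz emb ?_ i j t ht h1 h2
          intro i j t ht h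
          rw [hzr, ← hZ' i]
          exact ⟨t, ht, h⟩)
      exact Or.inl ⟨e, Finset.mem_of_mem_erase e.2, D, IsGr.monoG thr_le hD⟩
end cog


/-! ## Final assembly -/
def mB (s : ℕ) : ℕ := (s + 1) * (s + 1) * (3 * s + 2)
abbrev EB (s : ℕ) := {e : Fin (mB s) × Fin (mB s) // e.1 < e.2}
def ppB (s : ℕ) : ℕ := pB ((s + 1) * (s + 1)) (3 * s + 2) s (Fintype.card (EB s))
def wB (s : ℕ) : ℕ := 2 * (mB s * ppB s) + 1 + 2 * s

theorem clean_cols {V : Type} [Finite V] {s : ℕ} {μ : CV s → Set V}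
    (hd : ∀ x y v, v ∈ μ x → v ∈ μ y → x = y) (Y : Set V) :
    (s + 1) * (s + 1) ≤ Y.ncard + {a | ∀ r, Disjoint (μ (a, r)) Y}.ncard := by
  classical
  have h1 := ncard_add_ncard_compl {a | ∀ r, Disjoint (μ (a, r)) Y}
  rw [Nat.card_eq_fintype_card, Fintype.card_fin] at h1
  have h2 : ∀ a ∈ {a | ∀ r, Disjoint (μ (a, r)) Y}ᶜ, ∃ y ∈ Y, ∃ r, y ∈ μ (a, r) := by
    intro a ha
    simp only [mem_compl_iff, mem_ofPred_eq, not_forall, Set.not_disjoint_iff] at ha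
    obtain ⟨r, y, h, h'⟩ := ha
    exact ⟨y, h', r, h⟩
  rcases isEmpty_or_nonempty V with hV | hV
  · have : {a | ∀ r, Disjoint (μ (a, r)) Y}ᶜ = ∅ := by
      rw [eq_empty_iff_forall_notMem]
      intro a ha
      exact hV.elim (h2 a ha).choose
    rw [this, ncard_empty] at h1
    omega
  choose! y hy r hr using h2
  have h3 := ncard_le_ncard_of_injOn y hy (fun a ha b hb hab => by
    have e1 := hr a ha
    rw [hab] at e1
    exact (Prod.mk.injEq _ _ _ _ ▸ hd _ _ _ e1 (hr b hb)).1) (toFinite Y)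
  omega

theorem castle_model {V : Type} [Finite V] {G : SimpleGraph V} {w s : ℕ} {β : Set V → Set V}
    (hβ : Hav G w β) (hw : wB s ≤ w) : ∃ μ : CV s → Set V, Mdl (castle s) G μ ∧
      ∀ Y : Set V, Y.ncard < s → ∃ a, (∀ r, Disjoint (μ (a, r)) Y) ∧
        ∃ r, (μ (a, r) ∩ β Y).Nonempty := by
  classical
  have hpge := pB_ge ((s + 1) * (s + 1)) (3 * s + 2) s (Fintype.card (EB s))
  rw [← ppB] at hpge
  have hw' : 2 * (mB s * ppB s) + 1 ≤ w := by unfold wB at hw; omega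
  have hns : (s + 1) * (s + 1) = s * s + 2 * s + 1 := by ring
  obtain ⟨T, X, hT, hTc, hcard, hfree⟩ := blobs (m := mB s) (p := ppB s) hβ (by omega) hw'
  have hXw : X.ncard ≤ w := hT.le.trans (by omega)
  have hXC : Disjoint X (β X) := (hβ.comp X hXw).1.symm
  have hlk : ∀ e ∈ (Finset.univ : Finset (EB s)), ∃ f len,
      Lk (thr G (β X \ ∅) ((X ∩ T e.1.1) ∪ (X ∩ T e.1.2))) (X ∩ T e.1.1) (X ∩ T e.1.2)
        (pB ((s + 1) * (s + 1)) (3 * s + 2) s (Fintype.card (EB s))) f len := by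
    intro e _
    rw [sdiff_empty]
    exact blob_paths hβ hw' hT hcard hfree e.2.ne
  rcases cog (G := G) (ε := EB s) (A := fun e => X ∩ T e.1.1) (B := fun e => X ∩ T e.1.2)
    (C := β X) (n := (s + 1) * (s + 1)) (l := 3 * s + 2) (s := s) (by positivity) (by omega)
    (fun e => Set.disjoint_left.2 fun v h h' => e.2.ne (hT.dis _ _ v h.2 h'.2))
    (fun e => hXC.mono_left inter_subset_left) (fun e => hXC.mono_left inter_subset_left)
    _ Finset.univ ∅ Finset.card_univ hlk with ⟨e, -, D, h1, h2, h3, h4, h5⟩ | ⟨W, hW, hWd⟩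
  · have hdis : ∀ x y : CV s, ∀ v, v ∈ D x.1 x.2 → v ∈ D y.1 y.2 → x = y := by
      rintro ⟨a, r⟩ ⟨a', r'⟩ v h h'
      obtain ⟨e1, e2⟩ := h2 a a.2 r r.2 a' a'.2 r' r'.2 v h h'
      exact Prod.ext (Fin.ext e1) (Fin.ext e2)
    refine ⟨fun x => D x.1 x.2, ⟨fun x => h1 _ x.1.2 _ x.2.2, hdis, ?_⟩, ?_⟩
    · have key : ∀ x y : CV s, ((x.1 = y.1 ∧ x.2.val + 1 = y.2.val) ∨
          (x.2 = y.2 ∧ x.1.val + 1 = y.1.val ∧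
          (x.2.val < 2 * s + 1 ∨ x.1.val / (s + 1) = y.1.val / (s + 1)))) →
          ∃ u ∈ D x.1 x.2, ∃ v ∈ D y.1 y.2, G.Adj u v := by
        rintro x y (⟨e1, e2⟩ | ⟨e1, e2, -⟩)
        · have := h3 x.1 x.1.2 x.2 (by rw [e2]; exact y.2.2)
          rw [e2, e1] at this
          rw [e1]; exact this
        · have := h4 x.1 (by rw [e2]; exact y.1.2) x.2 x.2.2
          rw [e2, e1] at this
          rw [e1]; exact this
      intro x y hxy
      rw [castle, fromRel_adj] at hxy
      rcases hxy.2 with h | h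
      · exact key x y h
      · obtain ⟨u, hu, v, hv, e⟩ := key y x h
        exact ⟨v, hv, u, hu, e.symm⟩
    · intro Y hY
      have hcl := clean_cols hdis Y
      have h5' : ∀ a : Fin ((s + 1) * (s + 1)), ∃ x, x ∈ D a 0 ∩ (X ∩ T e.1.1) := fun a => h5 a a.2
      choose x hx using h5'
      have hxinj : Function.Injective x := by
        intro a b hab
        have e1 := (hx a).1
        rw [hab] at e1
        exact Fin.ext (h2 a a.2 0 (by omega) b b.2 0 (by omega) _ e1 (hx b).1).1
      obtain ⟨v, hv, a, ha, rfl⟩ := free_sub hβ hXw hfree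
        (X' := x '' {a | ∀ r : Fin (3 * s + 2), Disjoint (D a r) Y}) (Y := Y)
        (by rintro _ ⟨a, -, rfl⟩; exact (hx a).2.1)
        (by rw [ncard_image_of_injective _ hxinj]; dsimp only at hcl; omega)
      exact ⟨a, ha, ⟨0, by omega⟩, x a, (hx a).1, hv⟩
  · let σ : CV s ≃ Fin (mB s) := finProdFinEquiv
    let Br : Fin (mB s) → Set V := fun i => T i ∪ ⋃ e ∈ {e : EB s | e.1.1 = i}, (T i ∪ W e)
    have hTB : ∀ i, T i ⊆ Br i := fun i => subset_union_left
    have hBr : ∀ i v, v ∈ Br i → v ∈ T i ∨ ∃ e : EB s, e.1.1 = i ∧ v ∈ W e := by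
      rintro i v (h | h)
      · exact Or.inl h
      · simp only [mem_iUnion, mem_union] at h
        obtain ⟨e, he, h | h⟩ := h
        · exact Or.inl h
        · exact Or.inr ⟨e, he, h⟩
    have hWB : ∀ e : EB s, W e ⊆ Br e.1.1 := by
      intro e v hv
      refine Or.inr ?_
      simp only [mem_iUnion]
      exact ⟨e, rfl, Or.inr hv⟩
    have hWC : ∀ e v, v ∈ W e → v ∈ β X := fun e v hv => ((hW e (Finset.mem_univ _)).2.1 hv).1
    have hdis : ∀ i j v, v ∈ Br i → v ∈ Br j → i = j := by
      intro i j v h h'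
      rcases hBr i v h with g | ⟨e, rfl, g⟩ <;> rcases hBr j v h' with g' | ⟨e', rfl, g'⟩
      · exact hT.dis _ _ v g g'
      · exact absurd (hWC _ _ g') (hT.off _ _ g)
      · exact absurd (hWC _ _ g) (hT.off _ _ g')
      · rw [hWd e (Finset.mem_univ _) e' (Finset.mem_univ _) v g g']
    have hadj : ∀ i j, i < j → ∃ u ∈ Br i, ∃ v ∈ Br j, G.Adj u v := by
      intro i j hij
      obtain ⟨-, -, -, u, hu, v, hv, e⟩ := hW ⟨(i, j), hij⟩ (Finset.mem_univ _)
      exact ⟨u, hWB ⟨(i, j), hij⟩ hu, v, hTB _ hv.2, e⟩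
    have hdis' : ∀ x y v, v ∈ Br (σ x) → v ∈ Br (σ y) → x = y :=
      fun x y v h h' => σ.injective (hdis _ _ v h h')
    refine ⟨fun x => Br (σ x), ⟨?_, hdis', ?_⟩, ?_⟩
    · intro x
      refine (hTc (σ x)).biUnion ?_
      intro e he
      have he' : e.1.1 = σ x := he
      obtain ⟨c, -, ⟨u, hu, v, hv, a⟩, -⟩ := hW e (Finset.mem_univ _)
      refine ⟨(hTc (σ x)).unionAdj c (he' ▸ hv.2) hu a.symm, ?_⟩
      obtain ⟨t, ht⟩ := (hTc (σ x)).1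
      exact ⟨t, ht, Or.inl ht⟩
    · intro x y hxy
      have hne : σ x ≠ σ y := fun h => hxy.ne (σ.injective h)
      rcases lt_or_gt_of_ne hne with h | h
      · exact hadj _ _ h
      · obtain ⟨u, hu, v, hv, e⟩ := hadj _ _ h
        exact ⟨v, hv, u, hu, e.symm⟩
    · intro Y hY
      have hcl := clean_cols (s := s) (μ := fun x => Br (σ x)) hdis' Y
      obtain ⟨a, ha⟩ : {a | ∀ r, Disjoint (Br (σ (a, r))) Y}.Nonempty := by
        rw [nonempty_iff_ne_empty]
        intro h
        rw [h, ncard_empty] at hcl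
        omega
      obtain ⟨v, hv, hvX⟩ := free_sub hβ hXw hfree (X' := X ∩ T (σ (a, ⟨0, by omega⟩))) (Y := Y)
        inter_subset_left (by rw [hcard]; omega)
      exact ⟨a, ha, ⟨0, by omega⟩, v, hTB _ hvX.2, hv⟩

theorem RtwAtMost.le {q n : ℕ} {G : SimpleGraph (Fin n)} {χ : Fin n → Finset (Fin q)} {w w' : ℕ}
    (h : RtwAtMost G χ w) (hw : w ≤ w') : RtwAtMost G χ w' := by
  obtain ⟨X, ⟨m, T, β, h1, h2⟩, h3⟩ := h
  exact ⟨X, ⟨m, T, β, h1, fun t => (h2 t).trans (by omega)⟩, h3⟩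

/-- A grid theorem for restrictive treewidth: there is a function `sg` such that every
`q`-colorful graph (with `q, k ≥ 1`) either contains a `(q,k)`-segregated grid as a
colorful minor (and then has restrictive treewidth at least `k − 1`), or has
restrictive treewidth at most `sg(q,k)`. -/
theorem grid_theorem_restrictive_treewidth :
    ∃ sg : ℕ → ℕ → ℕ,
      ∀ q k : ℕ, 1 ≤ q → 1 ≤ k →
        ∀ (n : ℕ) (G : SimpleGraph (Fin n)) (χ : Fin n → Finset (Fin q)),
          ((∃ π : Equiv.Perm (Fin q),
              IsColorfulMinor (gridGraph (q * k)) (segPalette q k π) G χ) ∧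
            ∀ w : ℕ, RtwAtMost G χ w → k - 1 ≤ w) ∨
          RtwAtMost G χ (sg q k) := by
  refine ⟨fun q k => 4 * wB (q * (q * k)) + k, ?_⟩
  intro q k hq hk n G χ
  by_cases hrt : RtwAtMost G χ (4 * wB (q * (q * k)) + k)
  · exact Or.inr hrt
  refine Or.inl ⟨?_, ?_⟩
  · obtain ⟨s, hs⟩ : ∃ s, s = q * (q * k) := ⟨_, rfl⟩
    have hw1 : 1 ≤ wB s := by unfold wB; omega
    have hws : 2 * s ≤ wB s := by unfold wB; omega
    rw [← hs] at hrt
    obtain ⟨β, hβ, hP⟩ := rtw_haven G χ (wB s) hw1 (fun h => hrt (h.le (by omega)))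
    obtain ⟨μ, hμ, hal⟩ := castle_model (s := s) hβ le_rfl
    obtain ⟨z, zinj, zcol, zfree⟩ := free_coloured hβ χ hP s hws
      (fun i => (finProdFinEquiv.symm (Fin.cast hs i)).1)
    refine castle_finish hq hk hs χ hβ (by omega) z zinj ?_ zfree μ hμ hal
    intro c r i hi
    have h1 : Fin.cast hs i = finProdFinEquiv (c, r) := Fin.ext hi
    have h2 := zcol i
    rw [h1, Equiv.symm_apply_apply] at h2
    exact h2
  · intro w hw
    by_contra hlt
    exact hrt (hw.le (by omega))
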